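/- Fix a prime p. Let K be a p-adically closed differential field with field of constants k, k ≠ K, and let A ∈ Mat_n(K). Then any two p-adic Picard–Vessiot fields for y′ = Ay over K are isomorphic as differential field extensions of K. -/

import Mathlib

/-- A derivation on a field `F`. -/
structure FieldDeriv (F : Type) [Field F] : Type where
  d : F → F
  map_add : ∀ a b : F, d (a + b) = d a + d b
  leibniz : ∀ a b : F, d (a * b) = a * d b + d a * b

/-- A valuation subring `O` of `F` witnesses that `F` is a p-adic field if `pO` is the
maximal ideal of `O` and `O/pO ≅ 𝔽_p`. -/
def PAdicWitness (p : ℕ) {F : Type} [Field F] (O : ValuationSubring F) : Prop :=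
  (Ideal.span {(p : O)}).IsMaximal ∧
    Nonempty ((O ⧸ (Ideal.span {(p : O)} : Ideal O)) ≃+* ZMod p)

/-- A field is p-adic if it admits a valuation subring witnessing this. -/
def IsPAdicField (p : ℕ) (F : Type) [Field F] : Prop :=
  ∃ O : ValuationSubring F, PAdicWitness p O

/-- A field is p-adically closed if it is p-adic and no proper algebraic extension of it
is p-adic. -/
def IsPAdicallyClosed (p : ℕ) (F : Type) [Field F] : Prop :=
  IsPAdicField p F ∧
    ∀ (E : Type) [Field E] [Algebra F E], Algebra.IsAlgebraic F E →
      IsPAdicField p E → Function.Surjective (algebraMap F E)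

/-- `L/K`, with derivations `dL` extending `dK`, is a Picard--Vessiot field for `y' = A y`. -/
def IsPicardVessiot {K L : Type} [Field K] [Field L] [Algebra K L]
    (dK : FieldDeriv K) (dL : FieldDeriv L) {n : ℕ}
    (A : Matrix (Fin n) (Fin n) K) : Prop :=
  (∀ a : K, dL.d (algebraMap K L a) = algebraMap K L (dK.d a)) ∧
  ∃ F : Matrix (Fin n) (Fin n) L, IsUnit F.det ∧
    (∀ i j, dL.d (F i j) = (A.map (algebraMap K L) * F) i j) ∧
    IntermediateField.adjoin K (Set.range fun q : Fin n × Fin n => F q.1 q.2) = ⊤ ∧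
    ∀ x : L, dL.d x = 0 → ∃ a : K, dK.d a = 0 ∧ algebraMap K L a = x

section

open Polynomial

section EtaleExtension

variable {M E Γ₀ : Type*} [Field M] [Field E] [Algebra M E] [LinearOrderedCommGroupWithZero Γ₀]

/-- The polynomials over `M` whose coefficients are integral for a valuation on an extension. -/
noncomputable def integralPolys (M : Type*) {E Γ₀ : Type*} [Field M] [Field E] [Algebra M E]
    [LinearOrderedCommGroupWithZero Γ₀] (v : Valuation E Γ₀) : Subring M[X] :=
  Polynomial.liftsRing (v.comap (algebraMap M E)).integer.subtype

theorem mem_integralPolys {v : Valuation E Γ₀} {f : M[X]} :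
    f ∈ integralPolys M v ↔ ∀ i, v (algebraMap M E (f.coeff i)) ≤ 1 := by
  change f ∈ Polynomial.lifts (v.comap (algebraMap M E)).integer.subtype ↔ _
  rw [Polynomial.lifts_iff_coeff_lifts]
  simp [Valuation.mem_integer_iff]

theorem C_mem_integralPolys {v : Valuation E Γ₀} {a : M} (ha : v (algebraMap M E a) ≤ 1) :
    C a ∈ integralPolys M v := by
  rw [mem_integralPolys]
  intro i
  rw [coeff_C]
  split_ifs <;> simp [ha]

theorem X_mem_integralPolys {v : Valuation E Γ₀} : (X : M[X]) ∈ integralPolys M v := by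
  rw [mem_integralPolys]
  intro i
  rw [coeff_X]
  split_ifs <;> simp

theorem valuation_natCast_le_one (v : Valuation E Γ₀) (n : ℕ) : v (n : E) ≤ 1 := by
  induction n with
  | zero => simp
  | succ n ih => push_cast; exact v.map_add_le ih (by simp)

theorem derivative_mem_integralPolys {v : Valuation E Γ₀} {f : M[X]} (hf : f ∈ integralPolys M v) :
    derivative f ∈ integralPolys M v := by
  rw [mem_integralPolys] at hf ⊢
  intro i
  rw [coeff_derivative, map_mul, map_mul]
  have : v (algebraMap M E ((i : M) + 1)) ≤ 1 := by
    have := valuation_natCast_le_one v (i + 1)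
    simpa using this
  exact mul_le_one' (hf _) this

theorem valuation_aeval_le_one {v : Valuation E Γ₀} {f : M[X]} (hf : f ∈ integralPolys M v)
    {x : E} (hx : v x ≤ 1) : v (aeval x f) ≤ 1 := by
  rw [mem_integralPolys] at hf
  rw [aeval_eq_sum_range]
  refine v.map_sum_le fun i _ => ?_
  rw [Algebra.smul_def, map_mul, map_pow]
  exact mul_le_one' (hf i) (pow_le_one' hx i)

theorem valuation_aeval_sub_le {v : Valuation E Γ₀} {f : M[X]} (hf : f ∈ integralPolys M v)
    {x y : E} (hx : v x ≤ 1) (hy : v y ≤ 1) : v (aeval x f - aeval y f) ≤ v (x - y) := by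
  rw [mem_integralPolys] at hf
  rw [aeval_eq_sum_range, aeval_eq_sum_range, ← Finset.sum_sub_distrib]
  refine v.map_sum_le fun i hi => ?_
  clear hi
  rw [← smul_sub, Algebra.smul_def, map_mul]
  obtain ⟨c, hc, he⟩ : ∃ c, v c ≤ 1 ∧ x ^ i - y ^ i = c * (x - y) := by
    induction i with
    | zero => exact ⟨0, by simp, by simp⟩
    | succ i ih =>
      obtain ⟨c, hc, he⟩ := ih
      refine ⟨x * c + y ^ i, v.map_add_le ?_ ?_, ?_⟩
      · rw [map_mul]; exact mul_le_one' hx hc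
      · rw [map_pow]; exact pow_le_one' hy i
      · linear_combination x * he
  rw [he, map_mul, ← mul_assoc]
  exact mul_le_of_le_one_left' (mul_le_one' (hf i) hc)

theorem exists_valuation_aeval_eq {v : Valuation E Γ₀} {f : M[X]} (hf : f ∈ integralPolys M v)
    {x y : E} (hx : v x ≤ 1) (hy : v y ≤ 1) :
    ∃ k, v k ≤ 1 ∧ aeval y f = aeval x f + aeval x (derivative f) * (y - x) + k * (y - x) ^ 2 := by
  have key : ∃ k : v.integer, (f.map (algebraMap M E)).eval y =
      (f.map (algebraMap M E)).eval x + (f.map (algebraMap M E)).derivative.eval x * (y - x)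
        + k * (y - x) ^ 2 := by
    have hl : f.map (algebraMap M E) ∈ Polynomial.lifts v.integer.subtype := by
      rw [Polynomial.lifts_iff_coeff_lifts]
      intro i
      rw [coeff_map]
      exact ⟨⟨_, (mem_integralPolys.1 hf) i⟩, rfl⟩
    obtain ⟨g, hg⟩ := (Polynomial.mem_lifts _).1 hl
    obtain ⟨k, hk⟩ := g.binomExpansion ⟨x, hx⟩ (⟨y, hy⟩ - ⟨x, hx⟩)
    refine ⟨k, ?_⟩
    have := congrArg v.integer.subtype hk
    simp only [map_add, map_mul, map_pow, map_sub] at this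
    rw [← hg, derivative_map]
    rw [← eval₂_hom, ← eval₂_hom, ← eval₂_hom] at this
    simp only [eval_map]
    simpa [Subring.subtype_apply] using this
  obtain ⟨k, hk⟩ := key
  refine ⟨k, k.2, ?_⟩
  simpa [derivative_map, eval_map_algebraMap] using hk

/-- A nonzero multiple of a polynomial relation is primitive. -/
theorem exists_primitive_relation (v : Valuation E Γ₀) {u : E} (hu : IsAlgebraic M u) :
    ∃ f ∈ integralPolys M v, aeval u f = 0 ∧ ∃ i, v (algebraMap M E (f.coeff i)) = 1 := by
  obtain ⟨f, hf0, hf⟩ := hu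
  obtain ⟨i, hi, hmax⟩ := f.support.exists_max_image (fun i => v (algebraMap M E (f.coeff i)))
    (by simpa using hf0)
  have hne : f.coeff i ≠ 0 := by simpa using hi
  have hv : v (algebraMap M E (f.coeff i)) ≠ 0 := by simpa using hne
  refine ⟨C (f.coeff i)⁻¹ * f, ?_, by simp [hf], i, by simp [hv]⟩
  rw [mem_integralPolys]
  intro j
  simp only [coeff_C_mul, map_mul, map_inv₀]
  by_cases hj : j ∈ f.support
  · rw [inv_mul_le_one₀ (zero_lt_iff.2 hv)]
    exact hmax j hj
  · have : f.coeff j = 0 := by simpa using hj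
    simp [this]

/-- An element of the valuation ring that is algebraic over the ground field is a fraction of
elements integral over the ground valuation ring, with unit denominator. -/
theorem exists_integral_fraction (v : Valuation E Γ₀) {u : E} (hu : IsAlgebraic M u)
    (hvu : v u ≤ 1) : ∃ c : E, v c = 1 ∧
      IsIntegral (v.comap (algebraMap M E)).valuationSubring c ∧
      IsIntegral (v.comap (algebraMap M E)).valuationSubring (c * u) := by
  classical
  set A := (v.comap (algebraMap M E)).valuationSubring with hA
  obtain ⟨f, hf, hfu, hprim⟩ := exists_primitive_relation v hu
  rw [mem_integralPolys] at hf
  let q : ℕ → E := fun k => aeval u (divX^[k] f)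
  have hcoeff : ∀ k i, (divX^[k] f).coeff i = f.coeff (i + k) := by
    intro k
    induction k with
    | zero => simp
    | succ k ih => intro i; rw [Function.iterate_succ_apply', coeff_divX, ih]; congr 1; ring
  have hq0 : q 0 = 0 := hfu
  have hrec : ∀ k, q k = u * q (k + 1) + algebraMap M E (f.coeff k) := by
    intro k
    have := divX_mul_X_add (divX^[k] f)
    have h2 := congrArg (aeval u) this
    simp only [map_add, map_mul, aeval_X, aeval_C, hcoeff, zero_add] at h2
    simp only [q, Function.iterate_succ_apply']
    rw [← h2]; ring
  have hqN : ∀ k, f.natDegree < k → q k = 0 := by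
    intro k hk
    have : divX^[k] f = 0 := by
      ext i
      rw [hcoeff, coeff_zero]
      exact coeff_eq_zero_of_natDegree_lt (by omega)
    simp [q, this]
  have hint : ∀ k, IsIntegral A (q k) := by
    intro k
    let R := (integralClosure A E).toSubring
    have hR : IsIntegrallyClosedIn R E := by
      rw [Subring.isIntegrallyClosedIn_iff]
      intro x hx
      change IsIntegral A x
      have : IsIntegral (integralClosure A E) x := hx
      exact isIntegral_trans (A := integralClosure A E) x this
    change q k ∈ R
    rw [Subring.eq_iInf_of_isIntegrallyClosedIn (R := R), Subring.mem_iInf]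
    rintro ⟨W, hW⟩
    have hWA : ∀ i, algebraMap M E (f.coeff i) ∈ W := fun i => by
      apply hW
      change IsIntegral A _
      exact isIntegral_algebraMap (R := A) (A := E) (x := ⟨f.coeff i, hf i⟩)
    change q k ∈ W
    rcases W.mem_or_inv_mem u with h | h
    · by_contra hcon
      have : ∀ j, q (k + j) ∉ W := by
        intro j
        induction j with
        | zero => exact hcon
        | succ j ih =>
          intro hj
          apply ih
          rw [hrec]
          exact W.add_mem _ _ (W.mul_mem _ _ h hj) (hWA _)
      apply this (f.natDegree + 1)
      rw [hqN _ (by omega)]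
      exact W.zero_mem
    · rcases eq_or_ne u 0 with rfl | hu0
      · rw [hrec]; simpa using hWA k
      induction k with
      | zero => rw [hq0]; exact W.zero_mem
      | succ k ih =>
        have : q (k + 1) = u⁻¹ * (q k - algebraMap M E (f.coeff k)) := by
          rw [hrec k]; field_simp; ring
        rw [this]
        exact W.mul_mem _ _ h (W.sub_mem ih (hWA _))
  obtain ⟨k, hk, hkmax⟩ : ∃ k, v (algebraMap M E (f.coeff k)) = 1 ∧
      ∀ j, k < j → v (algebraMap M E (f.coeff j)) < 1 := by
    let S := f.support.filter fun i => v (algebraMap M E (f.coeff i)) = 1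
    have hS : S.Nonempty := by
      obtain ⟨i, hi⟩ := hprim
      refine ⟨i, ?_⟩
      simp only [S, Finset.mem_filter, hi, and_true, mem_support_iff]
      rintro h; simp [h] at hi
    have := S.max'_mem hS
    refine ⟨S.max' hS, (Finset.mem_filter.1 this).2, fun j hj => ?_⟩
    refine lt_of_le_of_ne (hf j) fun h => ?_
    refine absurd (S.le_max' j ?_) (not_le.2 hj)
    simp only [S, Finset.mem_filter, h, and_true, mem_support_iff]
    rintro h'; simp [h'] at h
  have hsmall : ∀ j, v (q (k + 1 + j)) < 1 := by
    by_contra! hcon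
    obtain ⟨j, hj⟩ := hcon
    have : ∀ i, 1 ≤ v (q (k + 1 + (j + i))) := by
      intro i
      induction i with
      | zero => exact hj
      | succ i ih =>
        by_contra! hlt
        rw [hrec] at ih
        refine absurd ih (not_le.2 (v.map_add_lt ?_ (hkmax _ (by omega))))
        rw [map_mul]
        calc v u * _ ≤ 1 * _ := mul_le_mul_left hvu _
          _ < 1 := by rw [one_mul]; exact hlt
    have h2 := this (f.natDegree + 1)
    rw [hqN _ (by omega)] at h2
    simp at h2
  have hqk : v (q k) = 1 := by
    rw [hrec, Valuation.map_add_eq_of_lt_right, hk]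
    rw [hk, map_mul]
    calc v u * _ ≤ 1 * _ := mul_le_mul_left hvu _
      _ < 1 := by rw [one_mul]; exact hsmall 0
  refine ⟨q k, hqk, hint k, ?_⟩
  cases k with
  | zero => rw [hq0] at hqk; simp at hqk
  | succ k =>
    have : q (k + 1) * u = q k - algebraMap M E (f.coeff k) := by rw [hrec k]; ring
    rw [this]
    exact (hint k).sub (isIntegral_algebraMap (R := A) (A := E) (x := ⟨f.coeff k, hf k⟩))

end EtaleExtension

section Conductor

variable {M E Γ₀ : Type*} [Field M] [Field E] [Algebra M E] [LinearOrderedCommGroupWithZero Γ₀]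

/-- The derivative of an integral minimal polynomial at a generator multiplies integral elements
into the ring generated by the generator. -/
theorem exists_aeval_eq_derivative_mul [CharZero M] (v : Valuation E Γ₀) (pb : PowerBasis M E)
    (hf : minpoly M pb.gen ∈ integralPolys M v) {z : E}
    (hz : IsIntegral (v.comap (algebraMap M E)).valuationSubring z) :
    ∃ b ∈ integralPolys M v,
      aeval pb.gen b = aeval pb.gen (derivative (minpoly M pb.gen)) * z := by
  classical
  set A := (v.comap (algebraMap M E)).valuationSubring with hA
  have := pb.finite
  set f := minpoly M pb.gen with hfdef
  let B : Subring E := (integralPolys M v).map (aeval pb.gen : M[X] →ₐ[M] E).toRingHom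
  suffices h : aeval pb.gen (derivative f) * z ∈ B by
    obtain ⟨b, hb, he⟩ := h
    exact ⟨b, hb, he⟩
  have hgen : pb.gen ∈ B := ⟨X, X_mem_integralPolys, by simp⟩
  have hC : ∀ a : M, v (algebraMap M E a) ≤ 1 → algebraMap M E a ∈ B := fun a ha =>
    ⟨C a, C_mem_integralPolys ha, by simp⟩
  have hcoeff : ∀ i, (minpolyDiv M pb.gen).coeff i ∈ B := by
    intro i
    by_contra H
    have : ∀ j, (minpolyDiv M pb.gen).coeff (i + j) ∉ B := by
      intro j
      induction j with
      | zero => exact H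
      | succ j IH =>
        intro hj
        apply IH
        rw [coeff_minpolyDiv]
        exact B.add_mem (hC _ (mem_integralPolys.1 hf _)) (B.mul_mem hj hgen)
    apply this ((minpolyDiv M pb.gen).natDegree + 1)
    rw [coeff_eq_zero_of_natDegree_lt (by lia)]
    exact B.zero_mem
  have hd : aeval pb.gen (derivative f) ≠ 0 :=
    (Algebra.IsSeparable.isSeparable M pb.gen).aeval_derivative_ne_zero (minpoly.aeval _ _)
  have hgenint : IsIntegral A pb.gen := by
    have hl : f ∈ Polynomial.lifts (algebraMap A M) := by
      rw [Polynomial.lifts_iff_coeff_lifts]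
      intro i
      exact ⟨⟨_, mem_integralPolys.1 hf i⟩, rfl⟩
    obtain ⟨g, hg, -, hgm⟩ := Polynomial.lifts_and_natDegree_eq_and_monic hl
      (minpoly.monic (Algebra.IsIntegral.isIntegral _))
    refine ⟨g, hgm, ?_⟩
    rw [← aeval_def, ← aeval_map_algebraMap M, hg, minpoly.aeval]
  have hsum := pb.basis.traceDual.sum_repr z
  rw [← hsum, Finset.mul_sum]
  refine B.sum_mem fun i _ => ?_
  rw [Module.Basis.traceDual_repr_apply, Module.Basis.traceDual_powerBasis_eq,
    PowerBasis.coe_basis, mul_smul_comm, mul_div_cancel₀ _ hd, Algebra.smul_def]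
  refine B.mul_mem (hC _ ?_) (hcoeff _)
  have hint : IsIntegral A (Algebra.traceForm M E z (pb.gen ^ (i : ℕ))) := by
    rw [Algebra.traceForm_apply]
    exact Algebra.isIntegral_trace (hz.mul (hgenint.pow _))
  obtain ⟨a, ha⟩ := IsIntegrallyClosed.isIntegral_iff.1 hint
  rw [← ha]
  exact a.2

/-- Elements of the valuation ring of an étale simple extension are fractions of integral
polynomials in the generator. -/
theorem exists_aeval_fraction {Ω : Type*} [Field Ω] [Algebra M Ω] [CharZero M]
    (v : Valuation Ω Γ₀) {y : Ω} (hy : IsAlgebraic M y)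
    (hf : minpoly M y ∈ integralPolys M v) (hd : v (aeval y (derivative (minpoly M y))) = 1)
    {u : Ω} (hu : u ∈ IntermediateField.adjoin M {y}) (hvu : v u ≤ 1) :
    ∃ b ∈ integralPolys M v, ∃ c ∈ integralPolys M v,
      v (aeval y c) = 1 ∧ aeval y c * u = aeval y b := by
  let E := IntermediateField.adjoin M {y}
  let w : Valuation E Γ₀ := v.comap (algebraMap E Ω)
  let pb : PowerBasis M E := IntermediateField.adjoin.powerBasis hy.isIntegral
  have hpb : (pb.gen : Ω) = y := by simp [pb, E]
  have hmin : minpoly M pb.gen = minpoly M y := by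
    rw [← hpb]
    exact (minpoly.algebraMap_eq (algebraMap E Ω).injective pb.gen).symm
  have hI : integralPolys M w = integralPolys M v := by
    ext f
    simp only [mem_integralPolys]
    rfl
  have hae : ∀ f : M[X], algebraMap E Ω (aeval pb.gen f) = aeval y f := fun f => by
    rw [← hpb]
    exact (Polynomial.aeval_algebraMap_apply Ω pb.gen f).symm
  have := pb.finite
  obtain ⟨c, hc, hcint, hcu⟩ := exists_integral_fraction (M := M) w (u := ⟨u, hu⟩)
    (Algebra.IsAlgebraic.isAlgebraic _) hvu
  rw [← hmin, ← hI] at hf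
  obtain ⟨b₁, hb₁, he₁⟩ := exists_aeval_eq_derivative_mul w pb hf hcu
  obtain ⟨c₁, hc₁, he₂⟩ := exists_aeval_eq_derivative_mul w pb hf hcint
  rw [hmin] at he₁ he₂
  replace he₁ := congrArg (algebraMap E Ω) he₁
  replace he₂ := congrArg (algebraMap E Ω) he₂
  rw [map_mul, hae, hae] at he₁ he₂
  refine ⟨b₁, hI ▸ hb₁, c₁, hI ▸ hc₁, ?_, ?_⟩
  · rw [he₂, map_mul, hd, one_mul]
    exact hc
  · rw [he₁, he₂, map_mul, mul_assoc]
    rfl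

end Conductor

section Henselian

variable {M Γ₀ : Type*} [Field M] [LinearOrderedCommGroupWithZero Γ₀]

/-- Hensel's lemma for the valuation `w`: simple residual roots of monic integral polynomials
lift. -/
def IsHenselianValuation (w : Valuation M Γ₀) : Prop :=
  ∀ f : M[X], f.Monic → (∀ i, w (f.coeff i) ≤ 1) → ∀ a : M, w a ≤ 1 → w (f.eval a) < 1 →
    w (f.derivative.eval a) = 1 → ∃ y : M, f.eval y = 0 ∧ w (y - a) < 1

theorem valuation_eval_lt_one {w : Valuation M Γ₀} {f : M[X]} (hf : ∀ i, w (f.coeff i) < 1)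
    {x : M} (hx : w x ≤ 1) : w (f.eval x) < 1 := by
  rw [eval_eq_sum_range]
  refine w.map_sum_lt one_ne_zero fun i _ => ?_
  rw [map_mul, map_pow]
  exact mul_lt_one_of_lt_of_le (hf i) (pow_le_one' hx i)

theorem valuation_coeff_derivative_lt_one {w : Valuation M Γ₀} {f : M[X]}
    (hf : ∀ i, w (f.coeff i) < 1) (i : ℕ) : w (f.derivative.coeff i) < 1 := by
  rw [coeff_derivative, map_mul]
  have : w ((i : M) + 1) ≤ 1 := by
    have := valuation_natCast_le_one w (i + 1)
    simpa using this
  exact mul_lt_one_of_lt_of_le (hf _) this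

theorem IsHenselianValuation.exists_root_of_unit {w : Valuation M Γ₀} (hw : IsHenselianValuation w)
    {f : M[X]} (h0 : w (f.coeff 0) = 1) (h1 : w (f.coeff 1) = 1)
    (h2 : ∀ i, 2 ≤ i → w (f.coeff i) < 1) : ∃ r : M, f.eval r = 0 ∧ w r ≤ 1 := by
  obtain ⟨m, hm⟩ : ∃ m, f.natDegree = m + 1 := by
    refine Nat.exists_eq_succ_of_ne_zero fun h => ?_
    have : f.coeff 1 = 0 := coeff_eq_zero_of_natDegree_lt (by omega)
    rw [this] at h1
    simp at h1
  set c := f.coeff with hc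
  have hc0 : c 0 ≠ 0 := by rintro h; rw [h] at h0; simp at h0
  have hc1 : c 1 ≠ 0 := by rintro h; rw [h] at h1; simp at h1
  let s : M[X] := ∑ i ∈ Finset.range m, C (c (i + 2) / c 0) * X ^ (m - 1 - i)
  have hs : ∀ i, w (s.coeff i) < 1 := by
    intro i
    simp only [s, finsetSum_coeff, coeff_C_mul, coeff_X_pow]
    refine w.map_sum_lt one_ne_zero fun j _ => ?_
    split_ifs
    · rw [mul_one, map_div₀, h0, div_one]; exact h2 _ (by omega)
    · simp
  have hsdeg : s.degree < (m : ℕ) := by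
    refine (degree_sum_le _ _).trans_lt ?_
    refine (Finset.sup_lt_iff (WithBot.bot_lt_coe m)).2 fun i hi => ?_
    refine (degree_C_mul_X_pow_le _ _).trans_lt ?_
    have := Finset.mem_range.1 hi
    exact Nat.cast_lt.2 (by omega : m - 1 - i < m)
  let g : M[X] := X ^ (m + 1) + (C (c 1 / c 0) * X ^ m + s)
  have hgm : g.Monic := by
    refine monic_X_pow_add ((degree_add_le _ _).trans_lt (max_lt ?_ ?_))
    · exact (degree_C_mul_X_pow_le _ _).trans_lt (by exact_mod_cast Nat.lt_succ_self m)
    · exact hsdeg.trans (by exact_mod_cast Nat.lt_succ_self m)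
  have hgint : ∀ i, w (g.coeff i) ≤ 1 := by
    intro i
    simp only [g, coeff_add, coeff_C_mul, coeff_X_pow]
    refine w.map_add_le ?_ (w.map_add_le ?_ (hs i).le)
    · split_ifs <;> simp
    · split_ifs <;> simp [h0, h1]
  have hgf : ∀ x : M, x ≠ 0 → c 0 * g.eval x = x ^ (m + 1) * f.eval x⁻¹ := by
    intro x hx
    rw [eval_eq_sum_range (p := f), hm, Finset.sum_range_succ', Finset.sum_range_succ']
    simp only [g, s, eval_add, eval_mul, eval_pow, eval_X, eval_C, eval_finsetSum, mul_add,
      Finset.mul_sum]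
    have : ∀ i ∈ Finset.range m, x ^ (m + 1) * (f.coeff (i + 1 + 1) * x⁻¹ ^ (i + 1 + 1)) =
        c 0 * (c (i + 2) / c 0 * x ^ (m - 1 - i)) := by
      intro i hi
      have hi := Finset.mem_range.1 hi
      obtain ⟨k, rfl⟩ : ∃ k, m = i + 1 + k := ⟨m - (i + 1), by omega⟩
      have : i + 1 + k - 1 - i = k := by omega
      rw [this, ← hc, inv_pow]
      field_simp
      ring
    have e1 : c 0 * (c 1 / c 0 * x ^ m) = c 1 * x ^ m := by field_simp
    have e2 : x ^ (m + 1) * (c 1 * x⁻¹) = c 1 * x ^ m := by rw [pow_succ]; field_simp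
    rw [Finset.sum_congr rfl this, ← hc, e1, zero_add, pow_one, e2]
    ring
  set a : M := -(c 1 / c 0) with ha
  have ha1 : w a = 1 := by rw [ha, Valuation.map_neg, map_div₀, h0, h1, div_one]
  have hga : g.eval a = s.eval a := by
    simp only [g, eval_add, eval_mul, eval_pow, eval_X, eval_C]
    rw [show c 1 / c 0 = -a by rw [ha, neg_neg]]
    ring
  have hgda : g.derivative.eval a = a ^ m + s.derivative.eval a := by
    simp only [g, derivative_add, derivative_X_pow, derivative_C_mul, eval_add, eval_mul, eval_pow,
      eval_X, eval_C]
    rw [show c 1 / c 0 = -a by rw [ha, neg_neg]]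
    cases m with
    | zero => simp
    | succ m => simp; ring
  obtain ⟨y, hy, hya⟩ := hw g hgm hgint a ha1.le (hga ▸ valuation_eval_lt_one hs ha1.le) (by
    have := valuation_eval_lt_one (valuation_coeff_derivative_lt_one hs) ha1.le
    rw [hgda, Valuation.map_add_eq_of_lt_left, map_pow, ha1, one_pow]
    rwa [map_pow, ha1, one_pow])
  have hy1 : w y = 1 := by
    have : y = a + (y - a) := by ring
    rw [this, Valuation.map_add_eq_of_lt_left _ (by rwa [ha1]), ha1]
  have hy0 : y ≠ 0 := by rintro rfl; simp at hy1
  refine ⟨y⁻¹, ?_, by rw [map_inv₀, hy1, inv_one]⟩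
  have := hgf y hy0
  rw [hy, mul_zero] at this
  simpa [hy0] using this.symm

/-- An integral polynomial whose reduction is linear has an integral root. -/
theorem IsHenselianValuation.exists_root_of_linear {w : Valuation M Γ₀}
    (hw : IsHenselianValuation w) {f : M[X]} (h0 : w (f.coeff 0) ≤ 1) (h1 : w (f.coeff 1) = 1)
    (h2 : ∀ i, 2 ≤ i → w (f.coeff i) < 1) : ∃ r : M, f.eval r = 0 ∧ w r ≤ 1 := by
  rcases h0.eq_or_lt with h0 | h0
  · exact hw.exists_root_of_unit h0 h1 h2
  let s : M[X] := divX (divX f)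
  have hs : ∀ i, w (s.coeff i) < 1 := fun i => by
    simp only [s, coeff_divX]
    exact h2 _ (by omega)
  have hf : f = C (f.coeff 0) + C (f.coeff 1) * X + s * X ^ 2 := by
    have e1 := divX_mul_X_add f
    have e2 := divX_mul_X_add (divX f)
    rw [coeff_divX, zero_add] at e2
    conv_lhs => rw [← e1, ← e2]
    ring
  have hcomp : f.comp (X + C 1) =
      C (f.coeff 0) + C (f.coeff 1) * (X + C 1) + (s * X ^ 2).comp (X + C 1) := by
    conv_lhs => rw [hf]
    simp
  have hsmall : ∀ i, w (((s * X ^ 2).comp (X + C 1)).coeff i) < 1 := by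
    intro i
    rw [← taylor_apply, taylor_coeff]
    refine valuation_eval_lt_one (fun j => ?_) (by simp)
    rw [hasseDeriv_coeff, map_mul]
    refine (mul_le_of_le_one_left' (valuation_natCast_le_one w _)).trans_lt ?_
    rw [coeff_mul_X_pow']
    split_ifs
    · exact hs _
    · simp
  generalize (s * X ^ 2).comp (X + C 1) = t at hcomp hsmall
  obtain ⟨r, hr, hr1⟩ := hw.exists_root_of_unit (f := f.comp (X + C 1)) (by
      rw [hcomp]
      rw [show C (f.coeff 0) + C (f.coeff 1) * (X + C 1) + t =
        C (f.coeff 1) * (X + C 1) + (C (f.coeff 0) + t) by ring,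
        coeff_add _ _ 0, coeff_add (C (f.coeff 0)) _ 0]
      have : w (f.coeff 0 + (t).coeff 0) < 1 :=
        w.map_add_lt h0 (hsmall 0)
      rw [coeff_C_zero, Valuation.map_add_eq_of_lt_left]
      · simp [h1]
      · simpa [h1] using this) (by
      rw [hcomp, coeff_add, Valuation.map_add_eq_of_lt_left]
      · simp [mul_add, coeff_C, h1, -map_mul]
      · simpa [coeff_X, mul_add, ← C_mul, coeff_C, h1, -map_mul] using hsmall 1) (by
      intro i hi
      rw [hcomp, coeff_add]
      refine w.map_add_lt ?_ (hsmall i)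
      rw [mul_add, ← C_mul]
      obtain ⟨j, rfl⟩ : ∃ j, i = j + 2 := ⟨i - 2, by omega⟩
      simp)
  refine ⟨r + 1, by simpa using hr, w.map_add_le hr1 (by simp)⟩

end Henselian

section PAdicValuation

variable {M Γ₀ : Type*} [Field M] [LinearOrderedCommGroupWithZero Γ₀]

/-- The valuation `w` has residue field `𝔽_p` and `p` has minimal positive value. -/
structure IsPAdicValuation (p : ℕ) (w : Valuation M Γ₀) : Prop where
  lt_one : w p < 1
  le_of_lt_one : ∀ x, w x < 1 → w x ≤ w p
  exists_natCast : ∀ x, w x ≤ 1 → ∃ n : ℕ, w (x - n) < 1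

/-- Modulo the group generated by the value of `p`, the value group is divisible. -/
def HasZGroup (p : ℕ) (w : Valuation M Γ₀) : Prop :=
  ∀ x : M, x ≠ 0 → ∀ n : ℕ, n ≠ 0 → ∃ (z : M) (k : ℤ), w x = w z ^ n * w (p : M) ^ k

theorem valuation_natCast_eq_one {p : ℕ} {w : Valuation M Γ₀} (hw : w p < 1) {m : ℕ}
    (h : m.Coprime p) : w (m : M) = 1 := by
  refine le_antisymm (valuation_natCast_le_one w m) (not_lt.1 fun hm => ?_)
  have hb := congrArg (Int.cast : ℤ → M) (Nat.gcd_eq_gcd_ab m p)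
  rw [Nat.Coprime.gcd_eq_one h] at hb
  push_cast at hb
  have hz : ∀ z : ℤ, w (z : M) ≤ 1 := by
    intro z
    obtain ⟨n, rfl | rfl⟩ := z.eq_nat_or_neg
    · simpa using valuation_natCast_le_one w n
    · simpa using valuation_natCast_le_one w n
  have : w (1 : M) < 1 := by
    rw [hb]
    refine w.map_add_lt ?_ ?_ <;> rw [map_mul]
    · exact mul_lt_one_of_lt_of_le hm (hz _)
    · exact mul_lt_one_of_lt_of_le hw (hz _)
  simp at this

theorem exists_valuation_natCast_eq {p : ℕ} (hp : p.Prime) {w : Valuation M Γ₀} (hw : w p < 1)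
    {n : ℕ} (hn : n ≠ 0) : ∃ N : ℕ, w (n : M) = w (p : M) ^ N := by
  obtain ⟨N, m, hm, rfl⟩ := Nat.exists_eq_pow_mul_and_not_dvd hn p hp.ne_one
  refine ⟨N, ?_⟩
  have := valuation_natCast_eq_one hw ((Nat.Prime.coprime_iff_not_dvd hp).2 hm).symm
  push_cast
  rw [map_mul, this, map_pow, mul_one]

variable {p : ℕ} {w : Valuation M Γ₀}

theorem IsPAdicValuation.exists_zpow_eq [CharZero M] (hw : IsPAdicValuation p w) (hp : p.Prime)
    {t : M} {n : ℕ} (hn : n ≠ 0) {k : ℤ} (h : w t ^ n = w (p : M) ^ k) :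
    ∃ s : ℤ, w t = w (p : M) ^ s := by
  have hp0 : (p : M) ≠ 0 := by exact_mod_cast hp.ne_zero
  have hwp : w (p : M) ≠ 0 := (Valuation.ne_zero_iff w).2 hp0
  have hn' : (0 : ℤ) < n := by exact_mod_cast Nat.pos_of_ne_zero hn
  obtain ⟨r, hr⟩ := Int.eq_ofNat_of_zero_le (Int.emod_nonneg k hn'.ne')
  have hrn : r < n := by
    have := Int.emod_lt_of_pos k hn'
    rw [hr] at this
    exact_mod_cast this
  have hdiv := Int.mul_ediv_add_emod k n
  set s := k / n
  have key : w (t / (p : M) ^ s) ^ n = w (p : M) ^ r := by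
    rw [map_div₀, div_pow, h, map_zpow₀, ← zpow_natCast (w (p : M) ^ s), ← zpow_mul,
      ← zpow_sub₀ hwp, ← zpow_natCast]
    congr 1
    rw [← hr]
    linarith
  refine ⟨s, ?_⟩
  rcases Nat.eq_zero_or_pos r with rfl | hr0
  · rw [pow_zero, pow_eq_one_iff_left hn, map_div₀, map_zpow₀] at key
    exact (div_eq_one_iff_eq (zpow_ne_zero _ hwp)).1 key
  · exfalso
    have h1 : w (t / (p : M) ^ s) < 1 := by
      rw [← pow_lt_one_iff hn, key]
      exact pow_lt_one' hw.lt_one hr0.ne'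
    have h2 := pow_le_pow_left' (hw.le_of_lt_one _ h1) n
    rw [key] at h2
    exact absurd h2 (not_le.2 (pow_lt_pow_right_of_lt_one₀ (zero_lt_iff.2 hwp) hw.lt_one hrn))

theorem IsPAdicValuation.exists_natCast_pow [CharZero M] (hw : IsPAdicValuation p w)
    (hp : p.Prime) {x : M} (hx : w x ≤ 1) (N : ℕ) : ∃ m : ℕ, w (x - m) ≤ w (p : M) ^ N := by
  have hp0 : (p : M) ≠ 0 := by exact_mod_cast hp.ne_zero
  have hwp : w (p : M) ≠ 0 := (Valuation.ne_zero_iff w).2 hp0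
  induction N with
  | zero => exact ⟨0, by simpa using hx⟩
  | succ N ih =>
    obtain ⟨m, hm⟩ := ih
    obtain ⟨m', hm'⟩ := hw.exists_natCast ((x - m) / p ^ N) (by
      rw [map_div₀, map_pow, div_le_one₀ (zero_lt_iff.2 (pow_ne_zero _ hwp))]
      exact hm)
    refine ⟨m + p ^ N * m', ?_⟩
    have : x - ((m + p ^ N * m' : ℕ) : M) = ((x - m) / p ^ N - m') * p ^ N := by
      push_cast
      field_simp
      ring
    rw [this, map_mul, map_pow, pow_succ']
    exact mul_le_mul_left (hw.le_of_lt_one _ hm') _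

theorem IsHenselianValuation.exists_pow_eq [CharZero M] (hM : IsHenselianValuation w)
    (hp : p.Prime) (hw : w p < 1) {n : ℕ} (hn : n ≠ 0) {x : M}
    (hx : w (x - 1) ≤ w (p * n ^ 2 : M)) : ∃ z : M, z ^ n = x := by
  have hp0 : (p : M) ≠ 0 := by exact_mod_cast hp.ne_zero
  have hn0 : (n : M) ≠ 0 := by exact_mod_cast hn
  set d : M := p * n ^ 2 with hd
  have hd0 : d ≠ 0 := mul_ne_zero hp0 (pow_ne_zero _ hn0)
  let f : M[X] := C d⁻¹ * (((1 + X) ^ n).comp (C ((p : M) * n) * X) - C x)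
  have hcoeff : ∀ i, f.coeff i =
      d⁻¹ * ((n.choose i : M) * ((p : M) * n) ^ i - if i = 0 then x else 0) := by
    intro i
    simp only [f, coeff_C_mul, coeff_sub, comp_C_mul_X_coeff, coeff_one_add_X_pow, coeff_C]
  obtain ⟨r, hr, -⟩ := hM.exists_root_of_linear (f := f) (by
      rw [hcoeff]
      simp only [Nat.choose_zero_right, Nat.cast_one, pow_zero, mul_one, if_true, map_mul, map_inv₀]
      rw [inv_mul_le_one₀ (zero_lt_iff.2 ((Valuation.ne_zero_iff w).2 hd0)), Valuation.map_sub_swap]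
      exact hx) (by
      rw [hcoeff]
      have : d⁻¹ * ((n.choose 1 : M) * ((p : M) * n) ^ 1 - if 1 = 0 then x else 0) = 1 := by
        simp [hd]
        field_simp
      rw [this, map_one]) (by
      intro i hi
      obtain ⟨j, rfl⟩ : ∃ j, i = j + 2 := ⟨i - 2, by omega⟩
      rw [hcoeff]
      have : d⁻¹ * ((n.choose (j + 2) : M) * ((p : M) * n) ^ (j + 2) - if j + 2 = 0 then x else 0)
          = p * ((n.choose (j + 2) * p ^ j * n ^ j : ℕ) : M) := by
        simp [hd]
        field_simp
        ring
      rw [this, map_mul]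
      exact mul_lt_one_of_lt_of_le hw (valuation_natCast_le_one w _))
  refine ⟨1 + p * n * r, ?_⟩
  simp only [f, eval_mul, eval_C, eval_sub, eval_comp, eval_pow, eval_add, eval_one, eval_X,
    mul_eq_zero, inv_eq_zero, hd0, false_or] at hr
  exact sub_eq_zero.1 hr

/-- In a henselian `p`-adically valued field, up to powers every element is rational. -/
theorem IsPAdicValuation.exists_eq_mul_pow [CharZero M] (hw : IsPAdicValuation p w)
    (hp : p.Prime) (hM : IsHenselianValuation w) (hz : HasZGroup p w) {x : M} (hx : x ≠ 0)
    {n : ℕ} (hn : n ≠ 0) : ∃ (q : ℚ) (z : M), x = q * z ^ n := by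
  have hp0 : (p : M) ≠ 0 := by exact_mod_cast hp.ne_zero
  have hn0 : (n : M) ≠ 0 := by exact_mod_cast hn
  obtain ⟨z, k, hzk⟩ := hz x hx n hn
  have hz0 : z ≠ 0 := by
    rintro rfl
    simp [hn, hx] at hzk
  set u : M := x / (z ^ n * (p : M) ^ k) with hu
  have hdz : z ^ n * (p : M) ^ k ≠ 0 := mul_ne_zero (pow_ne_zero _ hz0) (zpow_ne_zero _ hp0)
  have hu1 : w u = 1 := by
    rw [hu, map_div₀, map_mul, map_pow, map_zpow₀, hzk, ← map_pow, ← map_zpow₀, ← map_mul]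
    exact div_self ((Valuation.ne_zero_iff w).2 hdz)
  obtain ⟨N, hN⟩ := exists_valuation_natCast_eq hp hw.lt_one (mul_ne_zero hp.ne_zero
    (pow_ne_zero 2 hn))
  push_cast at hN
  obtain ⟨m, hm⟩ := hw.exists_natCast_pow hp hu1.le N
  rw [← hN] at hm
  have hlt : w (u - m) < 1 := by
    refine hm.trans_lt ?_
    rw [map_mul]
    refine mul_lt_one_of_lt_of_le hw.lt_one ?_
    exact_mod_cast valuation_natCast_le_one w (n ^ 2)
  have hm1 : w (m : M) = 1 := by
    have : (m : M) = u - (u - m) := by ring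
    rw [this, Valuation.map_sub_eq_of_lt_left _ (by rwa [hu1]), hu1]
  have hm0 : (m : M) ≠ 0 := by rintro h; rw [h] at hm1; simp at hm1
  obtain ⟨t, ht⟩ := hM.exists_pow_eq hp hw.lt_one hn (x := u / m) (by
    have : u / m - 1 = (u - m) / m := by field_simp
    rw [this, map_div₀, hm1, div_one]
    exact hm)
  refine ⟨(p : ℚ) ^ k * m, z * t, ?_⟩
  push_cast
  rw [mul_pow, ht, hu]
  field_simp

variable {k : Type*} [Field k] [Algebra k M]

theorem IsPAdicValuation.comap (hw : IsPAdicValuation p w) :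
    IsPAdicValuation p (w.comap (algebraMap k M)) where
  lt_one := by simpa using hw.lt_one
  le_of_lt_one x hx := by simpa using hw.le_of_lt_one _ hx
  exists_natCast x hx := by simpa using hw.exists_natCast _ hx

theorem IsHenselianValuation.comap (hM : IsHenselianValuation w)
    (hk : ∀ x : M, IsAlgebraic k x → x ∈ (algebraMap k M).range) :
    IsHenselianValuation (w.comap (algebraMap k M)) := by
  intro f hf hint a ha hfa hfda
  have he : ∀ g : k[X], (g.map (algebraMap k M)).eval (algebraMap k M a) =
      algebraMap k M (g.eval a) := fun g => by rw [eval_map, eval₂_at_apply]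
  obtain ⟨y, hy, hya⟩ := hM (f.map (algebraMap k M)) (hf.map _)
    (fun i => by rw [coeff_map]; exact hint i) (algebraMap k M a) ha (by rw [he]; exact hfa)
    (by rw [derivative_map, he]; exact hfda)
  obtain ⟨y, rfl⟩ := hk y ⟨f, hf.ne_zero, by rwa [eval_map_algebraMap] at hy⟩
  refine ⟨y, ?_, by simpa using hya⟩
  rw [eval_map, eval₂_at_apply] at hy
  exact (map_eq_zero _).1 hy

theorem HasZGroup.comap [CharZero M] (hw : IsPAdicValuation p w)
    (hp : p.Prime) (hM : IsHenselianValuation w) (hz : HasZGroup p w)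
    (hk : ∀ x : M, IsAlgebraic k x → x ∈ (algebraMap k M).range) :
    HasZGroup p (w.comap (algebraMap k M)) := by
  intro x hx n hn
  have hx' : algebraMap k M x ≠ 0 := by simpa using hx
  obtain ⟨q, z, hqz⟩ := hw.exists_eq_mul_pow hp hM hz hx' hn
  have hq0 : q ≠ 0 := by rintro rfl; simp [hx] at hqz
  have : CharZero k := (algebraMap k M).charZero_iff (algebraMap k M).injective |>.2 inferInstance
  obtain ⟨z, rfl⟩ := hk z (by
    refine ⟨X ^ n - C (x / q), X_pow_sub_C_ne_zero (Nat.pos_of_ne_zero hn) _, ?_⟩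
    have : (q : M) ≠ 0 := by exact_mod_cast hq0
    simp [hqz]
    field_simp
    simp)
  obtain ⟨k, hk⟩ : ∃ k : ℤ, w (q : M) = w (p : M) ^ k := by
    obtain ⟨N₁, h₁⟩ := exists_valuation_natCast_eq hp hw.lt_one
      (Int.natAbs_ne_zero.2 (Rat.num_ne_zero.2 hq0))
    obtain ⟨N₂, h₂⟩ := exists_valuation_natCast_eq hp hw.lt_one q.den_ne_zero
    have hnum : w (q.num : M) = w (q.num.natAbs : M) := by
      obtain h | h := q.num.natAbs_eq
      · conv_lhs => rw [h]
        simp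
      · conv_lhs => rw [h]
        simp
    refine ⟨N₁ - N₂, ?_⟩
    have hp0 : w (p : M) ≠ 0 := (Valuation.ne_zero_iff w).2 (by exact_mod_cast hp.ne_zero)
    rw [Rat.cast_def, map_div₀, hnum, h₁, h₂, zpow_sub₀ hp0, zpow_natCast, zpow_natCast]
  refine ⟨z, k, ?_⟩
  simp only [Valuation.comap_apply, map_natCast]
  rw [hqz, map_mul, hk, map_pow, mul_comm]

end PAdicValuation

section Maximal

open IntermediateField

variable {M Ω Γ₀ : Type*} [Field M] [Field Ω] [Algebra M Ω] [LinearOrderedCommGroupWithZero Γ₀]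

theorem exists_minpoly_factor (v : Valuation Ω Γ₀) {f : M[X]} (hfm : f.Monic)
    (hf : f ∈ integralPolys M v) {y : Ω} (hy : aeval y f = 0) :
    minpoly M y ∈ integralPolys M v ∧ ∃ q ∈ integralPolys M v, f = minpoly M y * q := by
  set A := (v.comap (algebraMap M Ω)).valuationSubring with hA
  have hl : f ∈ Polynomial.lifts (algebraMap A M) := by
    rw [Polynomial.lifts_iff_coeff_lifts]
    intro i
    exact ⟨⟨_, mem_integralPolys.1 hf i⟩, rfl⟩
  obtain ⟨g, hg, -, hgm⟩ := Polynomial.lifts_and_natDegree_eq_and_monic hl hfm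
  have hgy : aeval y g = 0 := by rw [← aeval_map_algebraMap M, hg, hy]
  have hint : IsIntegral A y := ⟨g, hgm, by rwa [← aeval_def]⟩
  have hmap : ∀ q : A[X], q.map (algebraMap A M) ∈ integralPolys M v := fun q => by
    rw [mem_integralPolys]
    intro i
    rw [coeff_map]
    exact (q.coeff i).2
  have hmin := minpoly.isIntegrallyClosed_eq_field_fractions' M hint
  obtain ⟨q, hq⟩ := minpoly.isIntegrallyClosed_dvd hint hgy
  refine ⟨hmin ▸ hmap _, q.map (algebraMap A M), hmap _, ?_⟩
  rw [hmin, ← Polynomial.map_mul, ← hq, hg]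

theorem IsPAdicValuation.of_approx {p : ℕ} {v : Valuation Ω Γ₀}
    (hM : IsPAdicValuation p (v.comap (algebraMap M Ω))) {E : IntermediateField M Ω}
    (h : ∀ u ∈ E, v u ≤ 1 → ∃ u₀ : M, v (u - algebraMap M Ω u₀) ≤ v p) :
    IsPAdicValuation p (v.comap (algebraMap E Ω)) where
  lt_one := by simpa using hM.lt_one
  le_of_lt_one := by
    rintro ⟨u, hu⟩ (hu1 : v u < 1)
    obtain ⟨u₀, h₀⟩ := h u hu hu1.le
    have hlt : v p < 1 := by simpa using hM.lt_one
    have := hM.le_of_lt_one u₀ (by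
      have : algebraMap M Ω u₀ = u - (u - algebraMap M Ω u₀) := by ring
      rw [Valuation.comap_apply, this]
      exact v.map_sub_lt hu1 (h₀.trans_lt hlt))
    have he : u = (u - algebraMap M Ω u₀) + algebraMap M Ω u₀ := by ring
    simp only [Valuation.comap_apply, map_natCast] at this ⊢
    change v u ≤ _
    rw [he]
    exact v.map_add_le h₀ this
  exists_natCast := by
    rintro ⟨u, hu⟩ (hu1 : v u ≤ 1)
    obtain ⟨u₀, h₀⟩ := h u hu hu1
    have hlt : v p < 1 := by simpa using hM.lt_one
    obtain ⟨n, hn⟩ := hM.exists_natCast u₀ (by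
      have : algebraMap M Ω u₀ = u - (u - algebraMap M Ω u₀) := by ring
      rw [Valuation.comap_apply, this]
      exact v.map_sub_le hu1 (h₀.trans hlt.le))
    refine ⟨n, ?_⟩
    have he : u - n = (u - algebraMap M Ω u₀) + algebraMap M Ω (u₀ - n) := by simp
    change v (u - n) < 1
    rw [he]
    exact v.map_add_lt (h₀.trans_lt hlt) hn

/-- An approximate root in the ground field is as close as its value predicts. -/
theorem valuation_sub_eq_valuation_aeval {v : Valuation Ω Γ₀} {f : M[X]}
    (hf : f ∈ integralPolys M v) {y a : Ω} (ha : v a ≤ 1) (hya : v (y - a) < 1)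
    (hy : aeval y f = 0) (hd : v (aeval y (derivative f)) = 1) : v (y - a) = v (aeval a f) := by
  have hy1 : v y ≤ 1 := by
    have : y = (y - a) + a := by ring
    rw [this]
    exact v.map_add_le hya.le ha
  obtain ⟨k, hk, he⟩ := exists_valuation_aeval_eq hf hy1 ha
  have : aeval a f = (a - y) * (aeval y (derivative f) + k * (a - y)) := by
    rw [he, hy]; ring
  rw [this, map_mul, Valuation.map_add_eq_of_lt_left, hd, mul_one, Valuation.map_sub_swap]
  rw [hd, map_mul, Valuation.map_sub_swap]
  exact (mul_le_of_le_one_left' hk).trans_lt hya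

theorem IsPAdicValuation.adjoin_root [CharZero M] {p : ℕ} {v : Valuation Ω Γ₀}
    (hM : IsPAdicValuation p (v.comap (algebraMap M Ω))) {y : Ω} (hy : IsAlgebraic M y)
    (hf : minpoly M y ∈ integralPolys M v) {a : M} (ha : v (algebraMap M Ω a) ≤ 1)
    (hya : v (y - algebraMap M Ω a) < 1) (hd : v (aeval y (derivative (minpoly M y))) = 1) :
    IsPAdicValuation p (v.comap (algebraMap M⟮y⟯ Ω)) := by
  have hy1 : v y ≤ 1 := by
    have : y = (y - algebraMap M Ω a) + algebraMap M Ω a := by ring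
    rw [this]
    exact v.map_add_le hya.le ha
  have hyap : v (y - algebraMap M Ω a) ≤ v p := by
    have h1 := valuation_sub_eq_valuation_aeval hf ha hya (minpoly.aeval M y) hd
    rw [aeval_algebraMap_apply] at h1
    rw [h1] at hya ⊢
    simpa using hM.le_of_lt_one _ hya
  refine hM.of_approx fun u hu hu1 => ?_
  obtain ⟨b, hb, c, hc, hcy, he⟩ := exists_aeval_fraction v hy hf hd hu hu1
  set a' := algebraMap M Ω a with ha'
  have hca : v (aeval a' c) = 1 := by
    have := valuation_aeval_sub_le hc ha hy1
    rw [v.map_sub_swap a' y] at this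
    have h2 : aeval a' c = aeval y c + (aeval a' c - aeval y c) := by ring
    rw [h2, Valuation.map_add_eq_of_lt_left, hcy]
    rw [hcy]
    exact this.trans_lt hya
  have hca0 : aeval a' c ≠ 0 := by rintro h; rw [h] at hca; simp at hca
  refine ⟨b.eval a / c.eval a, ?_⟩
  have e1 : algebraMap M Ω (b.eval a / c.eval a) = aeval a' b / aeval a' c := by
    rw [map_div₀, ha', aeval_algebraMap_apply, aeval_algebraMap_apply, coe_aeval_eq_eval]
  have e2 : aeval y c * (aeval a' c * (u - aeval a' b / aeval a' c)) =
      aeval a' c * (aeval y b - aeval a' b) - aeval a' b * (aeval y c - aeval a' c) := by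
    rw [← he]
    field_simp
    ring
  rw [e1]
  have e3 := congrArg v e2
  rw [map_mul, map_mul, hcy, hca, one_mul, one_mul] at e3
  rw [e3]
  refine v.map_sub_le ?_ ?_ <;> rw [map_mul]
  · rw [hca, one_mul]
    exact (valuation_aeval_sub_le hb hy1 ha).trans hyap
  · exact (mul_le_of_le_one_left' (valuation_aeval_le_one hb ha)).trans
      ((valuation_aeval_sub_le hc hy1 ha).trans hyap)

/-- In an algebraically closed valued field, simple residual roots lift, with integral minimal
polynomial over the ground field. -/
theorem exists_root_near [IsAlgClosed Ω] (v : Valuation Ω Γ₀) {f : M[X]} (hfm : f.Monic)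
    {a : Ω} (hfa : v (aeval a f) < 1) :
    ∃ y : Ω, aeval y f = 0 ∧ v (y - a) < 1 := by
  have hs := IsAlgClosed.splits (f.map (algebraMap M Ω))
  rw [← eval_map_algebraMap, hs.eval_eq_prod_roots_of_monic (hfm.map _), map_multiset_prod,
    Multiset.map_map] at hfa
  by_contra! hcon
  refine absurd hfa (not_lt.2 (Multiset.one_le_prod_of_one_le ?_))
  intro x hx
  obtain ⟨y, hy, rfl⟩ := Multiset.mem_map.1 hx
  have := isRoot_of_mem_roots hy
  rw [IsRoot, eval_map_algebraMap] at this
  have := hcon y this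
  rwa [Function.comp_apply, Valuation.map_sub_swap]

theorem valuation_aeval_derivative_minpoly {v : Valuation Ω Γ₀} {f : M[X]} (hfm : f.Monic)
    (hf : f ∈ integralPolys M v) {y : Ω} (hy : aeval y f = 0) (hy1 : v y ≤ 1)
    (hd : v (aeval y (derivative f)) = 1) :
    v (aeval y (derivative (minpoly M y))) = 1 := by
  obtain ⟨hm, q, hq, he⟩ := exists_minpoly_factor v hfm hf hy
  have h1 := valuation_aeval_le_one (derivative_mem_integralPolys hm) hy1
  have h2 := valuation_aeval_le_one hq hy1
  have h3 : aeval y (derivative f) = aeval y (derivative (minpoly M y)) * aeval y q := by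
    rw [he]; simp
  rw [h3, map_mul] at hd
  refine le_antisymm h1 ?_
  rw [← hd]
  exact mul_le_of_le_one_right' h2

theorem valuation_aeval_derivative_of_near {v : Valuation Ω Γ₀} {f : M[X]}
    (hf : f ∈ integralPolys M v) {y a : Ω} (hy1 : v y ≤ 1) (ha : v a ≤ 1) (hya : v (y - a) < 1)
    (hd : v (aeval a (derivative f)) = 1) : v (aeval y (derivative f)) = 1 := by
  have := (valuation_aeval_sub_le (derivative_mem_integralPolys hf) hy1 ha).trans_lt hya
  have h2 : aeval y (derivative f) =
    aeval a (derivative f) + (aeval y (derivative f) - aeval a (derivative f)) := by ring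
  rw [h2, Valuation.map_add_eq_of_lt_left _ (by rwa [hd]), hd]

/-- A `p`-adically valued field without proper algebraic `p`-adic extensions is henselian. -/
theorem IsPAdicValuation.isHenselian_of_maximal [CharZero M] [IsAlgClosed Ω] {p : ℕ}
    {v : Valuation Ω Γ₀} (hM : IsPAdicValuation p (v.comap (algebraMap M Ω)))
    (hmax : ∀ y : Ω, IsAlgebraic M y → IsPAdicValuation p (v.comap (algebraMap M⟮y⟯ Ω)) →
      y ∈ (algebraMap M Ω).range) :
    IsHenselianValuation (v.comap (algebraMap M Ω)) := by
  intro f hfm hf a ha hfa hfda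
  have hae : ∀ g : M[X], algebraMap M Ω (g.eval a) = aeval (algebraMap M Ω a) g := fun g => by
    rw [aeval_algebraMap_apply, coe_aeval_eq_eval]
  rw [Valuation.comap_apply] at ha hfa hfda
  rw [hae] at hfa hfda
  have hf' : f ∈ integralPolys M v := mem_integralPolys.2 hf
  obtain ⟨y, hy, hya⟩ := exists_root_near v hfm hfa
  have hy1 : v y ≤ 1 := by
    have : y = (y - algebraMap M Ω a) + algebraMap M Ω a := by ring
    rw [this]
    exact v.map_add_le hya.le ha
  obtain ⟨z, rfl⟩ := hmax y ⟨f, hfm.ne_zero, hy⟩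
    (hM.adjoin_root ⟨f, hfm.ne_zero, hy⟩ (exists_minpoly_factor v hfm hf' hy).1 ha hya
      (valuation_aeval_derivative_minpoly hfm hf' hy hy1
        (valuation_aeval_derivative_of_near hf' hy1 ha hya hfda)))
  refine ⟨z, ?_, by simpa using hya⟩
  rw [aeval_algebraMap_apply, coe_aeval_eq_eval] at hy
  exact (map_eq_zero _).1 hy

end Maximal

section ValueGroup

open IntermediateField

variable {M Ω Γ₀ : Type*} [Field M] [Field Ω] [Algebra M Ω] [LinearOrderedCommGroupWithZero Γ₀]

theorem Valuation.le_map_sum_of_injOn {ι : Type*} (v : Valuation Ω Γ₀) {s : Finset ι} {t : ι → Ω}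
    (h : ∀ i ∈ s, ∀ j ∈ s, i ≠ j → t i ≠ 0 → v (t i) ≠ v (t j)) {i : ι} (hi : i ∈ s) :
    v (t i) ≤ v (∑ j ∈ s, t j) := by
  classical
  obtain ⟨m, hm, hmax⟩ := s.exists_max_image (fun j => v (t j)) ⟨i, hi⟩
  refine (hmax i hi).trans ?_
  by_cases h0 : t m = 0
  · simp [h0]
  have hv0 : v (t m) ≠ 0 := (Valuation.ne_zero_iff v).2 h0
  rw [← Finset.add_sum_erase s t hm, Valuation.map_add_eq_of_lt_left]
  refine v.map_sum_lt hv0 fun j hj => ?_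
  obtain ⟨hne, hj⟩ := Finset.mem_erase.1 hj
  exact lt_of_le_of_ne (hmax j hj) (h m hm j hj hne.symm h0).symm

theorem IsPAdicValuation.exists_pow_eq_of_lt [CharZero M] {p : ℕ} (hp : p.Prime)
    {w : Valuation M Γ₀} (hw : IsPAdicValuation p w) {e : M} (he : w e ≤ 1) {N : ℕ}
    (h : w (p : M) ^ N < w e) : ∃ r : ℕ, r < N ∧ w e = w (p : M) ^ r := by
  have hp0 : (p : M) ≠ 0 := by exact_mod_cast hp.ne_zero
  have hwp : w (p : M) ≠ 0 := (Valuation.ne_zero_iff w).2 hp0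
  induction N generalizing e with
  | zero => simp [he.not_gt] at h
  | succ N ih =>
    rcases he.eq_or_lt with he | he
    · exact ⟨0, Nat.succ_pos _, by simpa using he⟩
    · have h1 := hw.le_of_lt_one _ he
      obtain ⟨r, hr, h2⟩ := ih (e := e / p)
        (by rw [map_div₀]; exact (div_le_one₀ (zero_lt_iff.2 hwp)).2 h1)
        (by rw [map_div₀, lt_div_iff₀ (zero_lt_iff.2 hwp), ← pow_succ]; exact h)
      refine ⟨r + 1, by omega, ?_⟩
      rw [map_div₀, div_eq_iff hwp] at h2
      rw [h2, pow_succ]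

theorem exists_eq_pow_mul_of_coprime {p : ℕ} {w : Valuation M Γ₀} (hp0 : (p : M) ≠ 0) {x : M}
    (hx : x ≠ 0) {i l : ℕ}
    (hil : i.Coprime l) {a : M} {k : ℤ} (h : w x ^ i = w a ^ l * w (p : M) ^ k) :
    ∃ (z : M) (k' : ℤ), w x = w z ^ l * w (p : M) ^ k' := by
  have hw0 : w x ≠ 0 := (Valuation.ne_zero_iff w).2 hx
  have hwp : w (p : M) ≠ 0 := (Valuation.ne_zero_iff w).2 hp0
  have hb := Nat.gcd_eq_gcd_ab i l
  rw [Nat.Coprime.gcd_eq_one hil] at hb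
  set s := i.gcdA l
  set t := i.gcdB l
  refine ⟨a ^ s * x ^ t, k * s, ?_⟩
  have : w x = w x ^ ((i : ℤ) * s + l * t) := by rw [← hb]; simp
  have e : ∀ (g : Γ₀) (m : ℤ), (g ^ l) ^ m = (g ^ m) ^ l := fun g m => by
    rw [← zpow_natCast, ← zpow_natCast, ← zpow_mul, ← zpow_mul, mul_comm]
  rw [this, zpow_add₀ hw0, zpow_mul, zpow_natCast, h, mul_zpow, zpow_mul (w x), zpow_natCast, e, e,
    map_mul, map_zpow₀, map_zpow₀, mul_pow, zpow_mul]
  exact mul_right_comm _ _ _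

theorem hasZGroup_of_prime {p : ℕ} {w : Valuation M Γ₀}
    (h : ∀ l : ℕ, l.Prime → ∀ x : M, x ≠ 0 → ∃ (z : M) (k : ℤ), w x = w z ^ l * w (p : M) ^ k) :
    HasZGroup p w := by
  intro x hx n
  induction n using induction_on_primes generalizing x with
  | zero => exact fun h => absurd rfl h
  | one => exact fun _ => ⟨x, 0, by simp⟩
  | prime_mul l a hl ih =>
    intro hn
    obtain ⟨z, k, hz⟩ := h l hl x hx
    have hz0 : z ≠ 0 := by
      rintro rfl
      simp [hl.ne_zero, hx] at hz
    obtain ⟨z', k', hz'⟩ := ih z hz0 (right_ne_zero_of_mul hn)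
    by_cases hp0 : w (p : M) = 0
    · refine ⟨z', if k' = 0 then k else k', ?_⟩
      rw [hz, hz', hp0, mul_pow, ← pow_mul, mul_comm a l]
      split_ifs with h0
      · simp [h0]
      · rw [zero_zpow _ h0, zero_pow hl.ne_zero]; simp
    · refine ⟨z', k' * l + k, ?_⟩
      rw [hz, hz', mul_pow, ← pow_mul, mul_comm a l, zpow_add₀ hp0, zpow_mul, zpow_natCast,
        mul_assoc]

theorem exists_aeval_of_mem_adjoin {y : Ω} (hy : IsAlgebraic M y) {u : Ω} (hu : u ∈ M⟮y⟯) :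
    ∃ g : M[X], aeval y g = u := by
  have : u ∈ M⟮y⟯.toSubalgebra := hu
  rw [adjoin_simple_toSubalgebra_of_isAlgebraic hy, Algebra.adjoin_singleton_eq_range_aeval] at this
  exact this

/-- A `p`-adically valued field without proper algebraic `p`-adic extensions has value group a
`ℤ`-group. -/
theorem IsPAdicValuation.hasZGroup_of_maximal [CharZero M] [IsAlgClosed Ω] {p : ℕ} (hp : p.Prime)
    {v : Valuation Ω Γ₀} (hM : IsPAdicValuation p (v.comap (algebraMap M Ω)))
    (hmax : ∀ y : Ω, IsAlgebraic M y → IsPAdicValuation p (v.comap (algebraMap M⟮y⟯ Ω)) →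
      y ∈ (algebraMap M Ω).range) :
    HasZGroup p (v.comap (algebraMap M Ω)) := by
  refine hasZGroup_of_prime fun l hl x hx => ?_
  by_contra hcon
  have hp0 : (p : M) ≠ 0 := by exact_mod_cast hp.ne_zero
  obtain ⟨y, hyx⟩ := IsAlgClosed.exists_pow_nat_eq (algebraMap M Ω x) hl.pos
  have hymon : (X ^ l - C x : M[X]).Monic := monic_X_pow_sub_C x hl.ne_zero
  have hyroot : aeval y (X ^ l - C x : M[X]) = 0 := by simp [hyx]
  have hyalg : IsAlgebraic M y := ⟨_, hymon.ne_zero, hyroot⟩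
  set w := v.comap (algebraMap M Ω) with hw
  have hyl : v y ^ l = w x := by rw [← map_pow, hyx]; rfl
  have key : ∀ i : ℕ, 0 < i → i < l → ∀ (a : M) (k : ℤ), w x ^ i ≠ w a ^ l * w (p : M) ^ k := by
    intro i hi0 hil a k h
    exact hcon (exists_eq_pow_mul_of_coprime hp0 hx
      ((Nat.coprime_comm.1 ((Nat.Prime.coprime_iff_not_dvd hl).2 fun hd =>
        absurd (Nat.le_of_dvd hi0 hd) (not_le.2 hil)))) h)
  obtain ⟨z, rfl⟩ := hmax y hyalg (hM.of_approx fun u hu hu1 => by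
    obtain ⟨g, rfl⟩ := exists_aeval_of_mem_adjoin hyalg hu
    set r := g %ₘ (X ^ l - C x) with hr
    have hgr : aeval y g = aeval y r := by
      conv_lhs => rw [← modByMonic_add_div g (X ^ l - C x)]
      simp [hyx, hr]
    have hdeg : r.natDegree < l := by
      have := natDegree_modByMonic_lt g hymon (fun h => by
        have := congrArg natDegree h
        rw [natDegree_X_pow_sub_C, natDegree_one] at this
        exact hl.ne_zero this)
      rwa [natDegree_X_pow_sub_C] at this
    rw [hgr] at hu1 ⊢
    have hsum : aeval y r = ∑ i ∈ Finset.range l, algebraMap M Ω (r.coeff i) * y ^ i := by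
      rw [aeval_eq_sum_range' hdeg]
      simp [Algebra.smul_def]
    have hy0 : v y ≠ 0 := by
      rw [← pow_ne_zero_iff hl.ne_zero, hyl]
      exact (Valuation.ne_zero_iff w).2 hx
    have hle : ∀ i < l, v (algebraMap M Ω (r.coeff i) * y ^ i) ≤ 1 := by
      intro i hi
      refine le_trans ?_ hu1
      rw [hsum]
      refine v.le_map_sum_of_injOn (t := fun i => algebraMap M Ω (r.coeff i) * y ^ i) ?_
        (Finset.mem_range.2 hi)
      have hlt : ∀ j k, j < k → k < l → r.coeff k ≠ 0 →
          v (algebraMap M Ω (r.coeff j) * y ^ j) ≠ v (algebraMap M Ω (r.coeff k) * y ^ k) := by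
        intro j k hjk hkl hk0 h
        have hk0' : w (r.coeff k) ≠ 0 := (Valuation.ne_zero_iff w).2 hk0
        refine key (k - j) (by omega) (by omega) (r.coeff j / r.coeff k) 0 ?_
        have h2 : v y ^ (k - j) = w (r.coeff j / r.coeff k) := by
          rw [map_mul, map_mul, map_pow, map_pow] at h
          rw [map_div₀, eq_div_iff hk0', hw]
          apply mul_right_cancel₀ (pow_ne_zero j hy0)
          change _ = v _ * _
          rw [h, mul_right_comm, ← pow_add, mul_comm]
          congr 2
          omega
        rw [← hyl, ← pow_mul, mul_comm, pow_mul, h2]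
        simp
      intro j hj k hk hjk htj
      have htj' : r.coeff j ≠ 0 := fun h => htj (by simp [h])
      rcases lt_or_gt_of_ne hjk with h | h
      · by_cases hk0 : r.coeff k = 0
        · simp only [hk0, map_zero, zero_mul]
          exact (Valuation.ne_zero_iff v).2 htj
        · exact hlt j k h (Finset.mem_range.1 hk) hk0
      · exact (hlt k j h (Finset.mem_range.1 hj) htj').symm
    refine ⟨r.coeff 0, ?_⟩
    obtain ⟨m, rfl⟩ := Nat.exists_eq_succ_of_ne_zero hl.ne_zero
    rw [hsum, Finset.sum_range_succ', pow_zero, mul_one, add_sub_cancel_right]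
    refine v.map_sum_le fun i hi => ?_
    have hi := Finset.mem_range.1 hi
    by_contra! hlt
    have hle1 := hle (i + 1) (by omega)
    set e : M := r.coeff (i + 1) ^ (m + 1) * x ^ (i + 1) with he
    have hve : w e = v (algebraMap M Ω (r.coeff (i + 1)) * y ^ (i + 1)) ^ (m + 1) := by
      rw [he, map_mul, map_pow, map_pow, ← hyl, map_mul, map_pow, mul_pow, ← pow_mul, ← pow_mul,
        mul_comm (m.succ)]
      rfl
    have hvp : w (p : M) = v p := by simp [hw]
    obtain ⟨s, -, hs⟩ := hM.exists_pow_eq_of_lt hp (e := e) (N := m + 1)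
      (by rw [hve]; exact pow_le_one' hle1 _)
      (by rw [hve, hvp]; exact pow_lt_pow_left₀ hlt zero_le (by omega))
    have hc0 : w (r.coeff (i + 1)) ≠ 0 := by
      intro h
      have h0 : r.coeff (i + 1) = 0 := by simpa using h
      simp [h0] at hlt
    refine key (i + 1) (by omega) (by omega) (r.coeff (i + 1))⁻¹ s ?_
    rw [zpow_natCast, ← hs, he, map_mul, map_pow, map_pow, map_inv₀, inv_pow, ← mul_assoc,
      inv_mul_cancel₀ (pow_ne_zero _ hc0), one_mul])
  refine key 1 one_pos hl.one_lt z 0 ?_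
  rw [pow_one, ← hyl]
  simp [hw]

end ValueGroup

section Specialization

open IntermediateField

variable {K N Γ₀ : Type*} [Field K] [Field N] [Algebra K N] [LinearOrderedCommGroupWithZero Γ₀]

/-- A pair of algebra homomorphisms `α : P → N`, `β : P → K` with `ker α ≤ ker β` induces a
homomorphism to `K` from a subalgebra of `N` containing the fractions with denominator not killed
by `β`. -/
theorem exists_algHom_of_ker_le {P : Type*} [CommRing P] [Algebra K P] (α : P →ₐ[K] N)
    (β : P →ₐ[K] K) (h : ∀ g, α g = 0 → β g = 0) :
    ∃ (R : Subalgebra K N) (φ : R →ₐ[K] K), ∀ g d : P, β d ≠ 0 →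
      ∃ hm : α g / α d ∈ R, φ ⟨α g / α d, hm⟩ = β g / β d := by
  let S : Submonoid P :=
    { carrier := {d | β d ≠ 0}
      mul_mem' := fun ha hb => by
        simp only [Set.mem_ofPred_eq, map_mul] at *
        exact mul_ne_zero ha hb
      one_mem' := by simp }
  have hα : ∀ s : S, IsUnit (α s) := fun s => isUnit_iff_ne_zero.2 fun h0 => s.2 (h _ h0)
  have hβ : ∀ s : S, IsUnit (β s) := fun s => isUnit_iff_ne_zero.2 s.2
  let α' : Localization S →ₐ[K] N := IsLocalization.liftAlgHom (M := S) hα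
  let β' : Localization S →ₐ[K] K := IsLocalization.liftAlgHom (M := S) hβ
  have eα : ∀ (g : P) (d : S), α' (IsLocalization.mk' _ g d) = α g / α d := fun g d => by
    rw [eq_div_iff (hα d).ne_zero]
    have := (IsLocalization.lift_mk'_spec (S := Localization S) (g := α.toRingHom) (hg := hα) g
      (α g / α d) d).2 (by
        change α g = α d * (α g / α d)
        rw [mul_div_cancel₀ _ (hα d).ne_zero])
    change IsLocalization.lift (g := α.toRingHom) hα _ * _ = _
    rw [this, div_mul_cancel₀ _ (hα d).ne_zero]
  have eβ : ∀ (g : P) (d : S), β' (IsLocalization.mk' _ g d) = β g / β d := fun g d => by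
    rw [eq_div_iff (hβ d).ne_zero]
    have := (IsLocalization.lift_mk'_spec (S := Localization S) (g := β.toRingHom) (hg := hβ) g
      (β g / β d) d).2 (by
        change β g = β d * (β g / β d)
        rw [mul_div_cancel₀ _ (hβ d).ne_zero])
    change IsLocalization.lift (g := β.toRingHom) hβ _ * _ = _
    rw [this, div_mul_cancel₀ _ (hβ d).ne_zero]
  have hker : ∀ z, z ∈ RingHom.ker α' → β' z = 0 := by
    intro z hz
    obtain ⟨g, d, rfl⟩ := IsLocalization.exists_mk'_eq S z
    rw [RingHom.mem_ker, eα, div_eq_zero_iff, or_iff_left (hα d).ne_zero] at hz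
    rw [eβ, h g hz, zero_div]
  let e := Ideal.quotientKerEquivRange α'
  refine ⟨α'.range, (Ideal.Quotient.liftₐ (RingHom.ker α') β' hker).comp e.symm.toAlgHom,
    fun g d hd => ?_⟩
  refine ⟨⟨IsLocalization.mk' _ g (⟨d, hd⟩ : S), eα g ⟨d, hd⟩⟩, ?_⟩
  have : e.symm ⟨α g / α d, ⟨IsLocalization.mk' _ g (⟨d, hd⟩ : S), eα g ⟨d, hd⟩⟩⟩ =
      Ideal.Quotient.mk _ (IsLocalization.mk' _ g (⟨d, hd⟩ : S)) := by
    rw [AlgEquiv.symm_apply_eq]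
    exact Subtype.ext (eα g ⟨d, hd⟩).symm
  change Ideal.Quotient.liftₐ (RingHom.ker α') β' hker (e.symm _) = _
  rw [this, ← eβ g ⟨d, hd⟩]
  rfl

/-- Finitely many elements of `S` can be specialized to the base field, preserving integrality. -/
def IsSpecializable (K : Type*) {N Γ₀ : Type*} [Field K] [Field N] [Algebra K N]
    [LinearOrderedCommGroupWithZero Γ₀] (w : Valuation N Γ₀) (S : Set N) : Prop :=
  ∀ T : Finset N, (T : Set N) ⊆ S → ∃ (R : Subalgebra K N) (φ : R →ₐ[K] K), ∀ t ∈ T,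
    ∃ h : t ∈ R, w t ≤ 1 → w (algebraMap K N (φ ⟨t, h⟩)) ≤ 1

theorem isSpecializable_range (w : Valuation N Γ₀) : IsSpecializable K w (algebraMap K N).range := by
  intro T hT
  refine ⟨⊥, (Algebra.botEquiv K N).toAlgHom, fun t ht => ⟨Algebra.mem_bot.2 (hT ht), ?_⟩⟩
  obtain ⟨a, rfl⟩ := hT ht
  intro ha
  have : (Algebra.botEquiv K N) ⟨algebraMap K N a, Algebra.mem_bot.2 (hT ht)⟩ = a :=
    (Algebra.botEquiv K N).commutes a
  change w (algebraMap K N (Algebra.botEquiv K N _)) ≤ 1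
  rw [this]
  exact ha

theorem IsSpecializable.trans {M : Type*} [Field M] [Algebra K M] [Algebra M N] [IsScalarTower K M N]
    {w : Valuation N Γ₀} (h₁ : IsSpecializable K w (algebraMap M N).range) {S : Set N}
    (h₂ : IsSpecializable M w S) : IsSpecializable K w S := by
  classical
  intro T hT
  obtain ⟨R, φ, hφ⟩ := h₂ T hT
  choose hm hi using hφ
  obtain ⟨R', ψ, hψ⟩ := h₁ ((Finset.univ : Finset T).image fun t : T => algebraMap M N (φ ⟨t, hm t t.2⟩)) (by
    intro x hx
    obtain ⟨t, -, rfl⟩ := Finset.mem_image.1 hx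
    exact ⟨_, rfl⟩)
  let θ : R.restrictScalars K →ₐ[K] N :=
    (IsScalarTower.toAlgHom K M N).comp (φ.restrictScalars K)
  let Q : Subalgebra K (R.restrictScalars K) := R'.comap θ
  let χ : Q →ₐ[K] K := ψ.comp ((θ.comp Q.val).codRestrict R' fun x => x.2)
  let e : Q ≃ₐ[K] Q.map (R.restrictScalars K).val :=
    Q.equivMapOfInjective _ Subtype.val_injective
  refine ⟨Q.map (R.restrictScalars K).val, χ.comp e.symm.toAlgHom, fun t ht => ?_⟩
  obtain ⟨h', hi'⟩ := hψ (algebraMap M N (φ ⟨t, hm t ht⟩))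
    (Finset.mem_image.2 ⟨⟨t, ht⟩, Finset.mem_univ _, rfl⟩)
  have hQ : (⟨t, hm t ht⟩ : R.restrictScalars K) ∈ Q := h'
  refine ⟨⟨_, hQ, rfl⟩, fun h1 => ?_⟩
  have he : e.symm ⟨t, ⟨_, hQ, rfl⟩⟩ = ⟨⟨t, hm t ht⟩, hQ⟩ := by
    rw [AlgEquiv.symm_apply_eq]
    rfl
  change w (algebraMap K N (χ (e.symm _))) ≤ 1
  rw [he]
  exact hi' (hi t ht h1)

theorem IsSpecializable.mono {w : Valuation N Γ₀} {S S' : Set N} (h : IsSpecializable K w S)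
    (hS : S' ⊆ S) : IsSpecializable K w S' := fun T hT => h T (hT.trans hS)

theorem isSpecializable_iUnion {ι : Type*} [Nonempty ι] {w : Valuation N Γ₀} {S : ι → Set N}
    (hd : Directed (· ⊆ ·) S) (h : ∀ i, IsSpecializable K w (S i)) :
    IsSpecializable K w (⋃ i, S i) := by
  intro T hT
  obtain ⟨i, hi⟩ := hd.exists_mem_subset_of_finset_subset_biUnion hT
  exact h i T hi

/-- A transcendental element that is approximated by elements of the base field, as far as
comparing values of polynomials is concerned, can be specialized. -/
theorem isSpecializable_adjoin_of_filter {w : Valuation N Γ₀} {x : N} (hx : Transcendental K x)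
    (F : Filter K) [F.NeBot]
    (hF : ∀ g d : K[X], d ≠ 0 → w (aeval x g) ≤ w (aeval x d) → ∀ᶠ b in F,
      d.eval b ≠ 0 ∧ w (algebraMap K N (g.eval b)) ≤ w (algebraMap K N (d.eval b))) :
    IsSpecializable K w (K⟮x⟯ : Set N) := by
  intro T hT
  have h1 : ∀ t ∈ T, ∃ g d : K[X], d ≠ 0 ∧ t = aeval x g / aeval x d := by
    intro t ht
    obtain ⟨r, s, rfl⟩ := (mem_adjoin_simple_iff K _).1 (hT ht)
    by_cases hs : s = 0
    · exact ⟨0, 1, one_ne_zero, by simp [hs]⟩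
    · exact ⟨r, s, hs, rfl⟩
  choose! g d hd ht using h1
  have h2 : ∀ᶠ b in F, ∀ t ∈ T, (d t).eval b ≠ 0 ∧
      (w t ≤ 1 → w (algebraMap K N ((g t).eval b)) ≤ w (algebraMap K N ((d t).eval b))) := by
    rw [Filter.eventually_all_finset]
    intro t htT
    have hdx : aeval x (d t) ≠ 0 := fun h0 => hd t htT ((transcendental_iff.1 hx) _ h0)
    by_cases hw : w t ≤ 1
    · rw [ht t htT, map_div₀, div_le_one₀ (zero_lt_iff.2 ((Valuation.ne_zero_iff w).2 hdx))] at hw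
      exact (hF _ _ (hd t htT) hw).mono fun b hb => ⟨hb.1, fun _ => hb.2⟩
    · exact (hF 0 _ (hd t htT) (by simp)).mono fun b hb => ⟨hb.1, fun h => absurd h hw⟩
  obtain ⟨b, hb⟩ := h2.exists
  obtain ⟨R, φ, hφ⟩ := exists_algHom_of_ker_le (aeval x : K[X] →ₐ[K] N) (aeval b)
    fun f hf => by rw [(transcendental_iff.1 hx) f hf, map_zero]
  refine ⟨R, φ, fun t htT => ?_⟩
  obtain ⟨hdb, hle⟩ := hb t htT
  rw [← coe_aeval_eq_eval] at hdb hle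
  obtain ⟨hm, he⟩ := hφ (g t) (d t) hdb
  have hm' : t ∈ R := by rw [ht t htT]; exact hm
  refine ⟨hm', fun h1 => ?_⟩
  have : (⟨t, hm'⟩ : R) = ⟨_, hm⟩ := Subtype.ext (ht t htT)
  rw [this, he, map_div₀, map_div₀, div_le_one₀]
  · exact hle h1
  · rw [zero_lt_iff, Valuation.ne_zero_iff]
    simpa using hdb

end Specialization

section SpecializationHenselian

open IntermediateField

variable {K M N Γ₀ : Type*} [Field K] [Field M] [Field N] [Algebra K M] [Algebra M N] [Algebra K N]
  [IsScalarTower K M N] [LinearOrderedCommGroupWithZero Γ₀] {w : Valuation N Γ₀}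

theorem IsSpecializable.exists_of_finite (h : IsSpecializable K w (algebraMap M N).range) {S : Set M}
    (hS : S.Finite) : ∃ (A : Subalgebra K M) (φ : A →ₐ[K] K), ∀ s ∈ S,
      ∃ hs : s ∈ A, w (algebraMap M N s) ≤ 1 → w (algebraMap K N (φ ⟨s, hs⟩)) ≤ 1 := by
  classical
  obtain ⟨R, φ, hφ⟩ := h (hS.toFinset.image (algebraMap M N)) (by
    intro x hx
    obtain ⟨s, -, rfl⟩ := Finset.mem_image.1 hx
    exact ⟨s, rfl⟩)
  refine ⟨R.comap (IsScalarTower.toAlgHom K M N),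
    φ.comp (((IsScalarTower.toAlgHom K M N).comp
      (R.comap (IsScalarTower.toAlgHom K M N)).val).codRestrict R fun x => x.2), fun s hs => ?_⟩
  exact hφ _ (Finset.mem_image_of_mem _ (hS.mem_toFinset.2 hs))

/-- Specializability passes to an extension by a root provided by Hensel's lemma. -/
theorem IsSpecializable.adjoin_root [CharZero M] {p : ℕ} (hp : p.Prime) (hw : IsPAdicValuation p w)
    (hK : IsHenselianValuation (w.comap (algebraMap K N)))
    (h : IsSpecializable K w (algebraMap M N).range) {y : N} (hy : IsAlgebraic M y)
    (hf : minpoly M y ∈ integralPolys M w) {a : M} (ha : w (algebraMap M N a) ≤ 1)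
    (hya : w (y - algebraMap M N a) < 1) (hd : w (aeval y (derivative (minpoly M y))) = 1) :
    IsSpecializable K w (M⟮y⟯ : Set N) := by
  intro T hT
  have hy1 : w y ≤ 1 := by
    have : y = (y - algebraMap M N a) + algebraMap M N a := by ring
    rw [this]
    exact w.map_add_le hya.le ha
  have : CharZero N := (algebraMap M N).charZero_iff (algebraMap M N).injective |>.1 inferInstance
  have hae : ∀ g : M[X], algebraMap M N (g.eval a) = aeval (algebraMap M N a) g := fun g => by
    rw [aeval_algebraMap_apply, coe_aeval_eq_eval]
  have hunit : ∀ c ∈ integralPolys M w, w (aeval y c) = 1 → w (algebraMap M N (c.eval a)) = 1 := by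
    intro c hc h1
    have h2 := (valuation_aeval_sub_le hc hy1 ha).trans_lt hya
    rw [hae, Valuation.map_sub_swap] at *
    have h3 : aeval (algebraMap M N a) c =
      aeval y c + (aeval (algebraMap M N a) c - aeval y c) := by ring
    rw [h3, Valuation.map_add_eq_of_lt_left _ (by rwa [h1]), h1]
  have hfrac : ∀ t ∈ T, ∃ b c : M[X], c ∈ integralPolys M w ∧ w (aeval y c) = 1 ∧
      aeval y c * t = aeval y b ∧ (w t ≤ 1 → b ∈ integralPolys M w) := by
    intro t ht
    by_cases h1 : w t ≤ 1
    · obtain ⟨b, hb, c, hc, hc1, he⟩ := exists_aeval_fraction w hy hf hd (hT ht) h1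
      exact ⟨b, c, hc, hc1, he, fun _ => hb⟩
    · obtain ⟨g, hg⟩ := exists_aeval_of_mem_adjoin hy (hT ht)
      exact ⟨g, 1, one_mem _, by simp, by simp [hg], fun h2 => absurd h2 h1⟩
  choose! b c hc hc1 hbc hb using hfrac
  set m := minpoly M y with hm
  let coeffs : M[X] → Set M := fun g => (fun i => g.coeff i) '' (g.support : Set ℕ) ∪ {0}
  have hcoeffs : ∀ g i, g.coeff i ∈ coeffs g := by
    intro g i
    by_cases hi : g.coeff i = 0
    · right; simpa using hi
    · left; exact ⟨i, by simpa using hi, rfl⟩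
  have hfin : ∀ g, (coeffs g).Finite := fun g =>
    (g.support.finite_toSet.image _).union (Set.finite_singleton 0)
  let S : Set M := {a, m.eval a / p, ((derivative m).eval a)⁻¹} ∪
      coeffs m ∪ ⋃ t ∈ (T : Set N), (coeffs (b t) ∪ coeffs (c t) ∪ {((c t).eval a)⁻¹})
  have hS : S.Finite := by
    refine Set.Finite.union (Set.Finite.union (by simp) (hfin _)) ?_
    exact Set.Finite.biUnion T.finite_toSet fun t _ =>
      ((hfin _).union (hfin _)).union (Set.finite_singleton _)
  have haS : a ∈ S := by simp [S]
  have hpS : m.eval a / p ∈ S := by simp [S]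
  have hdS : ((derivative m).eval a)⁻¹ ∈ S := by simp [S]
  have hmS : ∀ i, m.coeff i ∈ S := fun i => Or.inl (Or.inr (hcoeffs m i))
  have htS : ∀ t ∈ T, coeffs (b t) ∪ coeffs (c t) ∪ {((c t).eval a)⁻¹} ⊆ S := fun t ht x hx =>
    Or.inr (Set.mem_biUnion (x := t) ht hx)
  have hbS : ∀ t ∈ T, ∀ i, (b t).coeff i ∈ S := fun t ht i =>
    htS t ht (Or.inl (Or.inl (hcoeffs _ i)))
  have hcS : ∀ t ∈ T, ∀ i, (c t).coeff i ∈ S := fun t ht i =>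
    htS t ht (Or.inl (Or.inr (hcoeffs _ i)))
  have hciS : ∀ t ∈ T, ((c t).eval a)⁻¹ ∈ S := fun t ht => htS t ht (Or.inr rfl)
  obtain ⟨A, φ, hφ⟩ := h.exists_of_finite hS
  have hA : S ⊆ A := fun s hs => (hφ s hs).1
  have hp0 : (p : M) ≠ 0 := by exact_mod_cast hp.ne_zero
  have hlift : ∀ g : M[X], (∀ i, g.coeff i ∈ A) → ∃ g' : A[X], g'.map (algebraMap A M) = g := by
    intro g hg
    have : g ∈ Polynomial.lifts (algebraMap A M) := by
      rw [Polynomial.lifts_iff_coeff_lifts]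
      exact fun i => ⟨⟨_, hg i⟩, rfl⟩
    exact this
  let aA : A := ⟨a, hA haS⟩
  have hev : ∀ g' : A[X], ((g'.eval aA : A) : M) = (g'.map (algebraMap A M)).eval a := fun g' =>
    (eval_map_apply (algebraMap A M) aA).symm
  have hevK : ∀ g' : A[X], φ (g'.eval aA) = (g'.map φ.toRingHom).eval (φ aA) := fun g' =>
    (eval_map_apply φ.toRingHom aA).symm
  have hKle : ∀ g' : A[X], (∀ i, (g'.map (algebraMap A M)).coeff i ∈ S) →
      g'.map (algebraMap A M) ∈ integralPolys M w → g'.map φ.toRingHom ∈ integralPolys K w := by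
    intro g' hg hi
    rw [mem_integralPolys] at hi ⊢
    intro i
    rw [coeff_map]
    have h1 := hg i
    have h2 := hi i
    rw [coeff_map] at h1 h2
    exact (hφ _ h1).2 h2
  have haK : w (algebraMap K N (φ aA)) ≤ 1 := (hφ a haS).2 ha
  have hone : ∀ g' : A[X], g'.map φ.toRingHom ∈ integralPolys K w →
      w (algebraMap M N ((g'.map (algebraMap A M)).eval a)) = 1 →
      ((g'.map (algebraMap A M)).eval a)⁻¹ ∈ S →
      w (algebraMap K N ((g'.map φ.toRingHom).eval (φ aA))) = 1 := by
    intro g' hg h1 hi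
    have hle : w (algebraMap K N ((g'.map φ.toRingHom).eval (φ aA))) ≤ 1 := by
      rw [← coe_aeval_eq_eval, ← aeval_algebraMap_apply]
      exact valuation_aeval_le_one hg haK
    have hmul : g'.eval aA * ⟨_, hA hi⟩ = 1 := by
      apply Subtype.ext
      change ((g'.eval aA : A) : M) * _ = 1
      rw [hev, mul_inv_cancel₀]
      intro h0
      simp [h0] at h1
    have h2 := (hφ _ hi).2 (by rw [map_inv₀, map_inv₀, h1, inv_one])
    have h3 := congrArg (fun x => w (algebraMap K N (φ x))) hmul
    simp only [map_mul, map_one] at h3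
    rw [hevK] at h3
    refine le_antisymm hle ?_
    rw [← h3]
    exact mul_le_of_le_one_right' h2
  obtain ⟨μ, hμ, -, hμm⟩ := Polynomial.lifts_and_natDegree_eq_and_monic
    (hlift m fun i => hA (hmS i)) (minpoly.monic hy.isIntegral)
  have hμK : μ.map φ.toRingHom ∈ integralPolys K w :=
    hKle μ (fun i => by rw [hμ]; exact hmS i) (by rw [hμ]; exact hf)
  obtain ⟨η, hη, hηa⟩ := hK (μ.map φ.toRingHom) (hμm.map _) (mem_integralPolys.1 hμK) (φ aA) haK
    (by
      have h1 : μ.eval aA = ⟨_, hA hpS⟩ * (p : A) := by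
        apply Subtype.ext
        rw [hev, hμ]
        simp [hp0]
      have h2 : w (algebraMap M N (m.eval a)) ≤ w p := by
        refine hw.le_of_lt_one _ ?_
        rw [hae, ← sub_zero (aeval _ m), ← minpoly.aeval M y]
        refine (valuation_aeval_sub_le hf ha hy1).trans_lt ?_
        rwa [Valuation.map_sub_swap]
      have h3 := (hφ _ hpS).2 (by
        rw [map_div₀, map_div₀, map_natCast]
        exact div_le_one_of_le₀ h2 zero_le)
      rw [Valuation.comap_apply, ← hevK, h1, map_mul, map_mul, map_mul, map_natCast, map_natCast]
      exact (mul_le_of_le_one_left' h3).trans_lt hw.lt_one)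
    (by
      rw [Valuation.comap_apply, derivative_map]
      refine hone _ ?_ ?_ ?_
      · rw [← derivative_map]
        exact derivative_mem_integralPolys hμK
      · rw [← derivative_map, hμ]
        exact hunit _ (derivative_mem_integralPolys hf) hd
      · rw [← derivative_map, hμ]
        exact hdS)
  rw [Valuation.comap_apply, map_sub] at hηa
  have hη1 : w (algebraMap K N η) ≤ 1 := by
    have : algebraMap K N η = (algebraMap K N η - algebraMap K N (φ aA)) + algebraMap K N (φ aA) := by
      ring
    rw [this]
    exact w.map_add_le hηa.le haK
  let α : A[X] →ₐ[K] N := eval₂AlgHom (IsScalarTower.toAlgHom K A N) y fun _ => Commute.all _ _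
  let β : A[X] →ₐ[K] K := eval₂AlgHom φ η fun _ => Commute.all _ _
  have hα : ∀ g, α g = aeval y (g.map (algebraMap A M)) := fun g => by
    rw [aeval_map_algebraMap]; rfl
  have hβ : ∀ g, β g = (g.map φ.toRingHom).eval η := fun g => by
    rw [eval_map]; rfl
  obtain ⟨R, ψ, hψ⟩ := exists_algHom_of_ker_le α β (by
    intro g hg
    rw [hα] at hg
    have h1 := minpoly.dvd M y hg
    rw [← hm, ← hμ, map_dvd_map _ Subtype.val_injective hμm] at h1
    obtain ⟨q, rfl⟩ := h1
    rw [hβ, Polynomial.map_mul, eval_mul, hη, zero_mul])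
  have hηle : ∀ g : K[X], g ∈ integralPolys K w → w (algebraMap K N (g.eval η)) ≤ 1 := by
    intro g hg
    rw [← coe_aeval_eq_eval, ← aeval_algebraMap_apply]
    exact valuation_aeval_le_one hg hη1
  refine ⟨R, ψ, fun t ht => ?_⟩
  obtain ⟨b', hb'⟩ := hlift (b t) fun i => hA (hbS t ht i)
  obtain ⟨c', hc'⟩ := hlift (c t) fun i => hA (hcS t ht i)
  have hcK : c'.map φ.toRingHom ∈ integralPolys K w :=
    hKle c' (fun i => by rw [hc']; exact hcS t ht i) (by rw [hc']; exact hc t ht)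
  have hβc : w (algebraMap K N (β c')) = 1 := by
    have h1 := hone c' hcK (by rw [hc']; exact hunit _ (hc t ht) (hc1 t ht))
      (by rw [hc']; exact hciS t ht)
    have h2 := (valuation_aeval_sub_le hcK hη1 haK).trans_lt hηa
    rw [aeval_algebraMap_apply, aeval_algebraMap_apply, coe_aeval_eq_eval, coe_aeval_eq_eval] at h2
    rw [hβ, ← sub_add_cancel (algebraMap K N (eval η _)) (algebraMap K N (eval (φ aA)
      (c'.map φ.toRingHom))), Valuation.map_add_eq_of_lt_right _ (by rwa [h1]), h1]
  have hβ0 : β c' ≠ 0 := by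
    intro h0
    simp [h0] at hβc
  obtain ⟨hmem, he⟩ := hψ b' c' hβ0
  have ht' : t = α b' / α c' := by
    rw [hα, hα, hb', hc', eq_div_iff, mul_comm, hbc t ht]
    intro h0
    have := hc1 t ht
    simp [h0] at this
  have htR : t ∈ R := by rw [ht']; exact hmem
  refine ⟨htR, fun h1 => ?_⟩
  have : (⟨t, htR⟩ : R) = ⟨_, hmem⟩ := Subtype.ext ht'
  rw [this, he, map_div₀, map_div₀, hβc, div_one, hβ]
  exact hηle _ (hKle b' (fun i => by rw [hb']; exact hbS t ht i) (by rw [hb']; exact hb t ht h1))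

end SpecializationHenselian

section Approximation

variable {K N Γ₀ : Type*} [Field K] [Field N] [Algebra K N] [LinearOrderedCommGroupWithZero Γ₀]

/-- The filter of elements of `K` approaching `y` as closely as possible. -/
def approxFilter (K : Type*) {N Γ₀ : Type*} [Field K] [Field N] [Algebra K N]
    [LinearOrderedCommGroupWithZero Γ₀] (w : Valuation N Γ₀) (y : N) : Filter K where
  sets := {s | ∃ c : K, ∀ b : K, w (y - algebraMap K N b) ≤ w (y - algebraMap K N c) → b ∈ s}
  univ_sets := ⟨0, fun _ _ => trivial⟩
  sets_of_superset := fun ⟨c, hc⟩ h => ⟨c, fun b hb => h (hc b hb)⟩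
  inter_sets := by
    rintro s t ⟨c, hc⟩ ⟨d, hd⟩
    rcases le_total (w (y - algebraMap K N c)) (w (y - algebraMap K N d)) with h | h
    · exact ⟨c, fun b hb => ⟨hc b hb, hd b (hb.trans h)⟩⟩
    · exact ⟨d, fun b hb => ⟨hc b (hb.trans h), hd b hb⟩⟩

variable {w : Valuation N Γ₀} {y : N}

theorem eventually_approxFilter {P : K → Prop} : (∀ᶠ b in approxFilter K w y, P b) ↔
    ∃ c : K, ∀ b : K, w (y - algebraMap K N b) ≤ w (y - algebraMap K N c) → P b := Iff.rfl

theorem eventually_approxFilter_le (c : K) :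
    ∀ᶠ b in approxFilter K w y, w (y - algebraMap K N b) ≤ w (y - algebraMap K N c) :=
  eventually_approxFilter.2 ⟨c, fun _ h => h⟩

instance : (approxFilter K w y).NeBot := by
  refine Filter.neBot_iff.2 fun h => ?_
  have h1 : ∀ᶠ _ in approxFilter K w y, False := by rw [h]; exact Filter.eventually_bot
  obtain ⟨c, hc⟩ := eventually_approxFilter.1 h1
  exact hc c le_rfl

theorem eventually_approxFilter_lt
    (hy : ∀ b : K, ∃ b' : K, w (y - algebraMap K N b') < w (y - algebraMap K N b)) (c : K) :
    ∀ᶠ b in approxFilter K w y, w (y - algebraMap K N b) < w (y - algebraMap K N c) := by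
  obtain ⟨d, hd⟩ := hy c
  exact (eventually_approxFilter_le d).mono fun b hb => hb.trans_lt hd

theorem valuation_sub_pos
    (hy : ∀ b : K, ∃ b' : K, w (y - algebraMap K N b') < w (y - algebraMap K N b)) (c : K) :
    0 < w (y - algebraMap K N c) := by
  obtain ⟨d, hd⟩ := hy c
  exact zero_le.trans_lt hd

theorem IsPAdicValuation.eventually_approxFilter_le {p : ℕ} (hw : IsPAdicValuation p w)
    (hy : ∀ b : K, ∃ b' : K, w (y - algebraMap K N b') < w (y - algebraMap K N b)) (c : K)
    (e : ℕ) :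
    ∀ᶠ b in approxFilter K w y,
      w (y - algebraMap K N b) ≤ w (p : N) ^ e * w (y - algebraMap K N c) := by
  induction e with
  | zero => simpa using _root_.eventually_approxFilter_le c
  | succ e ih =>
    obtain ⟨d, hd⟩ := ih.exists
    obtain ⟨d', hd'⟩ := hy d
    refine (_root_.eventually_approxFilter_le d').mono fun b hb => hb.trans ?_
    have h1 : w (y - algebraMap K N d') ≤ w p * w (y - algebraMap K N d) := by
      rw [← div_le_iff₀ (valuation_sub_pos hy d), ← map_div₀]
      refine hw.le_of_lt_one _ ?_
      rwa [map_div₀, div_lt_one₀ (valuation_sub_pos hy d)]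
    rw [pow_succ', mul_assoc]
    exact h1.trans (mul_le_mul_right hd _)

/-- If `y` has no best approximation in `K`, then near `y` the monomials of a polynomial have
distinct values. -/
theorem eventually_le_valuation_eval
    (hy : ∀ b : K, ∃ b' : K, w (y - algebraMap K N b') < w (y - algebraMap K N b)) (h : N[X]) :
    ∀ᶠ b in approxFilter K w y, ∀ i,
      w (h.coeff i) * w (y - algebraMap K N b) ^ i ≤ w (h.eval (algebraMap K N b - y)) := by
  have key : ∀ i j, i < j → h.coeff i ≠ 0 → h.coeff j ≠ 0 → ∀ᶠ b in approxFilter K w y,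
      w (h.coeff i) * w (y - algebraMap K N b) ^ i ≠
        w (h.coeff j) * w (y - algebraMap K N b) ^ j := by
    intro i j hij hi hj
    by_cases hex : ∃ c : K, w (h.coeff i) * w (y - algebraMap K N c) ^ i =
        w (h.coeff j) * w (y - algebraMap K N c) ^ j
    · obtain ⟨c, hc⟩ := hex
      refine (eventually_approxFilter_lt hy c).mono fun b hb he => ?_
      obtain ⟨k, rfl⟩ := Nat.exists_eq_add_of_lt hij
      have hpos := valuation_sub_pos hy
      rw [show i + k + 1 = (k + 1) + i by ring, pow_add, ← mul_assoc] at hc he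
      have hc' := mul_right_cancel₀ (pow_ne_zero i (hpos c).ne') hc
      have he' := mul_right_cancel₀ (pow_ne_zero i (hpos b).ne') he
      rw [he'] at hc'
      rw [show i + k + 1 = k + 1 + i by ring] at hj
      have := mul_left_cancel₀ ((Valuation.ne_zero_iff w).2 hj) hc'
      exact (pow_lt_pow_left₀ hb zero_le (Nat.succ_ne_zero k)).ne this
    · exact Filter.Eventually.of_forall fun b hb => hex ⟨b, hb⟩
  have h2 : ∀ᶠ b in approxFilter K w y, ∀ i ∈ h.support, ∀ j ∈ h.support, i ≠ j →
      w (h.coeff i) * w (y - algebraMap K N b) ^ i ≠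
        w (h.coeff j) * w (y - algebraMap K N b) ^ j := by
    rw [Filter.eventually_all_finset]
    intro i hi
    rw [Filter.eventually_all_finset]
    intro j hj
    rw [mem_support_iff] at hi hj
    rcases lt_trichotomy i j with hij | rfl | hij
    · exact (key i j hij hi hj).mono fun b hb _ => hb
    · exact Filter.Eventually.of_forall fun b hb => absurd rfl hb
    · exact (key j i hij hj hi).mono fun b hb _ => hb.symm
  refine h2.mono fun b hb i => ?_
  have hval : ∀ i, w (h.coeff i) * w (y - algebraMap K N b) ^ i =
      w (h.coeff i * (algebraMap K N b - y) ^ i) := fun i => by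
    rw [map_mul, map_pow, Valuation.map_sub_swap]
  simp only [hval] at hb ⊢
  by_cases hi : i ∈ h.support
  · rw [eval_eq_sum, Polynomial.sum]
    exact w.le_map_sum_of_injOn (t := fun i => h.coeff i * (algebraMap K N b - y) ^ i)
      (fun i hi j hj hij _ => hb i hi j hj hij) hi
  · rw [notMem_support_iff] at hi
    simp [hi]

theorem coeff_taylor_derivative (g : N[X]) (r : N) (i : ℕ) :
    (taylor r (derivative g)).coeff i = (taylor r g).coeff (i + 1) * (i + 1) := by
  have : taylor r (derivative g) = derivative (taylor r g) := by
    simp [taylor_apply, derivative_comp]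
  rw [this, coeff_derivative]

theorem exists_eval_eq_zero_of_not_eventually [CharZero N] {p : ℕ} (hp : p.Prime)
    (hw : IsPAdicValuation p w) (hK : IsHenselianValuation (w.comap (algebraMap K N)))
    (hy : ∀ b : K, ∃ b' : K, w (y - algebraMap K N b') < w (y - algebraMap K N b))
    {g : K[X]} (hg' : derivative g ≠ 0)
    (ih : ∀ f : K[X], f ≠ 0 → f.natDegree < g.natDegree → ∀ᶠ b in approxFilter K w y,
      w (algebraMap K N (f.eval b) - aeval y f) < w (aeval y f))
    (hg : ¬ ∀ᶠ b in approxFilter K w y,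
      w (algebraMap K N (g.eval b) - aeval y g) < w (aeval y g)) : ∃ r, g.eval r = 0 := by
  have hn : g.natDegree ≠ 0 := fun h => by
    rw [eq_C_of_natDegree_eq_zero h, derivative_C] at hg'
    exact hg' rfl
  set H := taylor y (g.map (algebraMap K N)) with hH
  have hev : ∀ (f : K[X]) b, (taylor y (f.map (algebraMap K N))).eval (algebraMap K N b - y) =
      algebraMap K N (f.eval b) := fun f b => by
    rw [taylor_eval, sub_add_cancel, eval_map_algebraMap, aeval_algebraMap_apply, coe_aeval_eq_eval]
  have hev0 : ∀ (f : K[X]), (taylor y (f.map (algebraMap K N))).coeff 0 = aeval y f := fun f => by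
    rw [taylor_coeff_zero, eval_map_algebraMap]
  have hH1 : H.coeff 1 = aeval y (derivative g) := by
    rw [hH, taylor_coeff_one, derivative_map, eval_map_algebraMap]
  have hst := ih _ hg' (natDegree_derivative_lt hn)
  have hγ : 0 < w (H.coeff 1) := by
    obtain ⟨b, hb⟩ := hst.exists
    rw [hH1]
    exact zero_le.trans_lt hb
  have E1 : ∀ᶠ b in approxFilter K w y, ∀ i, i ≠ 0 →
      w (H.coeff (i + 1)) * w ((i + 1 : ℕ) : N) * w (y - algebraMap K N b) ^ i <
        w (H.coeff 1) := by
    have h1 := eventually_le_valuation_eval hy (taylor y ((derivative g).map (algebraMap K N)) -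
      C (aeval y (derivative g)))
    filter_upwards [hst, h1] with b hb1 hb2 i hi
    have := hb2 i
    rw [eval_sub, hev, eval_C, coeff_sub, coeff_C_of_ne_zero hi, sub_zero, ← derivative_map,
      coeff_taylor_derivative, map_mul, ← hH] at this
    rw [hH1]
    push_cast
    exact this.trans_lt hb1
  have E2 : ∀ᶠ b in approxFilter K w y, ∀ i ∈ Finset.range g.natDegree, i ≠ 0 →
      w (H.coeff (i + 1)) * w (y - algebraMap K N b) ^ i < w (H.coeff 1) := by
    rw [Filter.eventually_all_finset]
    intro i hi
    by_cases hi0 : i = 0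
    · exact Filter.Eventually.of_forall fun b hb => absurd hi0 hb
    obtain ⟨c, hc⟩ := E1.exists
    obtain ⟨e, he⟩ := exists_valuation_natCast_eq hp hw.lt_one (Nat.succ_ne_zero i)
    refine (hw.eventually_approxFilter_le hy c e).mono fun b hb _ => ?_
    refine lt_of_le_of_lt ?_ (hc i hi0)
    rw [he, mul_assoc]
    refine mul_le_mul_right ?_ _
    refine (pow_le_pow_left₀ zero_le hb i).trans ?_
    rw [mul_pow]
    exact mul_le_mul_left (pow_le_of_le_one zero_le (pow_le_one' hw.lt_one.le e) hi0) _
  have E3 : ∀ᶠ b in approxFilter K w y, ∀ i ∈ Finset.range g.natDegree,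
      w (algebraMap K N ((taylor b g).coeff (i + 1))) = w (H.coeff (i + 1)) := by
    rw [Filter.eventually_all_finset]
    intro i hi
    have h1 : H.coeff (i + 1) = aeval y (hasseDeriv (i + 1) g) := by
      rw [hH, taylor_coeff, ← eval_map_algebraMap]
      congr 1
      ext j
      simp [hasseDeriv_coeff]
    rw [h1]
    simp only [taylor_coeff]
    by_cases h0 : hasseDeriv (i + 1) g = 0
    · simp [h0]
    · refine (ih _ h0 ?_).mono fun b hb => ?_
      · have := natDegree_hasseDeriv_le g (i + 1)
        have := Finset.mem_range.1 hi
        omega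
      · rw [← sub_add_cancel (algebraMap K N _) (aeval y (hasseDeriv (i + 1) g)),
          Valuation.map_add_eq_of_lt_right _ hb]
  obtain ⟨b, hb, hb2, hb3⟩ := ((Filter.not_eventually.1 hg).and_eventually (E2.and E3)).exists
  rw [not_lt] at hb
  have hle : w (algebraMap K N (g.eval b) - aeval y g) ≤
      w (H.coeff 1) * w (y - algebraMap K N b) := by
    have : algebraMap K N (g.eval b) - aeval y g = ∑ i ∈ Finset.range g.natDegree,
        H.coeff (i + 1) * (algebraMap K N b - y) ^ (i + 1) := by
      rw [← hev, ← hev0, ← hH, eval_eq_sum_range, hH, natDegree_taylor, natDegree_map, ← hH,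
        Finset.sum_range_succ']
      simp
    rw [this]
    refine w.map_sum_le fun i hi => ?_
    rw [map_mul, map_pow, Valuation.map_sub_swap, pow_succ, ← mul_assoc]
    refine mul_le_mul_left ?_ _
    by_cases hi0 : i = 0
    · simp [hi0]
    · exact (hb2 i hi hi0).le
  have hle' : w (algebraMap K N (g.eval b)) ≤ w (H.coeff 1) * w (y - algebraMap K N b) := by
    rw [← sub_add_cancel (algebraMap K N (g.eval b)) (aeval y g)]
    exact w.map_add_le hle (hb.trans hle)
  by_cases hgb : g.eval b = 0
  · exact ⟨b, hgb⟩
  have hgb' : w (algebraMap K N (g.eval b)) ≠ 0 := by simpa using hgb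
  have h1 : w (algebraMap K N ((taylor b g).coeff 1)) = w (H.coeff 1) :=
    hb3 0 (Finset.mem_range.2 (Nat.pos_of_ne_zero hn))
  have h1' : (taylor b g).coeff 1 ≠ 0 := by
    intro h0
    rw [h0, map_zero, map_zero] at h1
    exact hγ.ne h1
  let s : K := g.eval b / (taylor b g).coeff 1
  have hs : g.eval b ≠ 0 := hgb
  obtain ⟨t, ht, -⟩ := hK.exists_root_of_linear
    (f := C (g.eval b)⁻¹ * (taylor b g).comp (C s * X)) (by
      rw [coeff_C_mul, comp_C_mul_X_coeff, taylor_coeff_zero, pow_zero, mul_one, inv_mul_cancel₀ hgb,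
        map_one]) (by
      rw [coeff_C_mul, comp_C_mul_X_coeff, pow_one]
      have : (eval b g)⁻¹ * ((taylor b g).coeff 1 * s) = 1 := by
        simp only [s]
        field_simp
      rw [this, map_one]) (by
      intro i hi
      obtain ⟨j, rfl⟩ : ∃ j, i = j + 1 := ⟨i - 1, by omega⟩
      by_cases hj : j ∈ Finset.range g.natDegree
      · rw [coeff_C_mul, comp_C_mul_X_coeff, Valuation.comap_apply]
        simp only [s, map_mul, map_inv₀, map_pow, map_div₀, h1, hb3 j hj]
        set u := w (algebraMap K N (g.eval b)) with hu
        set γ := w (H.coeff 1) with hγ'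
        have e1 : u⁻¹ * (w (H.coeff (j + 1)) * (u / γ) ^ (j + 1)) =
            w (H.coeff (j + 1)) * (u / γ) ^ j / γ := by
          rw [pow_succ]
          field_simp
        rw [e1, div_lt_one₀ hγ]
        refine lt_of_le_of_lt (mul_le_mul_right (pow_le_pow_left₀ zero_le ?_ j) _)
          (hb2 j hj (by omega))
        rw [div_le_iff₀ hγ, mul_comm]
        exact hle'
      · rw [coeff_C_mul, comp_C_mul_X_coeff, coeff_eq_zero_of_natDegree_lt]
        · simp
        · rw [natDegree_taylor]
          have := Finset.mem_range.not.1 hj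
          omega)
  refine ⟨s * t + b, ?_⟩
  rw [eval_mul, eval_C, eval_comp, taylor_eval, eval_mul, eval_C, eval_X, mul_eq_zero] at ht
  exact ht.resolve_left (inv_ne_zero hgb)

/-- Over a henselian `p`-adically valued field, polynomials have stable values near an element
without best approximation. -/
theorem eventually_valuation_eval_sub_lt [CharZero N] {p : ℕ} (hp : p.Prime)
    (hw : IsPAdicValuation p w) (hK : IsHenselianValuation (w.comap (algebraMap K N)))
    (hy : ∀ b : K, ∃ b' : K, w (y - algebraMap K N b') < w (y - algebraMap K N b))
    {g : K[X]} (hg : g ≠ 0) : ∀ᶠ b in approxFilter K w y,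
      w (algebraMap K N (g.eval b) - aeval y g) < w (aeval y g) := by
  have : CharZero K := (algebraMap K N).charZero_iff (algebraMap K N).injective |>.2 inferInstance
  induction hn : g.natDegree using Nat.strong_induction_on generalizing g with
  | _ n ih =>
  subst hn
  by_contra hns
  by_cases hg' : derivative g = 0
  · refine hns (Filter.Eventually.of_forall fun b => ?_)
    have := derivative_eq_zero.1 hg'
    rw [eq_C_of_natDegree_eq_zero this] at hg ⊢
    simpa [zero_lt_iff] using hg
  obtain ⟨r, hr⟩ := exists_eval_eq_zero_of_not_eventually hp hw hK hy hg'
    (fun f hf hd => ih _ hd hf rfl) hns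
  obtain ⟨h, rfl⟩ := dvd_iff_isRoot.2 hr
  have h0 : h ≠ 0 := right_ne_zero_of_mul hg
  refine hns ?_
  have hd : h.natDegree < ((X - C r) * h).natDegree := by
    rw [natDegree_mul (X_sub_C_ne_zero r) h0, natDegree_X_sub_C]
    omega
  filter_upwards [ih _ hd h0 rfl, eventually_approxFilter_lt hy r] with b hb1 hb2
  have e : algebraMap K N (((X - C r) * h).eval b) - aeval y ((X - C r) * h) =
      (algebraMap K N b - y) * algebraMap K N (h.eval b) +
        (y - algebraMap K N r) * (algebraMap K N (h.eval b) - aeval y h) := by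
    simp
    ring
  have hb3 : w (algebraMap K N (h.eval b)) = w (aeval y h) := by
    rw [← sub_add_cancel (algebraMap K N _) (aeval y h), Valuation.map_add_eq_of_lt_right _ hb1]
  have hpos : 0 < w (aeval y h) := zero_le.trans_lt hb1
  have hpos' := valuation_sub_pos hy r
  rw [e]
  simp only [map_mul, map_sub, aeval_X, aeval_C]
  refine w.map_add_lt ?_ ?_
  · rw [map_mul, hb3, Valuation.map_sub_swap]
    gcongr
  · rw [map_mul]
    gcongr

theorem transcendental_of_no_best_approx [CharZero N] {p : ℕ} (hp : p.Prime)
    (hw : IsPAdicValuation p w) (hK : IsHenselianValuation (w.comap (algebraMap K N)))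
    (hy : ∀ b : K, ∃ b' : K, w (y - algebraMap K N b') < w (y - algebraMap K N b)) :
    Transcendental K y := by
  refine transcendental_iff.2 fun g hg => by_contra fun h0 => ?_
  obtain ⟨b, hb⟩ := (eventually_valuation_eval_sub_lt hp hw hK hy h0).exists
  simp [hg] at hb

theorem eventually_valuation_eval_eq [CharZero N] {p : ℕ} (hp : p.Prime)
    (hw : IsPAdicValuation p w) (hK : IsHenselianValuation (w.comap (algebraMap K N)))
    (hy : ∀ b : K, ∃ b' : K, w (y - algebraMap K N b') < w (y - algebraMap K N b)) (g : K[X]) :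
    ∀ᶠ b in approxFilter K w y, w (algebraMap K N (g.eval b)) = w (aeval y g) := by
  by_cases hg : g = 0
  · simp [hg]
  refine (eventually_valuation_eval_sub_lt hp hw hK hy hg).mono fun b hb => ?_
  rw [← sub_add_cancel (algebraMap K N _) (aeval y g), Valuation.map_add_eq_of_lt_right _ hb]

open IntermediateField in
theorem isSpecializable_adjoin_of_no_best_approx [CharZero N] {p : ℕ} (hp : p.Prime)
    (hw : IsPAdicValuation p w) (hK : IsHenselianValuation (w.comap (algebraMap K N)))
    (hy : ∀ b : K, ∃ b' : K, w (y - algebraMap K N b') < w (y - algebraMap K N b)) :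
    IsSpecializable K w (K⟮y⟯ : Set N) := by
  have ht := transcendental_of_no_best_approx hp hw hK hy
  refine isSpecializable_adjoin_of_filter ht (approxFilter K w y) fun g d hd h => ?_
  filter_upwards [eventually_valuation_eval_eq hp hw hK hy g,
    eventually_valuation_eval_eq hp hw hK hy d] with b hg hd'
  refine ⟨fun h0 => hd (transcendental_iff.1 ht d ?_), by rwa [hg, hd']⟩
  rwa [h0, map_zero, map_zero, eq_comm, map_eq_zero] at hd'

open IntermediateField in
theorem exists_valuation_eq_of_no_best_approx [CharZero N] {p : ℕ} (hp : p.Prime)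
    (hw : IsPAdicValuation p w) (hK : IsHenselianValuation (w.comap (algebraMap K N)))
    (hy : ∀ b : K, ∃ b' : K, w (y - algebraMap K N b') < w (y - algebraMap K N b)) {u : N}
    (hu : u ∈ K⟮y⟯) : ∃ a : K, w u = w (algebraMap K N a) := by
  obtain ⟨r, s, rfl⟩ := (mem_adjoin_simple_iff K _).1 hu
  obtain ⟨b, hr, hs⟩ := ((eventually_valuation_eval_eq hp hw hK hy r).and
    (eventually_valuation_eval_eq hp hw hK hy s)).exists
  exact ⟨r.eval b / s.eval b, by rw [map_div₀, map_div₀, map_div₀, hr, hs]⟩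

end Approximation

section ValueTranscendental

open IntermediateField

variable {K N Γ₀ : Type*} [Field K] [Field N] [Algebra K N] [LinearOrderedCommGroupWithZero Γ₀]

/-- The filter of nonzero elements of `K` whose values approach that of `x` from below. -/
def belowFilter (w : Valuation N Γ₀) (x : N) {c₀ : K} (h₀ : c₀ ≠ 0)
    (hc₀ : w (algebraMap K N c₀) < w x) : Filter K where
  sets := {s | ∃ c : K, c ≠ 0 ∧ w (algebraMap K N c) < w x ∧
    ∀ b : K, w (algebraMap K N c) ≤ w (algebraMap K N b) → w (algebraMap K N b) < w x → b ∈ s}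
  univ_sets := ⟨c₀, h₀, hc₀, fun _ _ _ => trivial⟩
  sets_of_superset := fun ⟨c, h0, hc, hs⟩ h => ⟨c, h0, hc, fun b hb hb' => h (hs b hb hb')⟩
  inter_sets := by
    rintro s t ⟨c, h0, hc, hs⟩ ⟨d, h0', hd, ht⟩
    rcases le_total (w (algebraMap K N c)) (w (algebraMap K N d)) with h | h
    · exact ⟨d, h0', hd, fun b hb hb' => ⟨hs b (h.trans hb) hb', ht b hb hb'⟩⟩
    · exact ⟨c, h0, hc, fun b hb hb' => ⟨hs b hb hb', ht b (h.trans hb) hb'⟩⟩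

variable {w : Valuation N Γ₀} {x : N}

section

variable {c₀ : K} {h₀ : c₀ ≠ 0} {hc₀ : w (algebraMap K N c₀) < w x}

theorem eventually_belowFilter {P : K → Prop} : (∀ᶠ b in belowFilter w x h₀ hc₀, P b) ↔
    ∃ c : K, c ≠ 0 ∧ w (algebraMap K N c) < w x ∧ ∀ b : K,
      w (algebraMap K N c) ≤ w (algebraMap K N b) → w (algebraMap K N b) < w x → P b := Iff.rfl

theorem eventually_belowFilter_lt :
    ∀ᶠ b in belowFilter w x h₀ hc₀, b ≠ 0 ∧ w (algebraMap K N b) < w x :=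
  eventually_belowFilter.2 ⟨c₀, h₀, hc₀, fun b hb hb' => ⟨fun h0 => by
    rw [h0, map_zero, map_zero, le_zero_iff, Valuation.zero_iff, map_eq_zero] at hb
    exact h₀ hb, hb'⟩⟩

instance : (belowFilter w x h₀ hc₀).NeBot := by
  refine Filter.neBot_iff.2 fun h => ?_
  have h1 : ∀ᶠ _ in belowFilter w x h₀ hc₀, False := by rw [h]; exact Filter.eventually_bot
  obtain ⟨c, -, h, hc⟩ := eventually_belowFilter.1 h1
  exact hc c le_rfl h

theorem eventually_monomial_lt [CharZero N] {p : ℕ} (hp : p.Prime) (hw : IsPAdicValuation p w)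
    (hK : HasZGroup p (w.comap (algebraMap K N)))
    (hx : ∀ n : ℕ, n ≠ 0 → ∀ a : K, w x ^ n ≠ w (algebraMap K N a)) {a c : K} {i k : ℕ}
    (h : w (algebraMap K N a) * w x ^ i < w (algebraMap K N c) * w x ^ k) :
    ∀ᶠ b in belowFilter w x h₀ hc₀, w (algebraMap K N a) * w (algebraMap K N b) ^ i <
      w (algebraMap K N c) * w (algebraMap K N b) ^ k := by
  have hx0 : 0 < w x := by
    rw [zero_lt_iff]
    intro h0
    exact hx 1 one_ne_zero 0 (by simp [h0])
  have hp0 : 0 < w (p : N) := by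
    rw [zero_lt_iff, Valuation.ne_zero_iff]
    exact_mod_cast hp.ne_zero
  have hc0 : w (algebraMap K N c) ≠ 0 := by
    intro h0
    simp [h0] at h
  rcases lt_or_ge k i with hki | hik
  · obtain ⟨r, rfl⟩ := Nat.exists_eq_add_of_lt hki
    refine eventually_belowFilter_lt.mono fun b hb => ?_
    have hb0 : 0 < w (algebraMap K N b) := by
      rw [zero_lt_iff, Valuation.ne_zero_iff]
      simpa using hb.1
    rw [show k + r + 1 = (r + 1) + k by ring, pow_add, ← mul_assoc] at h ⊢
    have h1 := lt_of_mul_lt_mul_right h zero_le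
    refine mul_lt_mul_of_pos_right (lt_of_le_of_lt ?_ h1) (pow_pos hb0 k)
    exact mul_le_mul_right (pow_le_pow_left₀ zero_le hb.2.le _) _
  obtain ⟨r, rfl⟩ := Nat.exists_eq_add_of_le hik
  rw [add_comm i r, pow_add, ← mul_assoc] at h
  have h1 := lt_of_mul_lt_mul_right h zero_le
  suffices ∀ᶠ b in belowFilter w x h₀ hc₀, w (algebraMap K N a) <
      w (algebraMap K N c) * w (algebraMap K N b) ^ r by
    filter_upwards [this, eventually_belowFilter_lt] with b hb hb'
    have hb0 : 0 < w (algebraMap K N b) := by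
      rw [zero_lt_iff, Valuation.ne_zero_iff]
      simpa using hb'.1
    rw [add_comm i r, pow_add, ← mul_assoc]
    exact mul_lt_mul_of_pos_right hb (pow_pos hb0 i)
  rcases Nat.eq_zero_or_pos r with rfl | hr
  · simpa using h1
  by_cases ha : a = 0
  · refine eventually_belowFilter_lt.mono fun b hb => ?_
    rw [ha, map_zero, map_zero, zero_lt_iff]
    refine mul_ne_zero hc0 (pow_ne_zero _ ?_)
    simpa using hb.1
  have hc : c ≠ 0 := by
    rintro rfl
    simp at hc0
  obtain ⟨z, j, hz⟩ := hK (a / c) (div_ne_zero ha hc) r hr.ne'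
  simp only [Valuation.comap_apply, map_natCast] at hz
  obtain ⟨s, hs⟩ := Int.eq_ofNat_of_zero_le (Int.emod_nonneg j (b := (r : ℤ)) (by omega))
  have hsr : s < r := by
    have := Int.emod_lt_of_pos j (b := (r : ℤ)) (by omega)
    omega
  have hj : j = (j / r) * r + s := by
    rw [← hs]
    exact (Int.ediv_mul_add_emod j r).symm
  set z' : K := z * (p : K) ^ (j / r) with hz'
  have hz1 : w (algebraMap K N (a / c)) = w (algebraMap K N z') ^ r * w (p : N) ^ s := by
    have hpj : w (p : N) ^ j = (w (p : N) ^ (j / r)) ^ r * w (p : N) ^ s := by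
      conv_lhs => rw [hj, zpow_add₀ hp0.ne', zpow_mul, zpow_natCast, zpow_natCast]
    rw [hz, hz', map_mul, map_zpow₀, map_mul, map_zpow₀, map_natCast (algebraMap K N), mul_pow, hpj, mul_assoc]
  have hz0 : z' ≠ 0 := by
    intro h0
    rw [h0, map_zero, map_zero, zero_pow hr.ne', zero_mul, Valuation.zero_iff, map_eq_zero] at hz1
    exact div_ne_zero ha hc hz1
  have hz0' : 0 < w (algebraMap K N z') := by
    rw [zero_lt_iff, Valuation.ne_zero_iff]
    simpa using hz0
  have h2 : w (algebraMap K N (a / c)) < w x ^ r := by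
    rw [map_div₀, map_div₀, div_lt_iff₀ (zero_lt_iff.2 hc0), mul_comm]
    exact h1
  have hlt : w (algebraMap K N z') < w x := by
    refine lt_of_le_of_ne (not_lt.1 fun hlt => ?_) fun he => hx 1 one_ne_zero z' (by simp [he])
    have h3 : w x ≤ w p * w (algebraMap K N z') := by
      rw [← div_le_iff₀ hz0', ← map_div₀]
      refine hw.le_of_lt_one _ ?_
      rwa [map_div₀, div_lt_one₀ hz0']
    refine (h2.trans_le (pow_le_pow_left₀ zero_le h3 r)).not_ge ?_
    rw [hz1, mul_pow, mul_comm]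
    exact mul_le_mul_right (pow_le_pow_of_le_one zero_le hw.lt_one.le hsr.le) _
  have hle : w (algebraMap K N (z' / p)) ≤ w x := by
    have h3 : w (algebraMap K N z') ≤ w p * w x := by
      rw [← div_le_iff₀ hx0, ← map_div₀]
      refine hw.le_of_lt_one _ ?_
      rwa [map_div₀, div_lt_one₀ hx0]
    rwa [map_div₀, map_div₀, map_natCast, div_le_iff₀ hp0, mul_comm]
  have hp0' : (p : K) ≠ 0 := by
    intro h0
    rw [← map_natCast (algebraMap K N), h0] at hp0
    simp at hp0
  refine eventually_belowFilter.2 ⟨z' / p, div_ne_zero hz0 hp0', lt_of_le_of_ne hle fun he =>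
    hx 1 one_ne_zero (z' / p) (by rw [pow_one, he]), fun b hb _ => ?_⟩
  have hzb : w (algebraMap K N z') < w (algebraMap K N b) := by
    refine lt_of_lt_of_le ?_ hb
    rw [map_div₀, map_div₀, map_natCast, lt_div_iff₀ hp0]
    exact mul_lt_of_lt_one_right hz0' hw.lt_one
  rw [mul_comm, ← div_lt_iff₀ (zero_lt_iff.2 hc0), ← map_div₀, ← map_div₀, hz1]
  exact (mul_le_of_le_one_right' (pow_le_one' hw.lt_one.le s)).trans_lt
    (pow_lt_pow_left₀ hzb zero_le hr.ne')

end

theorem exists_dominant_monomial (hx : ∀ n : ℕ, n ≠ 0 → ∀ a : K, w x ^ n ≠ w (algebraMap K N a))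
    {g : K[X]} (hg : g ≠ 0) : ∃ k ∈ g.support, ∀ i ∈ g.support \ {k},
      w (algebraMap K N (g.coeff i)) * w x ^ i < w (algebraMap K N (g.coeff k)) * w x ^ k := by
  have hx0 : w x ≠ 0 := fun h0 => hx 1 one_ne_zero 0 (by simp [h0])
  obtain ⟨k, hk, hmax⟩ := g.support.exists_max_image
    (fun i => w (algebraMap K N (g.coeff i)) * w x ^ i) (support_nonempty.2 hg)
  have key : ∀ i j, i < j → g.coeff j ≠ 0 → w (algebraMap K N (g.coeff i)) * w x ^ i ≠
      w (algebraMap K N (g.coeff j)) * w x ^ j := by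
    intro i j hij hj he
    obtain ⟨r, rfl⟩ := Nat.exists_eq_add_of_lt hij
    rw [show i + r + 1 = (r + 1) + i by ring, pow_add, ← mul_assoc] at he
    have := mul_right_cancel₀ (pow_ne_zero i hx0) he
    refine hx (r + 1) (Nat.succ_ne_zero r) (g.coeff i / g.coeff (i + r + 1)) ?_
    rw [map_div₀, map_div₀, this, show r + 1 + i = i + r + 1 by ring, mul_div_cancel_left₀]
    simpa using hj
  refine ⟨k, hk, fun i hi => ?_⟩
  rw [Finset.mem_sdiff, Finset.mem_singleton] at hi
  refine lt_of_le_of_ne (hmax i hi.1) ?_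
  rcases Ne.lt_or_gt hi.2 with h | h
  · exact key i k h (mem_support_iff.1 hk)
  · exact (key k i h (mem_support_iff.1 hi.1)).symm

theorem valuation_aeval_of_dominant {g : K[X]} {k : ℕ} (hk : k ∈ g.support) {t : N}
    (h : ∀ i ∈ g.support \ {k},
      w (algebraMap K N (g.coeff i)) * w t ^ i < w (algebraMap K N (g.coeff k)) * w t ^ k) :
    w (aeval t g) = w (algebraMap K N (g.coeff k)) * w t ^ k := by
  rw [aeval_def, eval₂_eq_sum, Polynomial.sum]
  simp only [← map_pow, ← map_mul] at h ⊢
  exact w.map_sum_eq_of_lt (f := fun i => algebraMap K N (g.coeff i) * t ^ i) hk h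

theorem exists_valuation_aeval_eq_monomial
    (hx : ∀ n : ℕ, n ≠ 0 → ∀ a : K, w x ^ n ≠ w (algebraMap K N a)) {g : K[X]} (hg : g ≠ 0) :
    ∃ a : K, a ≠ 0 ∧ ∃ k : ℕ, w (aeval x g) = w (algebraMap K N a) * w x ^ k := by
  obtain ⟨k, hk, h⟩ := exists_dominant_monomial hx hg
  exact ⟨g.coeff k, mem_support_iff.1 hk, k, valuation_aeval_of_dominant hk h⟩

theorem transcendental_of_valuation (hx : ∀ n : ℕ, n ≠ 0 → ∀ a : K, w x ^ n ≠ w (algebraMap K N a)) :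
    Transcendental K x := by
  refine transcendental_iff.2 fun g hg => by_contra fun h0 => ?_
  obtain ⟨a, ha, k, h⟩ := exists_valuation_aeval_eq_monomial hx h0
  have hx0 : w x ≠ 0 := fun h0 => hx 1 one_ne_zero 0 (by simp [h0])
  rw [hg, map_zero, eq_comm, mul_eq_zero] at h
  exact h.elim (by simpa using ha) (pow_ne_zero k hx0)

theorem exists_valuation_eq_of_mem_adjoin
    (hx : ∀ n : ℕ, n ≠ 0 → ∀ a : K, w x ^ n ≠ w (algebraMap K N a)) {u : N} (hu : u ∈ K⟮x⟯) :
    ∃ (a : K) (k : ℤ), w u = w (algebraMap K N a) * w x ^ k := by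
  have hx0 : w x ≠ 0 := fun h0 => hx 1 one_ne_zero 0 (by simp [h0])
  obtain ⟨r, s, rfl⟩ := (mem_adjoin_simple_iff K _).1 hu
  by_cases hr : r = 0
  · exact ⟨0, 0, by simp [hr]⟩
  by_cases hs : s = 0
  · exact ⟨0, 0, by simp [hs]⟩
  obtain ⟨a, ha, i, hi⟩ := exists_valuation_aeval_eq_monomial hx hr
  obtain ⟨b, hb, j, hj⟩ := exists_valuation_aeval_eq_monomial hx hs
  refine ⟨a / b, i - j, ?_⟩
  rw [map_div₀, hi, hj, map_div₀, map_div₀, zpow_sub₀ hx0, zpow_natCast, zpow_natCast,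
    mul_div_mul_comm]

theorem isSpecializable_adjoin_of_valuation_of_lt [CharZero N] {p : ℕ} (hp : p.Prime)
    (hw : IsPAdicValuation p w) (hK : HasZGroup p (w.comap (algebraMap K N)))
    (hx : ∀ n : ℕ, n ≠ 0 → ∀ a : K, w x ^ n ≠ w (algebraMap K N a)) {c₀ : K} (h₀ : c₀ ≠ 0)
    (hc₀ : w (algebraMap K N c₀) < w x) : IsSpecializable K w (K⟮x⟯ : Set N) := by
  have hx0 : w x ≠ 0 := fun h0 => hx 1 one_ne_zero 0 (by simp [h0])
  refine isSpecializable_adjoin_of_filter (transcendental_of_valuation hx)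
    (belowFilter w x h₀ hc₀) fun g d hd hle => ?_
  have key : ∀ f : K[X], f ≠ 0 → ∃ k, f.coeff k ≠ 0 ∧
      w (aeval x f) = w (algebraMap K N (f.coeff k)) * w x ^ k ∧
      ∀ᶠ b in belowFilter w x h₀ hc₀, w (algebraMap K N (f.eval b)) =
        w (algebraMap K N (f.coeff k)) * w (algebraMap K N b) ^ k := by
    intro f hf
    obtain ⟨k, hk, h⟩ := exists_dominant_monomial hx hf
    refine ⟨k, mem_support_iff.1 hk, valuation_aeval_of_dominant hk h, ?_⟩
    have : ∀ᶠ b in belowFilter w x h₀ hc₀, ∀ i ∈ f.support \ {k},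
        w (algebraMap K N (f.coeff i)) * w (algebraMap K N b) ^ i <
          w (algebraMap K N (f.coeff k)) * w (algebraMap K N b) ^ k := by
      rw [Filter.eventually_all_finset]
      exact fun i hi => eventually_monomial_lt hp hw hK hx (h i hi)
    refine this.mono fun b hb => ?_
    rw [← valuation_aeval_of_dominant hk hb, aeval_algebraMap_apply, coe_aeval_eq_eval]
  obtain ⟨k, hk, hdx, hdb⟩ := key d hd
  have hne : ∀ᶠ b in belowFilter w x h₀ hc₀, d.eval b ≠ 0 := by
    filter_upwards [hdb, eventually_belowFilter_lt] with b hb hb' h0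
    rw [h0, map_zero, map_zero, eq_comm, mul_eq_zero] at hb
    exact hb.elim (by simpa using hk) (pow_ne_zero k (by simpa using hb'.1))
  by_cases hg : g = 0
  · exact hne.mono fun b hb => ⟨hb, by simp [hg]⟩
  obtain ⟨l, hl, hgx, hgb⟩ := key g hg
  refine hne.and ?_
  rw [hgx, hdx] at hle
  rcases hle.lt_or_eq with hlt | he
  · filter_upwards [hdb, hgb, eventually_monomial_lt (h₀ := h₀) (hc₀ := hc₀) hp hw hK hx hlt]
      with b h1 h2 h3
    rw [h1, h2]
    exact h3.le
  · have hnlt : ∀ i j, i < j → ∀ a b : K, b ≠ 0 →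
        w (algebraMap K N a) * w x ^ i ≠ w (algebraMap K N b) * w x ^ j := by
      intro i j hij a b hb he
      obtain ⟨r, rfl⟩ := Nat.exists_eq_add_of_lt hij
      rw [show i + r + 1 = (r + 1) + i by ring, pow_add, ← mul_assoc] at he
      have := mul_right_cancel₀ (pow_ne_zero i hx0) he
      refine hx (r + 1) (Nat.succ_ne_zero r) (a / b) ?_
      rw [map_div₀, map_div₀, this, mul_div_cancel_left₀]
      simpa using hb
    have hlk : l = k := by
      rcases lt_trichotomy l k with h | h | h
      · exact absurd he (hnlt l k h _ _ hk)
      · exact h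
      · exact absurd he.symm (hnlt k l h _ _ hl)
    subst hlk
    have := mul_right_cancel₀ (pow_ne_zero l hx0) he
    filter_upwards [hdb, hgb] with b h1 h2
    rw [h1, h2, this]

theorem isSpecializable_adjoin_of_valuation [CharZero N] {p : ℕ} (hp : p.Prime)
    (hw : IsPAdicValuation p w) (hK : HasZGroup p (w.comap (algebraMap K N)))
    (hx : ∀ n : ℕ, n ≠ 0 → ∀ a : K, w x ^ n ≠ w (algebraMap K N a)) :
    IsSpecializable K w (K⟮x⟯ : Set N) := by
  by_cases h : ∃ c₀ : K, c₀ ≠ 0 ∧ w (algebraMap K N c₀) < w x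
  · obtain ⟨c₀, h₀, hc₀⟩ := h
    exact isSpecializable_adjoin_of_valuation_of_lt hp hw hK hx h₀ hc₀
  · push Not at h
    have hx0 : w x ≠ 0 := fun h0 => hx 1 one_ne_zero 0 (by simp [h0])
    have h1 : w x < 1 := by
      refine lt_of_le_of_ne (by simpa using h 1 one_ne_zero) fun he => ?_
      exact hx 1 one_ne_zero 1 (by simp [he])
    refine (isSpecializable_adjoin_of_valuation_of_lt (x := x⁻¹) hp hw hK (fun n hn a he => ?_)
      (one_ne_zero (α := K)) ?_).mono ?_
    · refine hx n hn a⁻¹ ?_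
      rw [map_inv₀, map_inv₀, ← he, map_inv₀, inv_pow, inv_inv]
    · rw [map_one, map_one, map_inv₀]
      exact (one_lt_inv₀ (zero_lt_iff.2 hx0)).2 h1
    · have : x ∈ K⟮x⁻¹⟯ := by
        have := inv_mem (mem_adjoin_simple_self K x⁻¹)
        rwa [inv_inv] at this
      exact adjoin_simple_le_iff.2 this

end ValueTranscendental

section Pure

open IntermediateField

variable {M N Γ₀ : Type*} [Field M] [Field N] [Algebra M N] [LinearOrderedCommGroupWithZero Γ₀]

/-- The values of the elements of `S` form a pure subgroup of the value group. -/
def IsPure (w : Valuation N Γ₀) (S : Set N) : Prop :=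
  ∀ (u : N) (n : ℕ), n ≠ 0 → ∀ a ∈ S, w u ^ n = w a → ∃ a' ∈ S, w u = w a'

variable {w : Valuation N Γ₀} {p : ℕ}

theorem isPure_of_hasZGroup [CharZero N] (hp : p.Prime) (hw : IsPAdicValuation p w)
    (hM : HasZGroup p (w.comap (algebraMap M N))) : IsPure w (algebraMap M N).range := by
  rintro u n hn _ ⟨a, rfl⟩ h
  have hp0 : (p : N) ≠ 0 := by exact_mod_cast hp.ne_zero
  by_cases ha : a = 0
  · refine ⟨0, zero_mem _, ?_⟩
    rw [ha, map_zero, map_zero] at h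
    rw [eq_zero_of_pow_eq_zero h, map_zero]
  obtain ⟨z, k, hz⟩ := hM a ha n hn
  simp only [Valuation.comap_apply, map_natCast] at hz
  have hz0 : w (algebraMap M N z) ≠ 0 := by
    intro h0
    rw [h0, zero_pow hn, zero_mul, Valuation.zero_iff, map_eq_zero] at hz
    exact ha hz
  obtain ⟨s, hs⟩ := hw.exists_zpow_eq hp hn (t := u / algebraMap M N z) (k := k) (by
    rw [map_div₀, div_pow, h, hz, mul_div_cancel_left₀ _ (pow_ne_zero n hz0)])
  refine ⟨_, ⟨z * (p : M) ^ s, rfl⟩, ?_⟩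
  rw [map_div₀, div_eq_iff hz0, mul_comm] at hs
  rw [hs, map_mul, map_zpow₀, map_natCast (algebraMap M N), map_mul, map_zpow₀]

theorem HasZGroup.of_isPure [CharZero N] (hp : p.Prime) (hZ : HasZGroup p w)
    (hM : IsPure w (algebraMap M N).range) : HasZGroup p (w.comap (algebraMap M N)) := by
  intro x hx n hn
  have hp0 : w (p : N) ≠ 0 := by
    rw [Valuation.ne_zero_iff]
    exact_mod_cast hp.ne_zero
  obtain ⟨z, k, hz⟩ := hZ (algebraMap M N x) (by simpa using hx) n hn
  obtain ⟨_, ⟨z', rfl⟩, h⟩ := hM z n hn (algebraMap M N (x / (p : M) ^ k)) ⟨_, rfl⟩ (by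
    rw [map_div₀, map_zpow₀, map_natCast (algebraMap M N), map_div₀, map_zpow₀, hz,
      mul_div_cancel_right₀ _ (zpow_ne_zero k hp0)])
  refine ⟨z', k, ?_⟩
  rw [Valuation.comap_apply, Valuation.comap_apply, Valuation.comap_apply,
    map_natCast (algebraMap M N), hz, h]

theorem isPure_of_isAlgebraic (hM : IsPure w (algebraMap M N).range) {S : Set N}
    (hS : Set.range (algebraMap M N) ⊆ S) (h : ∀ a ∈ S, IsAlgebraic M a) : IsPure w S := by
  intro u n hn a ha hu
  have h1 : ∃ m : ℕ, m ≠ 0 ∧ ∃ b : M, w a ^ m = w (algebraMap M N b) := by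
    by_contra hx
    push Not at hx
    exact transcendental_of_valuation hx (h a ha)
  obtain ⟨m, hm, b, hb⟩ := h1
  obtain ⟨_, ⟨c, rfl⟩, hc⟩ := hM u (n * m) (mul_ne_zero hn hm) _ ⟨b, rfl⟩ (by rw [pow_mul, hu, hb])
  exact ⟨_, hS ⟨c, rfl⟩, hc⟩

theorem isPure_of_valuation_mem (hM : IsPure w (algebraMap M N).range) {S : Set N}
    (hS : Set.range (algebraMap M N) ⊆ S) (h : ∀ a ∈ S, ∃ b : M, w a = w (algebraMap M N b)) :
    IsPure w S := by
  intro u n hn a ha hu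
  obtain ⟨b, hb⟩ := h a ha
  obtain ⟨_, ⟨c, rfl⟩, hc⟩ := hM u n hn _ ⟨b, rfl⟩ (by rw [hu, hb])
  exact ⟨_, hS ⟨c, rfl⟩, hc⟩

theorem exists_eq_mul_pow_of_valuation [CharZero N] (hp : p.Prime) (hw : IsPAdicValuation p w)
    (hH : IsHenselianValuation w) (hZ : HasZGroup p w) {x : N}
    (hx : ∀ n : ℕ, n ≠ 0 → ∀ a : M, w x ^ n ≠ w (algebraMap M N a)) {m : ℕ} (hm : m ≠ 0) :
    ∃ (y : N) (c : M), (∀ n : ℕ, n ≠ 0 → ∀ a : M, w y ^ n ≠ w (algebraMap M N a)) ∧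
      x = algebraMap M N c * y ^ m := by
  have hx0 : x ≠ 0 := by
    rintro rfl
    exact hx 1 one_ne_zero 0 (by simp)
  have : CharZero M := ((algebraMap M N).charZero_iff (algebraMap M N).injective).2 inferInstance
  obtain ⟨q, y, h⟩ := hw.exists_eq_mul_pow hp hH hZ hx0 hm
  rw [← map_ratCast (algebraMap M N)] at h
  refine ⟨y, q, fun n hn a ha => hx n hn ((q : M) ^ n * a ^ m) ?_, h⟩
  rw [h, map_mul, map_pow, mul_pow, ← pow_mul, mul_comm m n, pow_mul, ha, map_mul, map_mul, map_pow,
    map_pow, map_pow, map_pow]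

theorem exists_seq_of_valuation [CharZero N] (hp : p.Prime) (hw : IsPAdicValuation p w)
    (hH : IsHenselianValuation w) (hZ : HasZGroup p w) {x : N}
    (hx : ∀ n : ℕ, n ≠ 0 → ∀ a : M, w x ^ n ≠ w (algebraMap M N a)) :
    ∃ s : ℕ → N, s 0 = x ∧ (∀ j n : ℕ, n ≠ 0 → ∀ a : M, w (s j) ^ n ≠ w (algebraMap M N a)) ∧
      ∀ j, ∃ c : M, s j = algebraMap M N c * s (j + 1) ^ (j + 1) := by
  have hstep : ∀ (j : ℕ) (y : {x : N // ∀ n : ℕ, n ≠ 0 → ∀ a : M, w x ^ n ≠ w (algebraMap M N a)}),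
      ∃ z : {x : N // ∀ n : ℕ, n ≠ 0 → ∀ a : M, w x ^ n ≠ w (algebraMap M N a)}, ∃ c : M,
        (y : N) = algebraMap M N c * (z : N) ^ (j + 1) := by
    rintro j ⟨y, hy⟩
    obtain ⟨z, c, hz, h⟩ := exists_eq_mul_pow_of_valuation hp hw hH hZ hy (Nat.succ_ne_zero j)
    exact ⟨⟨z, hz⟩, c, h⟩
  choose f c hf using hstep
  let s : ℕ → {x : N // ∀ n : ℕ, n ≠ 0 → ∀ a : M, w x ^ n ≠ w (algebraMap M N a)} :=
    Nat.rec ⟨x, hx⟩ f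
  exact ⟨fun j => (s j).1, rfl, fun j => (s j).2, fun j => ⟨c j (s j), hf j (s j)⟩⟩

theorem exists_isSpecializable_isPure_of_valuation [CharZero N] (hp : p.Prime)
    (hw : IsPAdicValuation p w) (hH : IsHenselianValuation w) (hZ : HasZGroup p w)
    (hM : IsPure w (algebraMap M N).range) {x : N}
    (hx : ∀ n : ℕ, n ≠ 0 → ∀ a : M, w x ^ n ≠ w (algebraMap M N a)) :
    ∃ E : IntermediateField M N, x ∈ E ∧ IsSpecializable M w (E : Set N) ∧
      IsPure w (E : Set N) := by
  obtain ⟨s, hs0, hs, hss⟩ := exists_seq_of_valuation hp hw hH hZ hx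
  have hmem : ∀ j, s j ∈ M⟮s j⟯ := fun j => mem_adjoin_simple_self M (s j)
  have hmono : Monotone fun j => M⟮s j⟯ := by
    refine monotone_nat_of_le_succ fun j => ?_
    obtain ⟨c, hc⟩ := hss j
    rw [adjoin_simple_le_iff, hc]
    exact mul_mem (IntermediateField.algebraMap_mem _ _) (pow_mem (hmem _) _)
  have hdir : Directed (· ≤ ·) fun j => M⟮s j⟯ := hmono.directed_le
  have hcoe : ((⨆ j, M⟮s j⟯ : IntermediateField M N) : Set N) = ⋃ j, (M⟮s j⟯ : Set N) :=
    coe_iSup_of_directed hdir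
  refine ⟨⨆ j, M⟮s j⟯, le_iSup (fun j => M⟮s j⟯) 0 (hs0 ▸ hmem 0), ?_, ?_⟩
  · rw [hcoe]
    exact isSpecializable_iUnion hdir fun j =>
      isSpecializable_adjoin_of_valuation hp hw (HasZGroup.of_isPure hp hZ hM) (hs j)
  · have hdiv : ∀ i j, i ≤ j → ∃ (c : M) (e : ℕ), s i = algebraMap M N c * s j ^ e := by
      intro i j hij
      induction j, hij using Nat.le_induction with
      | base => exact ⟨1, 1, by simp⟩
      | succ j _ ih =>
        obtain ⟨c, e, h⟩ := ih
        obtain ⟨c', h'⟩ := hss j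
        refine ⟨c * c' ^ e, (j + 1) * e, ?_⟩
        rw [h, h', map_mul, map_pow, mul_pow, pow_mul, mul_assoc]
    have hdivn : ∀ i n : ℕ, n ≠ 0 → ∃ (c : M) (j : ℕ), ∃ t ∈ M⟮s j⟯, s i = algebraMap M N c * t ^ n := by
      intro i n hn
      have h1 : 1 ≤ n * (i + 1) := Nat.one_le_iff_ne_zero.2 (mul_ne_zero hn (Nat.succ_ne_zero i))
      have h2 : i + 1 ≤ n * (i + 1) := Nat.le_mul_of_pos_left _ (Nat.pos_of_ne_zero hn)
      obtain ⟨c, e, h⟩ := hdiv i (n * (i + 1) - 1) (by omega)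
      obtain ⟨c', h'⟩ := hss (n * (i + 1) - 1)
      rw [Nat.sub_add_cancel h1] at h'
      refine ⟨c * c' ^ e, n * (i + 1), s (n * (i + 1)) ^ ((i + 1) * e), pow_mem (hmem _) _, ?_⟩
      rw [h, h', map_mul, map_pow]
      ring
    intro u n hn z hz hu
    rw [hcoe, Set.mem_iUnion] at hz
    obtain ⟨i, hz⟩ := hz
    obtain ⟨a, k, ha⟩ := exists_valuation_eq_of_mem_adjoin (hs i) hz
    obtain ⟨c, j, t, ht, hct⟩ := hdivn i n hn
    have ht0 : w (t ^ k) ≠ 0 := by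
      rw [Valuation.ne_zero_iff]
      refine zpow_ne_zero _ ?_
      rintro rfl
      refine hs i 1 one_ne_zero 0 ?_
      rw [hct, zero_pow hn, mul_zero, map_zero, map_zero, map_zero, pow_one]
    obtain ⟨_, ⟨b, rfl⟩, hb⟩ := hM (u / t ^ k) n hn _ ⟨a * c ^ k, rfl⟩ (by
      rw [map_div₀, div_pow, hu, ha, div_eq_iff (pow_ne_zero n ht0), hct]
      simp only [map_mul, map_zpow₀, map_pow, mul_zpow]
      rw [← zpow_natCast, ← zpow_natCast, zpow_comm, mul_assoc])
    refine ⟨algebraMap M N b * t ^ k, ?_, ?_⟩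
    · exact mul_mem (IntermediateField.algebraMap_mem _ _)
        (zpow_mem (le_iSup (fun j => M⟮s j⟯) j ht) k)
    · rw [map_mul, ← hb, map_div₀, div_mul_cancel₀ _ ht0]

end Pure

section ExistentiallyClosed

open IntermediateField

variable {K M N Γ₀ : Type*} [Field K] [Field M] [Field N] [Algebra K M] [Algebra M N] [Algebra K N]
  [IsScalarTower K M N] [LinearOrderedCommGroupWithZero Γ₀] {w : Valuation N Γ₀} {p : ℕ}

theorem isHenselian_of_isSpecializable_maximal [CharZero N] (hp : p.Prime)
    (hw : IsPAdicValuation p w) (hH : IsHenselianValuation w)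
    (hK : IsHenselianValuation (w.comap (algebraMap K N)))
    (hM : IsSpecializable K w (algebraMap M N).range) (hP : IsPure w (algebraMap M N).range)
    (hmax : ∀ E : IntermediateField M N, IsSpecializable K w (E : Set N) → IsPure w (E : Set N) →
      ∀ y ∈ E, y ∈ (algebraMap M N).range) :
    IsHenselianValuation (w.comap (algebraMap M N)) := by
  have : CharZero M := ((algebraMap M N).charZero_iff (algebraMap M N).injective).2 inferInstance
  intro f hfm hf a ha hfa hfda
  have hae : ∀ g : M[X], (g.map (algebraMap M N)).eval (algebraMap M N a) =
      algebraMap M N (g.eval a) := fun g => by rw [eval_map, eval₂_at_apply]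
  obtain ⟨y, hy, hya⟩ := hH (f.map (algebraMap M N)) (hfm.map _)
    (fun i => by rw [coeff_map]; exact hf i) (algebraMap M N a) ha (by rw [hae]; exact hfa)
    (by rw [derivative_map, hae]; exact hfda)
  rw [eval_map_algebraMap] at hy
  have hf' : f ∈ integralPolys M w := mem_integralPolys.2 hf
  have hy1 : w y ≤ 1 := by
    have : y = (y - algebraMap M N a) + algebraMap M N a := by ring
    rw [this]
    exact w.map_add_le hya.le ha
  have hd := valuation_aeval_derivative_of_near hf' hy1 ha hya (by
    rw [← eval_map_algebraMap, hae]; exact hfda)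
  have halg : IsAlgebraic M y := ⟨f, hfm.ne_zero, hy⟩
  have hE : IsSpecializable K w (M⟮y⟯ : Set N) :=
    hM.adjoin_root hp hw hK halg (exists_minpoly_factor w hfm hf' hy).1 ha hya
      (valuation_aeval_derivative_minpoly hfm hf' hy hy1 hd)
  have := isAlgebraic_adjoin_simple halg.isIntegral
  obtain ⟨y, rfl⟩ := hmax M⟮y⟯ hE (isPure_of_isAlgebraic hP
    (by rintro _ ⟨b, rfl⟩; exact IntermediateField.algebraMap_mem _ b)
    (fun u hu => isAlgebraic_iff.1 (Algebra.IsAlgebraic.isAlgebraic (⟨u, hu⟩ : M⟮y⟯))))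
    y (mem_adjoin_simple_self M y)
  refine ⟨y, ?_, by simpa using hya⟩
  rw [aeval_algebraMap_apply, map_eq_zero] at hy
  simpa using hy

theorem mem_range_of_isSpecializable_maximal [CharZero N] (hp : p.Prime)
    (hw : IsPAdicValuation p w) (hH : IsHenselianValuation w) (hZ : HasZGroup p w)
    (hK : IsHenselianValuation (w.comap (algebraMap K N)))
    (hM : IsSpecializable K w (algebraMap M N).range) (hP : IsPure w (algebraMap M N).range)
    (hmax : ∀ E : IntermediateField M N, IsSpecializable K w (E : Set N) → IsPure w (E : Set N) →
      ∀ y ∈ E, y ∈ (algebraMap M N).range) (y : N) : y ∈ (algebraMap M N).range := by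
  have hMH := isHenselian_of_isSpecializable_maximal hp hw hH hK hM hP hmax
  by_cases hy : ∀ b : M, ∃ b' : M, w (y - algebraMap M N b') < w (y - algebraMap M N b)
  · exact hmax M⟮y⟯ (hM.trans (isSpecializable_adjoin_of_no_best_approx hp hw hMH hy))
      (isPure_of_valuation_mem hP
        (by rintro _ ⟨b, rfl⟩; exact IntermediateField.algebraMap_mem _ b)
        fun u hu => exists_valuation_eq_of_no_best_approx hp hw hMH hy hu)
      y (mem_adjoin_simple_self M y)
  push Not at hy
  obtain ⟨b, hb⟩ := hy
  by_contra hyM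
  have hx0 : y - algebraMap M N b ≠ 0 := fun h => hyM ⟨b, (sub_eq_zero.1 h).symm⟩
  have hx1 : ∀ c : M, w (y - algebraMap M N b) ≠ w (algebraMap M N c) := by
    intro c hc
    have hwc : w (algebraMap M N c) ≠ 0 := by
      rw [← hc]
      exact (Valuation.ne_zero_iff w).2 hx0
    have hc0 : algebraMap M N c ≠ 0 := (Valuation.ne_zero_iff w).1 hwc
    obtain ⟨m, hm⟩ := hw.exists_natCast ((y - algebraMap M N b) / algebraMap M N c) (by
      rw [map_div₀, hc, div_self hwc])
    refine (hb (b + m * c)).not_gt ?_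
    have : y - algebraMap M N (b + m * c) =
        ((y - algebraMap M N b) / algebraMap M N c - m) * algebraMap M N c := by
      rw [sub_mul, div_mul_cancel₀ _ hc0, map_add, map_mul, map_natCast (algebraMap M N)]
      ring
    rw [this, map_mul, hc]
    exact mul_lt_of_lt_one_left (zero_lt_iff.2 hwc) hm
  have hx : ∀ n : ℕ, n ≠ 0 → ∀ a : M, w (y - algebraMap M N b) ^ n ≠ w (algebraMap M N a) := by
    intro n hn a ha
    obtain ⟨_, ⟨c, rfl⟩, hc⟩ := hP _ n hn _ ⟨a, rfl⟩ ha
    exact hx1 c hc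
  obtain ⟨E, hxE, hE, hEP⟩ := exists_isSpecializable_isPure_of_valuation hp hw hH hZ hP hx
  refine hyM (hmax E (hM.trans hE) hEP y ?_)
  have := add_mem hxE (IntermediateField.algebraMap_mem E b)
  rwa [sub_add_cancel] at this

theorem coe_range_algebraMap_intermediateField (E : IntermediateField K N) :
    ((algebraMap E N).range : Set N) = E := by
  ext x
  exact ⟨by rintro ⟨y, rfl⟩; exact y.2, fun h => ⟨⟨x, h⟩, rfl⟩⟩

/-- A henselian `p`-adic `ℤ`-group valued field is existentially closed in its extensions of the
same kind. -/
theorem isSpecializable_univ [CharZero N] (hp : p.Prime)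
    (hw : IsPAdicValuation p w) (hH : IsHenselianValuation w) (hZ : HasZGroup p w)
    (hK : IsHenselianValuation (w.comap (algebraMap K N)))
    (hKZ : HasZGroup p (w.comap (algebraMap K N))) : IsSpecializable K w Set.univ := by
  let P : Set (IntermediateField K N) :=
    {E | IsSpecializable K w (E : Set N) ∧ IsPure w (E : Set N)}
  obtain ⟨E, -, hE⟩ := zorn_le_nonempty₀ P (fun c hc hchain E₀ hE₀ => by
    have : Nonempty c := ⟨⟨E₀, hE₀⟩⟩
    have hdir : Directed (· ≤ ·) fun E : c => (E : IntermediateField K N) :=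
      hchain.directed
    have hcoe : ((⨆ E : c, (E : IntermediateField K N) : IntermediateField K N) : Set N) =
        ⋃ E : c, ((E : IntermediateField K N) : Set N) := coe_iSup_of_directed hdir
    refine ⟨⨆ E : c, (E : IntermediateField K N), ⟨?_, ?_⟩,
      fun E hE => le_iSup (fun E : c => (E : IntermediateField K N)) ⟨E, hE⟩⟩
    · rw [hcoe]
      exact isSpecializable_iUnion hdir fun E => (hc E.2).1
    · intro u n hn a ha hu
      rw [hcoe, Set.mem_iUnion] at ha
      obtain ⟨E, ha⟩ := ha
      obtain ⟨a', ha', h⟩ := (hc E.2).2 u n hn a ha hu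
      exact ⟨a', by rw [hcoe]; exact Set.mem_iUnion.2 ⟨E, ha'⟩, h⟩) ⊥ (by
    have := isSpecializable_range (K := K) w
    have h2 := isPure_of_hasZGroup hp hw hKZ
    have hb : ((⊥ : IntermediateField K N) : Set N) = (algebraMap K N).range := by
      ext x
      exact mem_bot
    exact ⟨by rw [hb]; exact this, by rw [hb]; exact h2⟩)
  have hEr := coe_range_algebraMap_intermediateField E
  have htop : ∀ y : N, y ∈ E := by
    intro y
    obtain ⟨y, rfl⟩ := mem_range_of_isSpecializable_maximal (M := E) hp hw hH hZ hK
      (by rw [hEr]; exact hE.prop.1) (by rw [hEr]; exact hE.prop.2) (fun E' h₁ h₂ y hy => by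
        have : E ≤ E'.restrictScalars K := fun x hx => E'.algebraMap_mem ⟨x, hx⟩
        exact ⟨⟨y, hE.le_of_ge (y := E'.restrictScalars K) ⟨h₁, h₂⟩ this hy⟩, rfl⟩) y
    exact y.2
  exact hE.prop.1.mono fun y _ => htop y

end ExistentiallyClosed

section PAdicClosure

open IntermediateField

variable {p : ℕ}

theorem ValuationSubring.exists_comap_eq {L Ω : Type*} [Field L] [Field Ω] [Algebra L Ω]
    (O : ValuationSubring L) : ∃ V : ValuationSubring Ω, V.comap (algebraMap L Ω) = O := by
  obtain ⟨V, hle, hloc⟩ := (O.toLocalSubring.map (algebraMap L Ω)).exists_le_valuationSubring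
  refine ⟨V, ?_⟩
  ext x
  refine ⟨fun hx => ?_, fun hx => hle ⟨x, hx, rfl⟩⟩
  by_contra hxO
  have hx' : x⁻¹ ∈ O := (O.mem_or_inv_mem x).resolve_left hxO
  have hx0 : x ≠ 0 := by
    rintro rfl
    exact hxO O.zero_mem
  have hmem : algebraMap L Ω x⁻¹ ∈ (O.toLocalSubring.map (algebraMap L Ω)).toSubring :=
    ⟨_, hx', rfl⟩
  have hu := hloc.map_nonunit ⟨_, hmem⟩ (isUnit_iff_exists_inv.2
    ⟨⟨algebraMap L Ω x, hx⟩, Subtype.ext (by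
      change algebraMap L Ω x⁻¹ * algebraMap L Ω x = 1
      rw [← map_mul, inv_mul_cancel₀ hx0, map_one])⟩)
  obtain ⟨⟨_, z, hz, rfl⟩, h⟩ := isUnit_iff_exists_inv.1 hu
  have h1 : algebraMap L Ω x⁻¹ * algebraMap L Ω z = 1 := congrArg Subtype.val h
  rw [← map_mul, ← map_one (algebraMap L Ω)] at h1
  have h2 := (algebraMap L Ω).injective h1
  rw [inv_mul_eq_one₀ hx0] at h2
  exact hxO (h2 ▸ hz)

theorem PAdicWitness.isPAdicValuation (hp : p.Prime) {F Γ₀ : Type} [Field F]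
    [LinearOrderedCommGroupWithZero Γ₀] {v : Valuation F Γ₀}
    (h : PAdicWitness p v.valuationSubring) : IsPAdicValuation p v := by
  obtain ⟨hmax, ⟨e⟩⟩ := h
  have := Fact.mk hp
  have hm := IsLocalRing.eq_maximalIdeal hmax
  have hlt : ∀ x : v.valuationSubring, v (x : F) < 1 → ∃ c, x = p * c := by
    intro x hx
    have := (Valuation.mem_maximalIdeal_iff _ v).2 hx
    rw [← hm] at this
    exact Ideal.mem_span_singleton.1 this
  have hlt' : ∀ x ∈ Ideal.span {(p : v.valuationSubring)}, v (x : F) < 1 := by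
    intro x hx
    rw [hm] at hx
    exact (Valuation.mem_maximalIdeal_iff _ v).1 hx
  refine ⟨by simpa using hlt' p (Ideal.mem_span_singleton_self _), fun x hx => ?_, fun x hx => ?_⟩
  · obtain ⟨c, hc⟩ := hlt ⟨x, hx.le⟩ hx
    have hc' : x = p * (c : F) := by simpa using congrArg Subtype.val hc
    rw [hc', map_mul]
    exact mul_le_of_le_one_right' c.2
  · refine ⟨(e (Ideal.Quotient.mk _ ⟨x, hx⟩)).val, ?_⟩
    refine hlt' (⟨x, hx⟩ - ((e (Ideal.Quotient.mk _ ⟨x, hx⟩)).val : v.valuationSubring)) ?_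
    rw [← Ideal.Quotient.eq_zero_iff_mem, ← map_eq_zero_iff e e.injective, map_sub, map_natCast,
      map_sub, map_natCast, ZMod.natCast_zmod_val, sub_self]

theorem IsPAdicValuation.isPAdicField (hp : p.Prime) {F Γ₀ : Type} [Field F]
    [LinearOrderedCommGroupWithZero Γ₀] {v : Valuation F Γ₀} (h : IsPAdicValuation p v) :
    IsPAdicField p F := by
  have hpm : (p : v.valuationSubring) ∈ IsLocalRing.maximalIdeal v.valuationSubring :=
    (Valuation.mem_maximalIdeal_iff _ v).2 (by simpa using h.lt_one)
  have hm : Ideal.span {(p : v.valuationSubring)} = IsLocalRing.maximalIdeal v.valuationSubring := by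
    refine le_antisymm ((Ideal.span_singleton_le_iff_mem _).2 hpm) fun x hx => ?_
    have hx' := h.le_of_lt_one _ ((Valuation.mem_maximalIdeal_iff _ v).1 hx)
    rw [Ideal.mem_span_singleton]
    by_cases hp0 : (p : F) = 0
    · rw [hp0, map_zero, le_zero_iff, map_eq_zero] at hx'
      exact ⟨0, Subtype.ext (by simpa using hx')⟩
    · have hvp : v (p : F) ≠ 0 := (Valuation.ne_zero_iff v).2 hp0
      refine ⟨⟨x / p, ?_⟩, Subtype.ext ?_⟩
      · rw [Valuation.mem_valuationSubring_iff, map_div₀]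
        exact div_le_one_of_le₀ hx' (zero_le)
      · change (x : F) = ((p : v.valuationSubring) : F) * (x / p)
        rw [show ((p : v.valuationSubring) : F) = p by simp, mul_div_cancel₀ _ hp0]
  have hmax : (Ideal.span {(p : v.valuationSubring)}).IsMaximal := by
    rw [hm]
    infer_instance
  refine ⟨v.valuationSubring, hmax, ?_⟩
  set I := Ideal.span {(p : v.valuationSubring)} with hI
  have : CharP (v.valuationSubring ⧸ I) p := (CharP.charP_iff_prime_eq_zero hp).2 (by
    rw [← map_natCast (Ideal.Quotient.mk I), Ideal.Quotient.eq_zero_iff_mem]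
    exact Ideal.mem_span_singleton_self _)
  have := Fact.mk hp
  refine ⟨(RingEquiv.ofBijective (ZMod.castHom (dvd_refl p) (v.valuationSubring ⧸ I))
    ⟨RingHom.injective _, fun x => ?_⟩).symm⟩
  obtain ⟨x, rfl⟩ := Ideal.Quotient.mk_surjective x
  obtain ⟨m, hmx⟩ := h.exists_natCast x x.2
  refine ⟨m, ?_⟩
  rw [map_natCast, ← map_natCast (Ideal.Quotient.mk I), eq_comm, Ideal.Quotient.eq, hm]
  exact (Valuation.mem_maximalIdeal_iff _ v).2 (by simpa using hmx)

theorem exists_isPAdicValuation_maximal {L Ω Γ₀ : Type*} [Field L] [Field Ω] [Algebra L Ω]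
    [LinearOrderedCommGroupWithZero Γ₀] {v : Valuation Ω Γ₀}
    (hL : IsPAdicValuation p (v.comap (algebraMap L Ω))) :
    ∃ E : IntermediateField L Ω, IsPAdicValuation p (v.comap (algebraMap E Ω)) ∧
      ∀ y : Ω, IsPAdicValuation p (v.comap (algebraMap E⟮y⟯ Ω)) → y ∈ (algebraMap E Ω).range := by
  obtain ⟨E, -, hE⟩ := zorn_le_nonempty₀
    {E : IntermediateField L Ω | IsPAdicValuation p (v.comap (algebraMap E Ω))}
    (fun c hc hchain E₀ hE₀ => by
      have : Nonempty c := ⟨⟨E₀, hE₀⟩⟩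
      have hcoe : ((⨆ E : c, (E : IntermediateField L Ω) : IntermediateField L Ω) : Set Ω) =
          ⋃ E : c, ((E : IntermediateField L Ω) : Set Ω) := coe_iSup_of_directed hchain.directed
      have hmem : ∀ x : (⨆ E : c, (E : IntermediateField L Ω) : IntermediateField L Ω),
          ∃ E : c, (x : Ω) ∈ (E : IntermediateField L Ω) := fun x =>
        Set.mem_iUnion.1 (hcoe ▸ x.2)
      refine ⟨⨆ E : c, (E : IntermediateField L Ω), ⟨?_, fun x hx => ?_, fun x hx => ?_⟩,
        fun E hE => le_iSup (fun E : c => (E : IntermediateField L Ω)) ⟨E, hE⟩⟩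
      · simpa using hL.lt_one
      · obtain ⟨E, hxE⟩ := hmem x
        simpa using (hc E.2).le_of_lt_one ⟨x, hxE⟩ hx
      · obtain ⟨E, hxE⟩ := hmem x
        simpa using (hc E.2).exists_natCast ⟨x, hxE⟩ hx) ⊥ (by
    refine ⟨by simpa using hL.lt_one, ?_, ?_⟩
    · rintro ⟨x, hx⟩ hvx
      obtain ⟨x, rfl⟩ := mem_bot.1 hx
      simpa using hL.le_of_lt_one x hvx
    · rintro ⟨x, hx⟩ hvx
      obtain ⟨x, rfl⟩ := mem_bot.1 hx
      simpa using hL.exists_natCast x hvx)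
  refine ⟨E, hE.prop, fun y hy => ?_⟩
  have : E ≤ E⟮y⟯.restrictScalars L := fun x hx => E⟮y⟯.algebraMap_mem ⟨x, hx⟩
  exact ⟨⟨y, hE.le_of_ge (y := E⟮y⟯.restrictScalars L) hy this (mem_adjoin_simple_self E y)⟩, rfl⟩

/-- A `p`-adic field extension of a `p`-adically closed field embeds over it into a henselian
`p`-adic `ℤ`-group valued field, inducing the same structure on the base field. -/
theorem IsPAdicallyClosed.exists_extension (hp : p.Prime) {K L : Type} [Field K] [CharZero K]
    [Field L] [Algebra K L] (hK : IsPAdicallyClosed p K) (hL : IsPAdicField p L) :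
    ∃ (N : Type) (_ : Field N) (_ : Algebra K N) (_ : L →ₐ[K] N) (Γ₀ : Type)
      (_ : LinearOrderedCommGroupWithZero Γ₀) (w : Valuation N Γ₀), IsPAdicValuation p w ∧
        IsHenselianValuation w ∧ HasZGroup p w ∧
        IsHenselianValuation (w.comap (algebraMap K N)) ∧
        HasZGroup p (w.comap (algebraMap K N)) := by
  obtain ⟨O, hO⟩ := hL
  obtain ⟨V, hV⟩ := O.exists_comap_eq (Ω := AlgebraicClosure L)
  have : CharZero L := (algebraMap K L).charZero_iff (algebraMap K L).injective |>.1 inferInstance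
  set v := V.valuation
  have hvO : (v.comap (algebraMap L (AlgebraicClosure L))).valuationSubring = O := by
    rw [← hV]
    ext x
    exact V.valuation_le_one_iff _
  have hvL : IsPAdicValuation p (v.comap (algebraMap L (AlgebraicClosure L))) :=
    PAdicWitness.isPAdicValuation hp (by rwa [hvO])
  obtain ⟨E, hE, hmax⟩ := exists_isPAdicValuation_maximal hvL
  have : IsScalarTower K E (AlgebraicClosure L) := .of_algebraMap_eq fun _ => rfl
  have hKE : v.comap (algebraMap K (AlgebraicClosure L)) =
      (v.comap (algebraMap E (AlgebraicClosure L))).comap (algebraMap K E) := by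
    rw [IsScalarTower.algebraMap_eq K E, Valuation.comap_comp]
  have hvK : IsPAdicValuation p (v.comap (algebraMap K (AlgebraicClosure L))) := by
    rw [hKE]
    exact hE.comap
  have hKmax : ∀ y : AlgebraicClosure L, IsAlgebraic K y →
      IsPAdicValuation p (v.comap (algebraMap K⟮y⟯ (AlgebraicClosure L))) →
      y ∈ (algebraMap K (AlgebraicClosure L)).range := by
    intro y hy hyp
    have := isAlgebraic_adjoin_simple hy.isIntegral
    obtain ⟨a, ha⟩ := hK.2 K⟮y⟯ this (hyp.isPAdicField hp) ⟨y, mem_adjoin_simple_self K y⟩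
    exact ⟨a, congrArg Subtype.val ha⟩
  refine ⟨E, inferInstance, inferInstance, IsScalarTower.toAlgHom K L E, _, inferInstance,
    v.comap (algebraMap E (AlgebraicClosure L)), hE, hE.isHenselian_of_maximal fun y _ => hmax y,
    hE.hasZGroup_of_maximal hp fun y _ => hmax y, ?_, ?_⟩
  · rw [← hKE]
    exact hvK.isHenselian_of_maximal hKmax
  · rw [← hKE]
    exact hvK.hasZGroup_of_maximal hp hKmax

theorem IsPAdicallyClosed.exists_algHom_of_finite (hp : p.Prime) {K L : Type} [Field K] [CharZero K]
    [Field L] [Algebra K L] (hK : IsPAdicallyClosed p K) (hL : IsPAdicField p L) {S : Set L}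
    (hS : S.Finite) : ∃ (R : Subalgebra K L) (_ : R →ₐ[K] K), S ⊆ R := by
  classical
  obtain ⟨N, _, _, f, Γ₀, _, w, hw, hH, hZ, hKH, hKZ⟩ := hK.exists_extension hp hL
  have : CharZero N := (algebraMap K N).charZero_iff (algebraMap K N).injective |>.1 inferInstance
  obtain ⟨R, φ, hφ⟩ := isSpecializable_univ hp hw hH hZ hKH hKZ (hS.toFinset.image f)
    (Set.subset_univ _)
  refine ⟨R.comap f, φ.comp ((f.comp (R.comap f).val).codRestrict R fun x => x.2), fun s hs => ?_⟩
  exact (hφ (f s) (Finset.mem_image_of_mem f (hS.mem_toFinset.2 hs))).1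

theorem IsPAdicallyClosed.exists_algHom_of_isAlgClosedIn (hp : p.Prime) {k K : Type} [Field k]
    [Field K] [CharZero K] [Algebra k K] (hK : IsPAdicallyClosed p K)
    (hk : ∀ x : K, IsAlgebraic k x → x ∈ (algebraMap k K).range) {S : Set K}
    (hS : S.Finite) : ∃ (R : Subalgebra k K) (_ : R →ₐ[k] k), S ⊆ R := by
  obtain ⟨N, _, _, f, Γ₀, _, w, hw, hH, hZ, hKH, hKZ⟩ := hK.exists_extension hp hK.1
  have hwK := hw.comap (k := K)
  obtain ⟨R, φ, hφ⟩ := isSpecializable_univ hp hwK hKH hKZ (hKH.comap hk)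
    (hKZ.comap hwK hp hKH hk) hS.toFinset (Set.subset_univ _)
  exact ⟨R, φ, fun s hs => (hφ s (hS.mem_toFinset.2 hs)).1⟩

end PAdicClosure

end

section FieldDeriv

namespace FieldDeriv

variable {F : Type} [Field F] (δ : FieldDeriv F)

theorem map_zero : δ.d 0 = 0 := by
  simpa using δ.map_add 0 0

theorem map_one : δ.d 1 = 0 := by
  simpa using δ.leibniz 1 1

/-- A derivation as an additive map. -/
def toAddMonoidHom : F →+ F where
  toFun := δ.d
  map_zero' := δ.map_zero
  map_add' := δ.map_add

theorem map_sum {ι : Type*} (s : Finset ι) (f : ι → F) : δ.d (∑ i ∈ s, f i) = ∑ i ∈ s, δ.d (f i) :=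
  _root_.map_sum δ.toAddMonoidHom f s

theorem map_neg (a : F) : δ.d (-a) = -δ.d a :=
  _root_.map_neg δ.toAddMonoidHom a

theorem map_inv (a : F) : δ.d a⁻¹ = -(a⁻¹ * a⁻¹ * δ.d a) := by
  by_cases ha : a = 0
  · simp [ha, δ.map_zero]
  have h := δ.leibniz a a⁻¹
  rw [mul_inv_cancel₀ ha, δ.map_one] at h
  have h2 : a * δ.d a⁻¹ = a * -(a⁻¹ * a⁻¹ * δ.d a) := by
    field_simp at h ⊢
    linear_combination -h
  exact mul_left_cancel₀ ha h2

/-- The field of constants. -/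
def constants : Subfield F where
  carrier := {a | δ.d a = 0}
  mul_mem' {a b} (ha : δ.d a = 0) (hb : δ.d b = 0) := by
    change δ.d (a * b) = 0
    rw [δ.leibniz, ha, hb, mul_zero, zero_mul, add_zero]
  one_mem' := δ.map_one
  add_mem' {a b} (ha : δ.d a = 0) (hb : δ.d b = 0) := by
    change δ.d (a + b) = 0
    rw [δ.map_add, ha, hb, add_zero]
  zero_mem' := δ.map_zero
  neg_mem' {a} (ha : δ.d a = 0) := by
    change δ.d (-a) = 0
    rw [δ.map_neg, ha, neg_zero]
  inv_mem' a (ha : δ.d a = 0) := by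
    change δ.d a⁻¹ = 0
    rw [δ.map_inv, ha, mul_zero, neg_zero]

theorem mem_constants {a : F} : a ∈ δ.constants ↔ δ.d a = 0 := Iff.rfl

/-- A derivation is linear over its constants. -/
def derivation : Derivation δ.constants F F :=
  Derivation.mk'
    { toFun := δ.d
      map_add' := δ.map_add
      map_smul' := fun c x => by
        rw [Subfield.smul_def, smul_eq_mul, δ.leibniz, δ.mem_constants.1 c.2, zero_mul, add_zero]
        rfl }
    fun a b => by
      change δ.d (a * b) = a * δ.d b + b * δ.d a
      rw [δ.leibniz, mul_comm b]

theorem isAlgebraic_constants [CharZero F] {x : F} (hx : IsAlgebraic δ.constants x) :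
    x ∈ (algebraMap δ.constants F).range := by
  have h := δ.derivation.map_aeval (minpoly δ.constants x) x
  rw [minpoly.aeval, Derivation.map_zero, eq_comm, smul_eq_mul, mul_eq_zero] at h
  have hsep := (minpoly.irreducible hx.isIntegral).separable
  have hd := hsep.aeval_derivative_ne_zero (minpoly.aeval δ.constants x)
  exact ⟨⟨x, h.resolve_left hd⟩, rfl⟩

variable {σ : Type*}

/-- A derivation applied to the coefficients of a polynomial. -/
noncomputable def mapCoeff (f : MvPolynomial σ F) : MvPolynomial σ F :=
  ∑ m ∈ f.support, MvPolynomial.monomial m (δ.d (f.coeff m))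

theorem coeff_mapCoeff (f : MvPolynomial σ F) (m : σ →₀ ℕ) :
    (δ.mapCoeff f).coeff m = δ.d (f.coeff m) := by
  classical
  rw [mapCoeff, MvPolynomial.coeff_sum]
  simp only [MvPolynomial.coeff_monomial, Finset.sum_ite_eq']
  split_ifs with h
  · rfl
  · rw [MvPolynomial.notMem_support_iff.1 h, δ.map_zero]

theorem mapCoeff_add (f g : MvPolynomial σ F) :
    δ.mapCoeff (f + g) = δ.mapCoeff f + δ.mapCoeff g := by
  ext m
  simp only [coeff_mapCoeff, MvPolynomial.coeff_add, δ.map_add]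

theorem mapCoeff_mul (f g : MvPolynomial σ F) :
    δ.mapCoeff (f * g) = f * δ.mapCoeff g + δ.mapCoeff f * g := by
  classical
  ext m
  simp only [coeff_mapCoeff, MvPolynomial.coeff_add, MvPolynomial.coeff_mul, δ.map_sum, δ.leibniz,
    Finset.sum_add_distrib]

theorem mapCoeff_C (a : F) : δ.mapCoeff (MvPolynomial.C a : MvPolynomial σ F) = .C (δ.d a) := by
  classical
  ext m
  rw [coeff_mapCoeff, MvPolynomial.coeff_C, MvPolynomial.coeff_C]
  split_ifs
  · rfl
  · exact δ.map_zero

theorem mapCoeff_X (i : σ) : δ.mapCoeff (MvPolynomial.X i : MvPolynomial σ F) = 0 := by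
  classical
  ext m
  rw [coeff_mapCoeff, MvPolynomial.coeff_X, MvPolynomial.coeff_zero]
  split_ifs
  · exact δ.map_one
  · exact δ.map_zero

theorem mapCoeff_sum {ι : Type*} (s : Finset ι) (f : ι → MvPolynomial σ F) :
    δ.mapCoeff (∑ i ∈ s, f i) = ∑ i ∈ s, δ.mapCoeff (f i) := by
  ext m
  simp only [coeff_mapCoeff, MvPolynomial.coeff_sum, δ.map_sum]

/-- A space of polynomials stable under a derivation is spanned by polynomials with constant
coefficients. -/
theorem mem_span_of_mapCoeff_mem {W : Submodule F (MvPolynomial σ F)}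
    (hW : ∀ f ∈ W, δ.mapCoeff f ∈ W) {f : MvPolynomial σ F} (hf : f ∈ W) :
    f ∈ Submodule.span F {g ∈ W | δ.mapCoeff g = 0} := by
  classical
  induction hn : f.support.card using Nat.strong_induction_on generalizing f with
  | _ n ih =>
  by_cases hf0 : f = 0
  · rw [hf0]
    exact zero_mem _
  by_cases hex : ∃ g ∈ W, g ≠ 0 ∧ g.support ⊂ f.support
  · obtain ⟨g, hg, hg0, hgf⟩ := hex
    obtain ⟨m, hm⟩ := MvPolynomial.support_nonempty.2 hg0
    have hm0 : g.coeff m ≠ 0 := MvPolynomial.mem_support_iff.1 hm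
    have hgm := ih _ (hn ▸ Finset.card_lt_card hgf) hg rfl
    have hlt : (f - (f.coeff m / g.coeff m) • g).support ⊂ f.support := by
      refine (Finset.ssubset_iff_of_subset fun m' hm' => ?_).2 ⟨m, hgf.1 hm, ?_⟩
      · by_contra hcon
        have h1 := MvPolynomial.notMem_support_iff.1 hcon
        have h2 := MvPolynomial.notMem_support_iff.1 fun h => hcon (hgf.1 h)
        rw [MvPolynomial.mem_support_iff, MvPolynomial.coeff_sub, MvPolynomial.coeff_smul, h1, h2,
          smul_zero, sub_zero] at hm'
        exact hm' rfl
      · rw [MvPolynomial.notMem_support_iff, MvPolynomial.coeff_sub, MvPolynomial.coeff_smul,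
          smul_eq_mul, div_mul_cancel₀ _ hm0, sub_self]
    have := ih _ (hn ▸ Finset.card_lt_card hlt) (W.sub_mem hf (W.smul_mem _ hg)) rfl
    rw [← sub_add_cancel f ((f.coeff m / g.coeff m) • g)]
    exact add_mem this (Submodule.smul_mem _ _ hgm)
  · obtain ⟨m, hm⟩ := MvPolynomial.support_nonempty.2 hf0
    have hm0 : f.coeff m ≠ 0 := MvPolynomial.mem_support_iff.1 hm
    have hh : (f.coeff m)⁻¹ • f ∈ W := W.smul_mem _ hf
    have hc : δ.mapCoeff ((f.coeff m)⁻¹ • f) = 0 := by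
      by_contra h0
      refine hex ⟨_, hW _ hh, h0, (Finset.ssubset_iff_of_subset fun m' hm' => ?_).2 ⟨m, hm, ?_⟩⟩
      · by_contra hcon
        rw [MvPolynomial.mem_support_iff, coeff_mapCoeff, MvPolynomial.coeff_smul,
          MvPolynomial.notMem_support_iff.1 hcon, smul_zero, δ.map_zero] at hm'
        exact hm' rfl
      · rw [MvPolynomial.notMem_support_iff, coeff_mapCoeff, MvPolynomial.coeff_smul, smul_eq_mul,
          inv_mul_cancel₀ hm0, δ.map_one]
    have : f = f.coeff m • ((f.coeff m)⁻¹ • f) := by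
      rw [smul_smul, mul_inv_cancel₀ hm0, one_smul]
    rw [this]
    exact Submodule.smul_mem _ _ (Submodule.subset_span ⟨hh, hc⟩)

end FieldDeriv

end FieldDeriv

section PicardVessiot

open MvPolynomial TensorProduct

theorem aeval_productMap_eq_zero {K L₁ L₂ ι : Type*} [Field K] [Field L₁] [Field L₂] [Algebra K L₁]
    [Algebra K L₂] {R₁ : Subalgebra K L₁} (φ₁ : R₁ →ₐ[K] K) {R₂ : Subalgebra K L₂}
    (φ₂ : R₂ →ₐ[K] K) {x : ι → R₁ ⊗[K] R₂} {h : MvPolynomial ι K}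
    (hx : aeval (fun i => Algebra.TensorProduct.map R₁.val R₂.val (x i)) h = 0) :
    aeval (fun i => Algebra.TensorProduct.productMap φ₁ φ₂ (x i)) h = 0 := by
  have hinj : Function.Injective (Algebra.TensorProduct.map R₁.val R₂.val) :=
    TensorProduct.map_injective_of_flat_flat R₁.val.toLinearMap R₂.val.toLinearMap
      Subtype.val_injective Subtype.val_injective
  rw [← comp_aeval_apply] at hx ⊢
  rw [(map_eq_zero_iff _ hinj).1 hx, map_zero]

variable {K L₁ L₂ : Type} [Field K] [Field L₁] [Field L₂] [Algebra K L₁] [Algebra K L₂] {n : ℕ}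
  {dK : FieldDeriv K} {d₁ : FieldDeriv L₁} {d₂ : FieldDeriv L₂} {A : Matrix (Fin n) (Fin n) K}
  {F₁ G₁ : Matrix (Fin n) (Fin n) L₁} {F₂ G₂ : Matrix (Fin n) (Fin n) L₂}

/-- The substitution of the generic matrix `X` by `F * X`. -/
noncomputable def mulLeftHom (K : Type) {L : Type} [Field K] [Field L] [Algebra K L]
    (F : Matrix (Fin n) (Fin n) L) :
    MvPolynomial (Fin n × Fin n) K →ₐ[K] MvPolynomial (Fin n × Fin n) L :=
  aeval fun q => ∑ l, C (F q.1 l) * X (l, q.2)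

theorem aeval_mulLeftHom {B : Type*} [CommRing B] [Algebra K B] [Algebra L₁ B]
    [IsScalarTower K L₁ B] (M : Matrix (Fin n) (Fin n) B) (P : MvPolynomial (Fin n × Fin n) K) :
    aeval (fun q => M q.1 q.2) (mulLeftHom K F₁ P) =
      aeval (fun q => (F₁.map (algebraMap L₁ B) * M) q.1 q.2) P := by
  induction P using MvPolynomial.induction_on with
  | C a =>
    simp only [mulLeftHom, algHom_C]
    rw [IsScalarTower.algebraMap_apply K L₁ (MvPolynomial (Fin n × Fin n) L₁),
      MvPolynomial.algebraMap_eq, algHom_C, ← IsScalarTower.algebraMap_apply]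
  | add P Q hP hQ => rw [map_add, map_add, hP, hQ, map_add]
  | mul_X P q hP =>
    rw [map_mul, map_mul, hP, map_mul, aeval_X, mulLeftHom, aeval_X, map_sum, Matrix.mul_apply]
    simp only [map_mul, algHom_C, aeval_X, Matrix.map_apply]

theorem exists_mapCoeff_mulLeftHom_eq (hd₁ : ∀ a : K, d₁.d (algebraMap K L₁ a) = algebraMap K L₁ (dK.d a))
    (hd₂ : ∀ a : K, d₂.d (algebraMap K L₂ a) = algebraMap K L₂ (dK.d a))
    (hF₁ : ∀ i j, d₁.d (F₁ i j) = (A.map (algebraMap K L₁) * F₁) i j)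
    (hF₂ : ∀ i j, d₂.d (F₂ i j) = (A.map (algebraMap K L₂) * F₂) i j)
    (P : MvPolynomial (Fin n × Fin n) K) :
    ∃ Q : MvPolynomial (Fin n × Fin n) K, d₁.mapCoeff (mulLeftHom K F₁ P) = mulLeftHom K F₁ Q ∧
      d₂.d (aeval (fun q => F₂ q.1 q.2) P) = aeval (fun q => F₂ q.1 q.2) Q := by
  have hC : ∀ {L : Type} [Field L] [Algebra K L] (F : Matrix (Fin n) (Fin n) L) (a : K),
      mulLeftHom K F (C a) = C (algebraMap K L a) := by
    intro L _ _ F a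
    rw [mulLeftHom, algHom_C]
    rfl
  induction P using MvPolynomial.induction_on with
  | C a =>
    refine ⟨C (dK.d a), ?_, ?_⟩
    · rw [hC, hC, d₁.mapCoeff_C, hd₁]
    · rw [algHom_C, algHom_C, hd₂]
  | add P P' hP hP' =>
    obtain ⟨Q, h₁, h₂⟩ := hP
    obtain ⟨Q', h₁', h₂'⟩ := hP'
    refine ⟨Q + Q', ?_, ?_⟩
    · rw [map_add, d₁.mapCoeff_add, h₁, h₁', map_add]
    · rw [map_add, d₂.map_add, h₂, h₂', map_add]
  | mul_X P q hP =>
    obtain ⟨Q, h₁, h₂⟩ := hP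
    refine ⟨P * (∑ l, C (A q.1 l) * X (l, q.2)) + Q * X q, ?_, ?_⟩
    · have hX : d₁.mapCoeff (mulLeftHom K F₁ (X q)) =
          mulLeftHom K F₁ (∑ l, C (A q.1 l) * X (l, q.2)) := by
        simp only [map_sum, map_mul, hC]
        simp only [mulLeftHom, aeval_X]
        simp only [d₁.mapCoeff_sum, d₁.mapCoeff_mul, d₁.mapCoeff_X, mul_zero, zero_add,
          d₁.mapCoeff_C, hF₁, Matrix.mul_apply, Matrix.map_apply, map_sum, Finset.sum_mul,
          Finset.mul_sum, map_mul, mul_assoc]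
        exact Finset.sum_comm
      rw [map_mul, d₁.mapCoeff_mul, hX, h₁, map_add, map_mul, map_mul]
    · rw [map_mul, d₂.leibniz, h₂, map_add, map_mul, map_mul, aeval_X, hF₂, Matrix.mul_apply, map_sum]
      simp only [map_mul, algHom_C, aeval_X, Matrix.map_apply]

theorem aeval_mul_eq_zero_of_constants
    (hd₁ : ∀ a : K, d₁.d (algebraMap K L₁ a) = algebraMap K L₁ (dK.d a))
    (hd₂ : ∀ a : K, d₂.d (algebraMap K L₂ a) = algebraMap K L₂ (dK.d a))
    (hF₁ : ∀ i j, d₁.d (F₁ i j) = (A.map (algebraMap K L₁) * F₁) i j)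
    (hF₂ : ∀ i j, d₂.d (F₂ i j) = (A.map (algebraMap K L₂) * F₂) i j)
    (hc : ∀ x : L₁, d₁.d x = 0 → ∃ a : K, dK.d a = 0 ∧ algebraMap K L₁ a = x)
    (hFG : F₁ * G₁ = 1) {D : Matrix (Fin n) (Fin n) K}
    (hD : ∀ h : MvPolynomial (Fin n × Fin n) K, dK.mapCoeff h = 0 →
      aeval (fun q => (G₁.map (algebraMap L₁ (L₁ ⊗[K] L₂)) *
        F₂.map (Algebra.TensorProduct.includeRight : L₂ →ₐ[K] L₁ ⊗[K] L₂)) q.1 q.2) h = 0 →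
      aeval (fun q => D q.1 q.2) h = 0)
    {P : MvPolynomial (Fin n × Fin n) K} (hP : aeval (fun q => F₂ q.1 q.2) P = 0) :
    aeval (fun q => (F₁ * D.map (algebraMap K L₁)) q.1 q.2) P = 0 := by
  set G := G₁.map (algebraMap L₁ (L₁ ⊗[K] L₂)) *
    F₂.map (Algebra.TensorProduct.includeRight : L₂ →ₐ[K] L₁ ⊗[K] L₂) with hG
  let W : Submodule L₁ (MvPolynomial (Fin n × Fin n) L₁) :=
    Submodule.span L₁ (mulLeftHom K F₁ '' {P | aeval (fun q => F₂ q.1 q.2) P = 0})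
  have hW : ∀ f ∈ W, d₁.mapCoeff f ∈ W := by
    intro f hf
    induction hf using Submodule.span_induction with
    | mem f hf =>
      obtain ⟨P, hP, rfl⟩ := hf
      obtain ⟨Q, h₁, h₂⟩ := exists_mapCoeff_mulLeftHom_eq hd₁ hd₂ hF₁ hF₂ P
      rw [h₁]
      refine Submodule.subset_span ⟨Q, ?_, rfl⟩
      change aeval _ Q = 0
      rw [← h₂, hP, d₂.map_zero]
    | zero =>
      rw [show (0 : MvPolynomial (Fin n × Fin n) L₁) = C 0 by simp, d₁.mapCoeff_C, d₁.map_zero]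
      simp
    | add f g _ _ hf hg =>
      rw [d₁.mapCoeff_add]
      exact add_mem hf hg
    | smul a f hfW hf =>
      rw [MvPolynomial.smul_eq_C_mul, d₁.mapCoeff_mul, d₁.mapCoeff_C, ← MvPolynomial.smul_eq_C_mul,
        ← MvPolynomial.smul_eq_C_mul]
      exact add_mem (Submodule.smul_mem _ _ hf) (Submodule.smul_mem _ _ hfW)
  have hWG : ∀ f ∈ W, aeval (fun q => G q.1 q.2) f = 0 := by
    intro f hf
    induction hf using Submodule.span_induction with
    | mem f hf =>
      obtain ⟨P, hP, rfl⟩ := hf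
      have : F₁.map (algebraMap L₁ (L₁ ⊗[K] L₂)) * G =
          F₂.map (Algebra.TensorProduct.includeRight : L₂ →ₐ[K] L₁ ⊗[K] L₂) := by
        rw [hG, ← mul_assoc, ← Matrix.map_mul, hFG, Matrix.map_one _ (map_zero _) (map_one _),
          one_mul]
      rw [aeval_mulLeftHom, this]
      simp only [Matrix.map_apply]
      rw [← comp_aeval_apply, hP, map_zero]
    | zero => exact map_zero _
    | add f g _ _ hf hg => rw [map_add, hf, hg, add_zero]
    | smul a f _ hf => rw [map_smul, hf, smul_zero]
  have hPW : mulLeftHom K F₁ P ∈ W := Submodule.subset_span ⟨P, hP, rfl⟩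
  have key : ∀ f ∈ Submodule.span L₁ {g ∈ W | d₁.mapCoeff g = 0},
      aeval (fun q => (D.map (algebraMap K L₁)) q.1 q.2) f = 0 := by
    intro f hf
    induction hf using Submodule.span_induction with
    | mem f hf =>
      obtain ⟨hfW, hf0⟩ := hf
      have hcoeff : ∀ m, d₁.d (f.coeff m) = 0 := fun m => by
        rw [← d₁.coeff_mapCoeff, hf0, coeff_zero]
      obtain ⟨h, rfl⟩ : f ∈ Set.range (MvPolynomial.map (algebraMap K L₁)) := by
        rw [mem_range_map_iff_coeffs_subset]
        intro c hcf
        obtain ⟨m, -, rfl⟩ := mem_coeffs_iff.1 hcf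
        obtain ⟨a, -, ha⟩ := hc _ (hcoeff m)
        exact ⟨a, ha⟩
      have hh : dK.mapCoeff h = 0 := by
        ext m
        have := hcoeff m
        rw [coeff_map, hd₁, map_eq_zero] at this
        rw [dK.coeff_mapCoeff, this, coeff_zero]
      have h0 := hWG _ hfW
      rw [aeval_map_algebraMap] at h0 ⊢
      simp only [Matrix.map_apply]
      have := hD h hh h0
      change aeval (fun q => Algebra.ofId K L₁ (D q.1 q.2)) h = 0
      rw [← comp_aeval_apply, this, map_zero]
    | zero => exact map_zero _
    | add f g _ _ hf hg => rw [map_add, hf, hg, add_zero]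
    | smul a f _ hf => rw [map_smul, hf, smul_zero]
  have := key _ (d₁.mem_span_of_mapCoeff_mem hW hPW)
  rw [aeval_mulLeftHom] at this
  simpa using this

end PicardVessiot

section PicardVessiotUniqueness

open MvPolynomial TensorProduct

variable {K L₁ L₂ : Type} [Field K] [Field L₁] [Field L₂] [Algebra K L₁] [Algebra K L₂] {n : ℕ}
  {dK : FieldDeriv K} {d₁ : FieldDeriv L₁} {d₂ : FieldDeriv L₂} {A : Matrix (Fin n) (Fin n) K}
  {F₁ G₁ : Matrix (Fin n) (Fin n) L₁} {F₂ G₂ : Matrix (Fin n) (Fin n) L₂}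

theorem Matrix.exists_map_val_eq {R B m : Type*} [CommRing R] [CommRing B] [Algebra R B]
    {S : Subalgebra R B} {M : Matrix m m B} (hM : Set.range (fun q : m × m => M q.1 q.2) ⊆ S) :
    ∃ M' : Matrix m m S, M'.map S.val = M :=
  ⟨fun i j => ⟨M i j, hM ⟨(i, j), rfl⟩⟩, rfl⟩

theorem Matrix.mul_eq_one_of_map_val {R B m : Type*} [CommRing R] [CommRing B] [Algebra R B]
    [Fintype m] [DecidableEq m] {S : Subalgebra R B} {M N : Matrix m m S}
    (h : M.map S.val * N.map S.val = 1) : M * N = 1 := by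
  rw [← Matrix.map_mul, ← Matrix.map_one S.val (map_zero _) (map_one _)] at h
  exact Matrix.map_injective Subtype.val_injective h

theorem exists_point_aeval_eq_zero {p : ℕ} (hp : p.Prime) [CharZero K]
    (hK : IsPAdicallyClosed p K) (h₁ : IsPAdicField p L₁) (h₂ : IsPAdicField p L₂)
    (hFG₁ : F₁ * G₁ = 1) (hFG₂ : F₂ * G₂ = 1) :
    ∃ B B' : Matrix (Fin n) (Fin n) K, B * B' = 1 ∧ ∀ h : MvPolynomial (Fin n × Fin n) K,
      aeval (fun q => (G₁.map (algebraMap L₁ (L₁ ⊗[K] L₂)) *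
        F₂.map (Algebra.TensorProduct.includeRight : L₂ →ₐ[K] L₁ ⊗[K] L₂)) q.1 q.2) h = 0 →
      aeval (fun q => B q.1 q.2) h = 0 := by
  obtain ⟨R₁, σ, hR₁⟩ := hK.exists_algHom_of_finite hp h₁
    ((Set.finite_range fun q : Fin n × Fin n => F₁ q.1 q.2).union
      (Set.finite_range fun q : Fin n × Fin n => G₁ q.1 q.2))
  obtain ⟨R₂, τ, hR₂⟩ := hK.exists_algHom_of_finite hp h₂
    ((Set.finite_range fun q : Fin n × Fin n => F₂ q.1 q.2).union
      (Set.finite_range fun q : Fin n × Fin n => G₂ q.1 q.2))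
  obtain ⟨hR₁, hR₁'⟩ := Set.union_subset_iff.1 hR₁
  obtain ⟨hR₂, hR₂'⟩ := Set.union_subset_iff.1 hR₂
  obtain ⟨f₁, rfl⟩ := Matrix.exists_map_val_eq hR₁
  obtain ⟨g₁, rfl⟩ := Matrix.exists_map_val_eq hR₁'
  obtain ⟨f₂, rfl⟩ := Matrix.exists_map_val_eq hR₂
  obtain ⟨g₂, rfl⟩ := Matrix.exists_map_val_eq hR₂'
  have e₁ : g₁ * f₁ = 1 := mul_eq_one_comm.1 (Matrix.mul_eq_one_of_map_val hFG₁)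
  have e₂ : f₂ * g₂ = 1 := Matrix.mul_eq_one_of_map_val hFG₂
  let x : Matrix (Fin n) (Fin n) (R₁ ⊗[K] R₂) :=
    g₁.map (Algebra.TensorProduct.includeLeft : R₁ →ₐ[K] R₁ ⊗[K] R₂) *
      f₂.map (Algebra.TensorProduct.includeRight : R₂ →ₐ[K] R₁ ⊗[K] R₂)
  refine ⟨g₁.map σ * f₂.map τ, g₂.map τ * f₁.map σ, ?_, fun h hh => ?_⟩
  · rw [mul_assoc, ← mul_assoc (f₂.map τ), ← Matrix.map_mul, e₂, Matrix.map_one _ (map_zero _)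
      (map_one _), one_mul, ← Matrix.map_mul, e₁, Matrix.map_one _ (map_zero _) (map_one _)]
  · have := aeval_productMap_eq_zero σ τ (x := fun q => x q.1 q.2) (h := h) (by
      rw [← hh]
      congr 2
      funext q
      simp [x, Matrix.mul_apply])
    rw [← this]
    congr 2
    funext q
    simp [x, Matrix.mul_apply]

theorem exists_constant_point {p : ℕ} (hp : p.Prime) [CharZero K]
    (hK : IsPAdicallyClosed p K) {B B' : Matrix (Fin n) (Fin n) K} (hB : B * B' = 1) :
    ∃ C C' : Matrix (Fin n) (Fin n) K, C * C' = 1 ∧ (∀ i j, dK.d (C i j) = 0) ∧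
      ∀ h : MvPolynomial (Fin n × Fin n) K, dK.mapCoeff h = 0 →
        aeval (fun q => B q.1 q.2) h = 0 → aeval (fun q => C q.1 q.2) h = 0 := by
  obtain ⟨R, ρ, hR⟩ := hK.exists_algHom_of_isAlgClosedIn hp
    (fun x hx => dK.isAlgebraic_constants hx)
    ((Set.finite_range fun q : Fin n × Fin n => B q.1 q.2).union
      (Set.finite_range fun q : Fin n × Fin n => B' q.1 q.2))
  obtain ⟨hR, hR'⟩ := Set.union_subset_iff.1 hR
  obtain ⟨b, rfl⟩ := Matrix.exists_map_val_eq hR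
  obtain ⟨b', rfl⟩ := Matrix.exists_map_val_eq hR'
  have e : b * b' = 1 := Matrix.mul_eq_one_of_map_val hB
  let ρ' : R →ₐ[dK.constants] K := (Algebra.ofId dK.constants K).comp ρ
  refine ⟨b.map ρ', b'.map ρ', ?_, fun i j => (ρ (b i j)).2, fun h hh h0 => ?_⟩
  · rw [← Matrix.map_mul, e, Matrix.map_one _ (map_zero _) (map_one _)]
  · obtain ⟨g, rfl⟩ : h ∈ Set.range (MvPolynomial.map (algebraMap dK.constants K)) := by
      rw [mem_range_map_iff_coeffs_subset]
      intro c hc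
      obtain ⟨m, -, rfl⟩ := mem_coeffs_iff.1 hc
      exact ⟨⟨h.coeff m, dK.mem_constants.2 (by rw [← dK.coeff_mapCoeff, hh, coeff_zero])⟩, rfl⟩
    rw [aeval_map_algebraMap] at h0 ⊢
    simp only [Matrix.map_apply] at h0 ⊢
    rw [← comp_aeval_apply, map_eq_zero_iff _ Subtype.val_injective] at h0
    rw [← comp_aeval_apply, h0, map_zero]

theorem exists_constant_matrix {p : ℕ} (hp : p.Prime) [CharZero K]
    (hK : IsPAdicallyClosed p K) (h₁ : IsPAdicField p L₁) (h₂ : IsPAdicField p L₂)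
    (hd₁ : ∀ a : K, d₁.d (algebraMap K L₁ a) = algebraMap K L₁ (dK.d a))
    (hd₂ : ∀ a : K, d₂.d (algebraMap K L₂ a) = algebraMap K L₂ (dK.d a))
    (hF₁ : ∀ i j, d₁.d (F₁ i j) = (A.map (algebraMap K L₁) * F₁) i j)
    (hF₂ : ∀ i j, d₂.d (F₂ i j) = (A.map (algebraMap K L₂) * F₂) i j)
    (hc : ∀ x : L₁, d₁.d x = 0 → ∃ a : K, dK.d a = 0 ∧ algebraMap K L₁ a = x)
    (hFG₁ : F₁ * G₁ = 1) (hFG₂ : F₂ * G₂ = 1) :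
    ∃ C C' : Matrix (Fin n) (Fin n) K, C * C' = 1 ∧ (∀ i j, dK.d (C i j) = 0) ∧
      ∀ P : MvPolynomial (Fin n × Fin n) K, aeval (fun q => F₂ q.1 q.2) P = 0 →
        aeval (fun q => (F₁ * C.map (algebraMap K L₁)) q.1 q.2) P = 0 := by
  obtain ⟨B, B', hB, hBz⟩ := exists_point_aeval_eq_zero hp hK h₁ h₂ hFG₁ hFG₂
  obtain ⟨C, C', hC, hdC, hCz⟩ := exists_constant_point (dK := dK) hp hK hB
  exact ⟨C, C', hC, hdC, fun P hP => aeval_mul_eq_zero_of_constants hd₁ hd₂ hF₁ hF₂ hc hFG₁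
    (fun h hh h0 => hCz h hh (hBz h h0)) hP⟩

end PicardVessiotUniqueness

section PicardVessiotIsomorphism

open MvPolynomial

theorem Ideal.comap_eq_of_le_comap_of_surjective {R : Type*} [CommRing R] [IsNoetherianRing R]
    {s : R →+* R} (hs : Function.Surjective s) {I : Ideal R} (hI : I ≤ I.comap s) :
    I.comap s = I := by
  obtain ⟨m, hm⟩ := WellFoundedGT.monotone_chain_condition
    (⟨fun m => I.comap (s ^ m), monotone_nat_of_le_succ fun m x hx => by
      rw [Ideal.mem_comap, pow_succ', RingHom.mul_def, RingHom.comp_apply]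
      exact hI hx⟩ : ℕ →o Ideal R)
  refine le_antisymm (fun x hx => ?_) hI
  obtain ⟨y, rfl⟩ : ∃ y, (s ^ m) y = x := by
    rw [RingHom.coe_pow]
    exact hs.iterate m x
  have hy : y ∈ I.comap (s ^ (m + 1)) := by
    rw [Ideal.mem_comap, pow_succ', RingHom.mul_def, RingHom.comp_apply]
    exact hx
  have h := hm (m + 1) m.le_succ
  simp only [OrderHom.coe_mk] at h
  rwa [← h] at hy

variable {K L₁ L₂ : Type} [Field K] [Field L₁] [Field L₂] [Algebra K L₁] [Algebra K L₂] {n : ℕ}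
  {dK : FieldDeriv K} {d₁ : FieldDeriv L₁} {d₂ : FieldDeriv L₂}

/-- The substitution of the generic matrix `X` by `X * M`. -/
noncomputable def mulRightHom (M : Matrix (Fin n) (Fin n) K) :
    MvPolynomial (Fin n × Fin n) K →ₐ[K] MvPolynomial (Fin n × Fin n) K :=
  aeval fun q => (Matrix.mvPolynomialX (Fin n) (Fin n) K * M.map (C : K →+* _) :
    Matrix (Fin n) (Fin n) (MvPolynomial (Fin n × Fin n) K)) q.1 q.2

theorem aeval_mulRightHom {B : Type*} [CommRing B] [Algebra K B] (N : Matrix (Fin n) (Fin n) B)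
    (M : Matrix (Fin n) (Fin n) K) (P : MvPolynomial (Fin n × Fin n) K) :
    aeval (fun q => N q.1 q.2) (mulRightHom M P) =
      aeval (fun q => (N * M.map (algebraMap K B)) q.1 q.2) P := by
  rw [mulRightHom, comp_aeval_apply]
  congr 2
  funext q
  simp [Matrix.mul_apply, Matrix.mvPolynomialX_apply]

theorem mulRightHom_surjective {M M' : Matrix (Fin n) (Fin n) K} (h : M * M' = 1) :
    Function.Surjective (mulRightHom M) := by
  refine fun P => ⟨mulRightHom M' P, ?_⟩
  rw [mulRightHom, aeval_mulRightHom, ← MvPolynomial.algebraMap_eq, mul_assoc, ← Matrix.map_mul, h,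
    Matrix.map_one _ (map_zero _) (map_one _), mul_one]
  exact aeval_X_left_apply P

theorem aeval_eq_zero_iff_of_constant_matrices {F₁ : Matrix (Fin n) (Fin n) L₁}
    {F₂ : Matrix (Fin n) (Fin n) L₂} {C C' D D' : Matrix (Fin n) (Fin n) K} (hC : C * C' = 1)
    (hD : D * D' = 1)
    (h₂₁ : ∀ P : MvPolynomial (Fin n × Fin n) K, aeval (fun q => F₂ q.1 q.2) P = 0 →
      aeval (fun q => (F₁ * C.map (algebraMap K L₁)) q.1 q.2) P = 0)
    (h₁₂ : ∀ P : MvPolynomial (Fin n × Fin n) K, aeval (fun q => F₁ q.1 q.2) P = 0 →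
      aeval (fun q => (F₂ * D.map (algebraMap K L₂)) q.1 q.2) P = 0)
    (P : MvPolynomial (Fin n × Fin n) K) :
    aeval (fun q => (F₁ * C.map (algebraMap K L₁)) q.1 q.2) P = 0 ↔
      aeval (fun q => F₂ q.1 q.2) P = 0 := by
  refine ⟨fun hP => ?_, h₂₁ P⟩
  have key : ∀ Q : MvPolynomial (Fin n × Fin n) K,
      aeval (fun q => (F₁ * C.map (algebraMap K L₁)) q.1 q.2) Q = 0 →
        aeval (fun q => F₂ q.1 q.2) (mulRightHom (D * C) Q) = 0 := by
    intro Q hQ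
    rw [← aeval_mulRightHom] at hQ
    have := h₁₂ _ hQ
    rwa [aeval_mulRightHom, mul_assoc, ← Matrix.map_mul, ← aeval_mulRightHom] at this
  have hDC : D * C * (C' * D') = 1 := by
    rw [mul_assoc, ← mul_assoc C, hC, one_mul, hD]
  have := Ideal.comap_eq_of_le_comap_of_surjective
    (s := (mulRightHom (D * C)).toRingHom)
    (mulRightHom_surjective hDC) (I := RingHom.ker (aeval fun q : Fin n × Fin n => F₂ q.1 q.2))
    fun Q hQ => key Q (h₂₁ Q hQ)
  exact this.le (key P hP)

theorem isFractionRing_aeval_range {ι : Type*} {x : ι → L₁}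
    (hx : IntermediateField.adjoin K (Set.range x) = ⊤) :
    IsFractionRing (aeval x : MvPolynomial ι K →ₐ[K] L₁).range L₁ := by
  refine IsFractionRing.of_field _ _ fun z => ?_
  obtain ⟨r, s, h⟩ := (IntermediateField.mem_adjoin_range_iff K x z).1 (hx ▸ IntermediateField.mem_top)
  exact ⟨⟨_, r, rfl⟩, ⟨_, s, rfl⟩, h⟩

theorem exists_algEquiv_of_aeval_eq_zero_iff {ι : Type*} {x : ι → L₁} {y : ι → L₂}
    (hx : IntermediateField.adjoin K (Set.range x) = ⊤)
    (hy : IntermediateField.adjoin K (Set.range y) = ⊤)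
    (h : ∀ P : MvPolynomial ι K, aeval x P = 0 ↔ aeval y P = 0) :
    ∃ φ : L₁ ≃ₐ[K] L₂, ∀ i, φ (x i) = y i := by
  have := isFractionRing_aeval_range hx
  have := isFractionRing_aeval_range hy
  have hker : RingHom.ker (aeval x : MvPolynomial ι K →ₐ[K] L₁).rangeRestrict =
      RingHom.ker (aeval y : MvPolynomial ι K →ₐ[K] L₂).rangeRestrict := by
    ext P
    simp only [RingHom.mem_ker, Subtype.ext_iff]
    exact h P
  let e₁ := Ideal.quotientKerAlgEquivOfSurjective
    (aeval x : MvPolynomial ι K →ₐ[K] L₁).rangeRestrict_surjective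
  let e₂ := Ideal.quotientKerAlgEquivOfSurjective
    (aeval y : MvPolynomial ι K →ₐ[K] L₂).rangeRestrict_surjective
  let e := (e₁.symm.trans (Ideal.quotientEquivAlgOfEq K hker)).trans e₂
  refine ⟨IsFractionRing.fieldEquivOfAlgEquiv K L₁ L₂ e, fun i => ?_⟩
  have h₁ : e₁ (Ideal.Quotient.mk _ (X i)) = ⟨x i, X i, aeval_X _ _⟩ :=
    Subtype.ext (aeval_X x i)
  have he : e ⟨x i, X i, aeval_X _ _⟩ = ⟨y i, X i, aeval_X _ _⟩ := by
    rw [← h₁]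
    simp only [e, AlgEquiv.trans_apply, AlgEquiv.symm_apply_apply]
    exact Subtype.ext (aeval_X y i)
  have := IsFractionRing.fieldEquivOfAlgEquiv_algebraMap K L₁ L₂ e ⟨x i, X i, aeval_X _ _⟩
  rw [he] at this
  exact this

theorem algEquiv_comm_derivation_of_adjoin_eq_top (φ : L₁ ≃ₐ[K] L₂) {S : Set L₁}
    (hS : IntermediateField.adjoin K S = ⊤)
    (hd₁ : ∀ a : K, d₁.d (algebraMap K L₁ a) = algebraMap K L₁ (dK.d a))
    (hd₂ : ∀ a : K, d₂.d (algebraMap K L₂ a) = algebraMap K L₂ (dK.d a))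
    (h : ∀ x ∈ S, φ (d₁.d x) = d₂.d (φ x)) (x : L₁) : φ (d₁.d x) = d₂.d (φ x) := by
  have hx : x ∈ IntermediateField.adjoin K S := hS ▸ IntermediateField.mem_top
  induction hx using IntermediateField.adjoin_induction with
  | mem x hx => exact h x hx
  | algebraMap a => rw [hd₁, φ.commutes, φ.commutes, hd₂]
  | add x y _ _ hx hy => rw [d₁.map_add, map_add, map_add, hx, hy, d₂.map_add]
  | inv x _ hx => simp only [FieldDeriv.map_inv, map_neg, map_mul, map_inv₀, hx]
  | mul x y _ _ hx hy => rw [d₁.leibniz, map_add, map_mul, map_mul, map_mul, hx, hy, d₂.leibniz]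

theorem derivation_mul_constant_matrix {A : Matrix (Fin n) (Fin n) K}
    {F : Matrix (Fin n) (Fin n) L₁} {C : Matrix (Fin n) (Fin n) K}
    (hd₁ : ∀ a : K, d₁.d (algebraMap K L₁ a) = algebraMap K L₁ (dK.d a))
    (hF : ∀ i j, d₁.d (F i j) = (A.map (algebraMap K L₁) * F) i j)
    (hC : ∀ i j, dK.d (C i j) = 0) (i j : Fin n) :
    d₁.d ((F * C.map (algebraMap K L₁)) i j) =
      (A.map (algebraMap K L₁) * (F * C.map (algebraMap K L₁))) i j := by
  rw [← mul_assoc, Matrix.mul_apply, Matrix.mul_apply, FieldDeriv.map_sum]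
  refine Finset.sum_congr rfl fun l _ => ?_
  rw [d₁.leibniz, Matrix.map_apply, hd₁, hC, map_zero, mul_zero, zero_add, hF]

theorem adjoin_mul_map_eq_top {F : Matrix (Fin n) (Fin n) L₁} {C C' : Matrix (Fin n) (Fin n) K}
    (hC : C * C' = 1)
    (hF : IntermediateField.adjoin K (Set.range fun q : Fin n × Fin n => F q.1 q.2) = ⊤) :
    IntermediateField.adjoin K
      (Set.range fun q : Fin n × Fin n => (F * C.map (algebraMap K L₁)) q.1 q.2) = ⊤ := by
  rw [eq_top_iff, ← hF, IntermediateField.adjoin_le_iff]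
  rintro _ ⟨⟨i, j⟩, rfl⟩
  have h : F = F * C.map (algebraMap K L₁) * C'.map (algebraMap K L₁) := by
    rw [mul_assoc, ← Matrix.map_mul, hC, Matrix.map_one _ (map_zero _) (map_one _), mul_one]
  change F i j ∈ IntermediateField.adjoin K _
  rw [h, Matrix.mul_apply]
  exact sum_mem fun l _ => mul_mem (IntermediateField.subset_adjoin _ _ ⟨(i, l), by rw [← h]⟩)
    (IntermediateField.algebraMap_mem _ _)

end PicardVessiotIsomorphism

/-- Over a p-adically closed differential field `K` (with field of
constants `k ≠ K`), any two p-adic Picard--Vessiot fields for `y' = A y` are isomorphic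
as differential field extensions of `K`. -/
theorem padic_picard_vessiot_unique_over_padically_closed
    (p : ℕ) (hp : p.Prime)
    (K : Type) [Field K] [CharZero K] (dK : FieldDeriv K)
    (hKpc : IsPAdicallyClosed p K)
    (hkK : ∃ a : K, dK.d a ≠ 0)
    (n : ℕ) (A : Matrix (Fin n) (Fin n) K)
    (L₁ L₂ : Type) [Field L₁] [Field L₂] [Algebra K L₁] [Algebra K L₂]
    (d₁ : FieldDeriv L₁) (d₂ : FieldDeriv L₂)
    (hPV₁ : IsPicardVessiot dK d₁ A) (hpadic₁ : IsPAdicField p L₁)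
    (hPV₂ : IsPicardVessiot dK d₂ A) (hpadic₂ : IsPAdicField p L₂) :
    ∃ φ : L₁ ≃ₐ[K] L₂, ∀ x : L₁, φ (d₁.d x) = d₂.d (φ x) := by
  obtain ⟨hd₁, F₁, hu₁, hF₁, hgen₁, hc₁⟩ := hPV₁
  obtain ⟨hd₂, F₂, hu₂, hF₂, hgen₂, hc₂⟩ := hPV₂
  have hG₁ := Matrix.mul_nonsing_inv F₁ hu₁
  have hG₂ := Matrix.mul_nonsing_inv F₂ hu₂
  obtain ⟨C, C', hCC', hC, h₂₁⟩ :=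
    exists_constant_matrix hp hKpc hpadic₁ hpadic₂ hd₁ hd₂ hF₁ hF₂ hc₁ hG₁ hG₂
  obtain ⟨D, D', hDD', -, h₁₂⟩ :=
    exists_constant_matrix hp hKpc hpadic₂ hpadic₁ hd₂ hd₁ hF₂ hF₁ hc₂ hG₂ hG₁
  have htop := adjoin_mul_map_eq_top hCC' hgen₁
  obtain ⟨φ, hφ⟩ := exists_algEquiv_of_aeval_eq_zero_iff htop hgen₂
    (aeval_eq_zero_iff_of_constant_matrices hCC' hDD' h₂₁ h₁₂)
  refine ⟨φ, algEquiv_comm_derivation_of_adjoin_eq_top φ htop hd₁ hd₂ ?_⟩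
  rintro _ ⟨⟨i, j⟩, rfl⟩
  have hφ' : ∀ i j, φ ((F₁ * C.map (algebraMap K L₁)) i j) = F₂ i j := fun i j => hφ (i, j)
  simp only [derivation_mul_constant_matrix hd₁ hF₁ hC, hφ', hF₂]
  rw [Matrix.mul_apply, Matrix.mul_apply, map_sum]
  simp only [map_mul, hφ', Matrix.map_apply, φ.commutes]
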